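/- arXiv:1803.00164 — 17 statements merged into one kernel-verified Lean document; each statement's English description precedes it below -/
import Mathlib

section
/- Assume (N0). For each integer k ≥ 1, the function d ↦ ε_*(k,d), defined on (d_k, ∞), attains its global maximum value ε₁ = (√(2u*v*) − 1)²/u*² exactly at the point d = d_M(k) = u*²/((√(2u*v*) − 1) k²π²). Moreover, the sequence k ↦ d_M(k) is strictly decreasing in k. -/
/-- Under (N0), for each integer `k ≥ 1` the function `d ↦ ε_*(k,d)` on `(d_k, ∞)`
attains its global maximum value `ε₁` exactly at `d = d_M k`, and `k ↦ d_M k`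
is strictly decreasing. -/
theorem epsilonStar_max_at_dM
    (a b : ℝ) (ha : 0 < a) (hb : 0 < b)
    (u v : ℝ) (hu : u = a + b) (hv : v = b / (a + b) ^ 2)
    (hN0 : u ^ 2 > 2 * u * v - 1 ∧ 2 * u * v - 1 > 0)
    (ε₁ : ℝ) (hε₁ : ε₁ = (Real.sqrt (2 * u * v) - 1) ^ 2 / u ^ 2)
    (dk dM : ℕ → ℝ)
    (hdk : ∀ k : ℕ, dk k = u ^ 2 / ((2 * u * v - 1) * (k : ℝ) ^ 2 * Real.pi ^ 2))
    (hdM : ∀ k : ℕ, dM k = u ^ 2 / ((Real.sqrt (2 * u * v) - 1) * (k : ℝ) ^ 2 * Real.pi ^ 2))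
    (εs : ℕ → ℝ → ℝ)
    (hεs : ∀ (k : ℕ) (d : ℝ), εs k d =
      ((2 * u * v - 1) * d * (k : ℝ) ^ 2 * Real.pi ^ 2 - u ^ 2) /
        (d * (k : ℝ) ^ 2 * Real.pi ^ 2 * (d * (k : ℝ) ^ 2 * Real.pi ^ 2 + u ^ 2))) :
    (∀ k : ℕ, 1 ≤ k →
        dk k < dM k ∧ εs k (dM k) = ε₁ ∧
          ∀ d : ℝ, dk k < d → εs k d ≤ ε₁ ∧ (εs k d = ε₁ ↔ d = dM k)) ∧
      (∀ k j : ℕ, 1 ≤ k → k < j → dM j < dM k) := by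
  have hupos : 0 < u := by rw [hu]; positivity
  obtain ⟨-, hN⟩ := hN0
  have hs2 : Real.sqrt (2 * u * v) ^ 2 = 2 * u * v := Real.sq_sqrt (by linarith)
  have hs0 := Real.sqrt_nonneg (2 * u * v)
  generalize hs : Real.sqrt (2 * u * v) = s at *
  rw [← hs2] at hN
  simp only [← hs2] at hdk hεs
  have hs1 : 0 < s - 1 := by nlinarith
  have hU : 0 < u ^ 2 := by positivity
  generalize u ^ 2 = U at *
  have hpi : 0 < Real.pi ^ 2 := by positivity
  generalize Real.pi ^ 2 = P at *
  constructor
  · intro k hk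
    have hk0 : (0 : ℝ) < (k : ℝ) ^ 2 := by
      have : (0 : ℝ) < k := by exact_mod_cast hk
      positivity
    have hdkpos : 0 < dk k := by rw [hdk]; positivity
    have hlt : dk k < dM k := by
      rw [hdk, hdM]
      have : s - 1 < s ^ 2 - 1 := by nlinarith
      gcongr
    have key : ∀ d : ℝ, 0 < d → ε₁ - εs k d =
        ((s - 1) * (d * (k : ℝ) ^ 2 * P) - U) ^ 2 /
          (U * (d * (k : ℝ) ^ 2 * P * (d * (k : ℝ) ^ 2 * P + U))) := by
      intro d hd
      rw [hε₁, hεs]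
      have : d * (k : ℝ) ^ 2 * P + U ≠ 0 := by positivity
      field_simp
      ring
    have hiff : ∀ d : ℝ, 0 < d → (εs k d = ε₁ ↔ d = dM k) := by
      intro d hd
      have h1 := key d hd
      have hD : U * (d * (k : ℝ) ^ 2 * P * (d * (k : ℝ) ^ 2 * P + U)) ≠ 0 := by positivity
      rw [hdM, eq_div_iff (by positivity), eq_comm, ← sub_eq_zero, h1, div_eq_zero_iff,
        or_iff_left hD, pow_eq_zero_iff two_ne_zero, sub_eq_zero]
      constructor <;> intro h <;> linarith
    refine ⟨hlt, (hiff _ (hdkpos.trans hlt)).2 rfl, fun d hd => ⟨?_, hiff d (hdkpos.trans hd)⟩⟩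
    have hd0 := hdkpos.trans hd
    have h1 := key d hd0
    have : 0 ≤ ε₁ - εs k d := by rw [h1]; positivity
    linarith
  · intro k j hk hkj
    have hk0 : (0 : ℝ) < k := by exact_mod_cast hk
    have hkj' : (k : ℝ) < j := by exact_mod_cast hkj
    rw [hdM, hdM]
    gcongr
end

section
/- Assume (N0). For each integer k ≥ 1, the function d ↦ ε_*(k,d) is strictly decreasing on the interval (d_M(k), ∞), where d_M(k) = u*²/((√(2u*v*) − 1) k²π²). Moreover, for every d > d_M(k) one has ε_*(k+1,d) < ε_*(k,d). -/
theorem aux_dec (s w x y : ℝ) (hs : 1 < s) (hw : 0 < w) (hx : w / (s - 1) < x) (hxy : x < y) :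
    ((s ^ 2 - 1) * y - w) / (y * (y + w)) < ((s ^ 2 - 1) * x - w) / (x * (x + w)) := by
  have hs1 : 0 < s - 1 := by linarith
  have hx0 : 0 < x := lt_trans (by positivity) hx
  have hy0 : 0 < y := by linarith
  rw [div_lt_iff₀ hs1] at hx
  have hp : 0 < x * (s - 1) - w := by linarith
  have hq : 0 < y * (s - 1) - w := by nlinarith
  have hE : 0 < (s - 1) * ((s ^ 2 - 1) * x * y - w * (x + y) - w ^ 2) := by
    have h : (s - 1) * ((s ^ 2 - 1) * x * y - w * (x + y) - w ^ 2)
        = (s + 1) * ((x * (s - 1) - w) * (y * (s - 1) - w))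
          + s * w * ((x * (s - 1) - w) + (y * (s - 1) - w)) := by ring
    rw [h]
    have : 0 < s := by linarith
    positivity
  have hE' := pos_of_mul_pos_right hE hs1.le
  rw [div_lt_div_iff₀ (by positivity) (by positivity)]
  have := mul_pos (sub_pos.2 hxy) hE'
  linarith [this, show (y - x) * ((s ^ 2 - 1) * x * y - w * (x + y) - w ^ 2) =
    ((s ^ 2 - 1) * x - w) * (y * (y + w)) - ((s ^ 2 - 1) * y - w) * (x * (x + w)) by ring]

/-- Under (N0), for each integer `k ≥ 1` the function `d ↦ ε_*(k,d)` is strictly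
decreasing on `(d_M k, ∞)`, and for every `d > d_M k` one has
`ε_*(k+1,d) < ε_*(k,d)`. -/
theorem epsilonStar_strict_decreasing
    (a b : ℝ) (ha : 0 < a) (hb : 0 < b)
    (u v : ℝ) (hu : u = a + b) (hv : v = b / (a + b) ^ 2)
    (hN0 : u ^ 2 > 2 * u * v - 1 ∧ 2 * u * v - 1 > 0)
    (dM : ℕ → ℝ)
    (hdM : ∀ k : ℕ, dM k = u ^ 2 / ((Real.sqrt (2 * u * v) - 1) * (k : ℝ) ^ 2 * Real.pi ^ 2))
    (εs : ℕ → ℝ → ℝ)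
    (hεs : ∀ (k : ℕ) (d : ℝ), εs k d =
      ((2 * u * v - 1) * d * (k : ℝ) ^ 2 * Real.pi ^ 2 - u ^ 2) /
        (d * (k : ℝ) ^ 2 * Real.pi ^ 2 * (d * (k : ℝ) ^ 2 * Real.pi ^ 2 + u ^ 2))) :
    ∀ k : ℕ, 1 ≤ k →
      (∀ d₁ d₂ : ℝ, dM k < d₁ → d₁ < d₂ → εs k d₂ < εs k d₁) ∧
        (∀ d : ℝ, dM k < d → εs (k + 1) d < εs k d) := by
  have hu0 : 0 < u := by rw [hu]; linarith
  have hw : 0 < u ^ 2 := by positivity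
  have hs : 1 < Real.sqrt (2 * u * v) := by
    rw [Real.lt_sqrt (by norm_num)]; linarith [hN0.2]
  have hsq : Real.sqrt (2 * u * v) ^ 2 = 2 * u * v := Real.sq_sqrt (by linarith [hN0.2])
  have hs1 : 0 < Real.sqrt (2 * u * v) - 1 := by linarith
  have hf : ∀ (k : ℕ) (d : ℝ), εs k d =
      ((Real.sqrt (2 * u * v) ^ 2 - 1) * (d * ((k : ℝ) ^ 2 * Real.pi ^ 2)) - u ^ 2) /
        ((d * ((k : ℝ) ^ 2 * Real.pi ^ 2)) * ((d * ((k : ℝ) ^ 2 * Real.pi ^ 2)) + u ^ 2)) := by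
    intro k d
    rw [hεs, hsq]
    simp only [mul_assoc]
  intro k hk
  have hk0 : (0 : ℝ) < k := by exact_mod_cast hk
  have hπ := Real.pi_pos
  have hK : 0 < (k : ℝ) ^ 2 * Real.pi ^ 2 := by positivity
  have key : ∀ d, dM k < d →
      u ^ 2 / (Real.sqrt (2 * u * v) - 1) < d * ((k : ℝ) ^ 2 * Real.pi ^ 2) := by
    intro d hd
    rwa [hdM, mul_assoc, ← div_div, div_lt_iff₀ hK] at hd
  refine ⟨fun d₁ d₂ h1 h2 => ?_, fun d hd => ?_⟩
  · rw [hf, hf]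
    exact aux_dec _ _ _ _ hs hw (key _ h1) (mul_lt_mul_of_pos_right h2 hK)
  · have hd0 : 0 < d := by
      refine lt_trans ?_ hd
      rw [hdM]
      positivity
    rw [hf, hf]
    refine aux_dec _ _ _ _ hs hw (key _ hd) ?_
    push_cast
    gcongr
    linarith
end

section
/- Assume (N0). For each integer k ≥ 1, the equation ε_*(k,d) = ε_*(k+1,d) in the variable d > 0 (on the common domain where both sides are defined) has exactly one root d_{k,k+1}; it lies in the open interval (d_M(k+1), d_M(k)), where d_M(j) = u*²/((√(2u*v*) − 1) j²π²), and it is given explicitly by d_{k,k+1} = (u*²/(2π²(2u*v* − 1))) · [ 1/k² + 1/(k+1)² + √( (1/k² + 1/(k+1)²)² + 4(2u*v* − 1)/(k²(k+1)²) ) ]. Moreover, for every d > d_{k,k+1} and every integer j ≥ k one has ε_*(j,d) > ε_*(j+1,d), i.e., ε_*(k,d) > ε_*(k+1,d) > ε_*(k+2,d) > ⋯ . -/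
def QQ (m U x y : ℝ) : ℝ := m * x * y - U * (x + y) - U ^ 2

lemma f_diff (m U x y : ℝ) (hU : 0 < U) (hx : 0 < x) (hy : 0 < y) :
    (m * x - U) / (x * (x + U)) - (m * y - U) / (y * (y + U)) =
      (y - x) * QQ m U x y / (x * (x + U) * (y * (y + U))) := by
  have h1 : x + U ≠ 0 := by positivity
  have h2 : y + U ≠ 0 := by positivity
  unfold QQ
  field_simp
  ring

lemma QQ_mono (m U x y x' y' : ℝ) (hm : 0 < m) (hU : 0 < U) (hx : 0 < x) (hy : 0 < y)
    (hxx : x ≤ x') (hyy : y ≤ y') (h : 0 < QQ m U x y) : 0 < QQ m U x' y' := by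
  unfold QQ at *
  have h1 : 0 < m * x - U := by
    have : 0 < (m * x - U) * y := by nlinarith [mul_pos hU hx, mul_pos hU hU]
    exact pos_of_mul_pos_left this hy.le
  have h2 : 0 < m * y - U := by
    have : 0 < (m * y - U) * x := by nlinarith [mul_pos hU hy, mul_pos hU hU]
    exact pos_of_mul_pos_left this hx.le
  have h3 := mul_nonneg h1.le (sub_nonneg.2 hyy)
  have h4 := mul_nonneg h2.le (sub_nonneg.2 hxx)
  have h5 := mul_nonneg hm.le (mul_nonneg (sub_nonneg.2 hxx) (sub_nonneg.2 hyy))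
  nlinarith

lemma QQ_factor (m U P A B D d : ℝ) (hm : 0 < m) (hU : 0 < U) (hP : 0 < P) (hA : 0 < A)
    (hB : 0 < B) (hD : 0 < D) (hd : 0 < d) (h : QQ m U (D * A * P) (D * B * P) = 0) :
    ∃ c : ℝ, 0 < c ∧ QQ m U (d * A * P) (d * B * P) = (d - D) * c := by
  refine ⟨m * P ^ 2 * A * B * d + U ^ 2 / D, by positivity, ?_⟩
  unfold QQ at *
  have h' : U ^ 2 / D = m * P ^ 2 * A * B * D - U * P * (A + B) := by
    field_simp
    linarith
  rw [h']
  linear_combination h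

lemma root_D (m U P A B D : ℝ) (hm : 0 < m) (hU : 0 < U) (hP : 0 < P) (hA : 0 < A)
    (hB : 0 < B) (h : D = U / (2 * P * m) * (1 / A + 1 / B +
      Real.sqrt ((1 / A + 1 / B) ^ 2 + 4 * m / (A * B)))) :
    0 < D ∧ QQ m U (D * A * P) (D * B * P) = 0 := by
  have hs := Real.sq_sqrt (show 0 ≤ (1 / A + 1 / B) ^ 2 + 4 * m / (A * B) by positivity)
  have hs0 := Real.sqrt_nonneg ((1 / A + 1 / B) ^ 2 + 4 * m / (A * B))
  generalize Real.sqrt ((1 / A + 1 / B) ^ 2 + 4 * m / (A * B)) = s at *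
  subst h
  refine ⟨by positivity, ?_⟩
  unfold QQ
  have e : m * (U / (2 * P * m) * (1 / A + 1 / B + s) * A * P) *
      (U / (2 * P * m) * (1 / A + 1 / B + s) * B * P) -
      U * (U / (2 * P * m) * (1 / A + 1 / B + s) * A * P +
      U / (2 * P * m) * (1 / A + 1 / B + s) * B * P) - U ^ 2 =
      U ^ 2 * A * B / (4 * m) * (s ^ 2 - ((1 / A + 1 / B) ^ 2 + 4 * m / (A * B))) := by
    field_simp
    ring
  rw [e, hs]; ring

lemma QQ_M (m U r x : ℝ) (hm : m = r ^ 2 - 1) (hr : 1 < r) (hx : x = U / (r - 1)) :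
    QQ m U x x = 0 := by
  have : r - 1 ≠ 0 := by linarith
  subst hm hx
  unfold QQ
  field_simp
  ring

/-- Under (N0), for each `k ≥ 1` the equation `ε_*(k,d) = ε_*(k+1,d)` (for `d` in the
common domain `d > d_k`) has exactly one root `d_{k,k+1}`, lying in `(d_M (k+1), d_M k)`
and given by the explicit formula; moreover `ε_*(j,d) > ε_*(j+1,d)` for all
`d > d_{k,k+1}` and all integers `j ≥ k`. -/
theorem epsilonStar_intersection_dkk
    (a b : ℝ) (ha : 0 < a) (hb : 0 < b)
    (u v : ℝ) (hu : u = a + b) (hv : v = b / (a + b) ^ 2)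
    (hN0 : u ^ 2 > 2 * u * v - 1 ∧ 2 * u * v - 1 > 0)
    (dk dM : ℕ → ℝ)
    (hdk : ∀ k : ℕ, dk k = u ^ 2 / ((2 * u * v - 1) * (k : ℝ) ^ 2 * Real.pi ^ 2))
    (hdM : ∀ k : ℕ, dM k = u ^ 2 / ((Real.sqrt (2 * u * v) - 1) * (k : ℝ) ^ 2 * Real.pi ^ 2))
    (εs : ℕ → ℝ → ℝ)
    (hεs : ∀ (k : ℕ) (d : ℝ), εs k d =
      ((2 * u * v - 1) * d * (k : ℝ) ^ 2 * Real.pi ^ 2 - u ^ 2) /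
        (d * (k : ℝ) ^ 2 * Real.pi ^ 2 * (d * (k : ℝ) ^ 2 * Real.pi ^ 2 + u ^ 2)))
    (dkk : ℕ → ℝ)
    (hdkk : ∀ k : ℕ, dkk k =
      u ^ 2 / (2 * Real.pi ^ 2 * (2 * u * v - 1)) *
        (1 / (k : ℝ) ^ 2 + 1 / ((k : ℝ) + 1) ^ 2 +
          Real.sqrt ((1 / (k : ℝ) ^ 2 + 1 / ((k : ℝ) + 1) ^ 2) ^ 2 +
            4 * (2 * u * v - 1) / ((k : ℝ) ^ 2 * ((k : ℝ) + 1) ^ 2)))) :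
    ∀ k : ℕ, 1 ≤ k →
      dM (k + 1) < dkk k ∧ dkk k < dM k ∧
        εs k (dkk k) = εs (k + 1) (dkk k) ∧
        (∀ d : ℝ, dk k < d → εs k d = εs (k + 1) d → d = dkk k) ∧
        (∀ d : ℝ, dkk k < d → ∀ j : ℕ, k ≤ j → εs j d > εs (j + 1) d) := by
  have hu0 : 0 < u := by rw [hu]; positivity
  obtain ⟨-, hm⟩ := hN0
  have hr1 : 1 < Real.sqrt (2 * u * v) := by
    rw [Real.lt_sqrt] <;> linarith
  have hr2 : 2 * u * v - 1 = Real.sqrt (2 * u * v) ^ 2 - 1 := by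
    rw [Real.sq_sqrt (by linarith)]
  generalize Real.sqrt (2 * u * v) = r at *
  generalize 2 * u * v - 1 = m at *
  have hU : 0 < u ^ 2 := by positivity
  generalize u ^ 2 = U at *
  have hP : 0 < Real.pi ^ 2 := by positivity
  generalize Real.pi ^ 2 = P at *
  have hm' : 0 < m := hm
  have hr0 : 0 < r - 1 := by linarith
  intro k hk
  have hk0 : (0 : ℝ) < k := by exact_mod_cast hk
  have hA : (0 : ℝ) < (k : ℝ) ^ 2 := by positivity
  have hB : (0 : ℝ) < ((k : ℝ) + 1) ^ 2 := by positivity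
  have hAB : (k : ℝ) ^ 2 < ((k : ℝ) + 1) ^ 2 := by nlinarith
  obtain ⟨hD, hQ⟩ := root_D m U P _ _ _ hm' hU hP hA hB (hdkk k)
  have hdiff : ∀ (j : ℕ), 1 ≤ j → ∀ d : ℝ, 0 < d → ∃ c : ℝ, 0 < c ∧ εs j d - εs (j + 1) d =
      c * QQ m U (d * (j : ℝ) ^ 2 * P) (d * ((j : ℝ) + 1) ^ 2 * P) := by
    intro j hj d hd
    have hj0 : (0 : ℝ) < j := by exact_mod_cast hj
    have hx : 0 < d * (j : ℝ) ^ 2 * P := by positivity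
    have hy : 0 < d * ((j : ℝ) + 1) ^ 2 * P := by positivity
    have hxy : d * (j : ℝ) ^ 2 * P < d * ((j : ℝ) + 1) ^ 2 * P := by
      have : (j : ℝ) ^ 2 < ((j : ℝ) + 1) ^ 2 := by nlinarith
      gcongr
    have h := f_diff m U _ _ hU hx hy
    rw [hεs, hεs]
    push_cast
    have e1 : ∀ z : ℝ, m * d * z * P = m * (d * z * P) := fun z => by ring
    rw [e1, e1, h]
    generalize d * (j : ℝ) ^ 2 * P = x at *
    generalize d * ((j : ℝ) + 1) ^ 2 * P = y at *
    refine ⟨(y - x) / (x * (x + U) * (y * (y + U))), ?_, by ring⟩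
    have := sub_pos.2 hxy
    positivity
  refine ⟨?_, ?_, ?_, ?_, ?_⟩
  · have hd : 0 < dM (k + 1) := by rw [hdM]; positivity
    obtain ⟨c, hc, h⟩ := QQ_factor m U P _ _ _ _ hm' hU hP hA hB hD hd hQ
    have hy := QQ_M m U r (dM (k + 1) * ((k : ℝ) + 1) ^ 2 * P) hr2 hr1 (by
      rw [hdM]; push_cast; field_simp)
    have hxy : dM (k + 1) * (k : ℝ) ^ 2 * P < dM (k + 1) * ((k : ℝ) + 1) ^ 2 * P := by gcongr
    have hx0 : 0 < dM (k + 1) * (k : ℝ) ^ 2 * P := by positivity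
    by_contra hcon
    have h0 : 0 ≤ (dM (k + 1) - dkk k) * c := mul_nonneg (by linarith) hc.le
    rw [← h] at h0
    generalize dM (k + 1) * (k : ℝ) ^ 2 * P = x at *
    generalize dM (k + 1) * ((k : ℝ) + 1) ^ 2 * P = y at *
    unfold QQ at h0 hy
    have hy0 : 0 < y := by linarith
    have h1 : 0 < m * y - U := by
      have : 0 < (m * y - U) * y := by nlinarith [mul_pos hU hy0, mul_pos hU hU]
      exact pos_of_mul_pos_left this hy0.le
    nlinarith [mul_pos h1 (sub_pos.2 hxy)]
  · have hd : 0 < dM k := by rw [hdM]; positivity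
    obtain ⟨c, hc, h⟩ := QQ_factor m U P _ _ _ _ hm' hU hP hA hB hD hd hQ
    have hx := QQ_M m U r (dM k * (k : ℝ) ^ 2 * P) hr2 hr1 (by
      rw [hdM]; field_simp)
    have hxy : dM k * (k : ℝ) ^ 2 * P < dM k * ((k : ℝ) + 1) ^ 2 * P := by gcongr
    have hx0 : 0 < dM k * (k : ℝ) ^ 2 * P := by positivity
    by_contra hcon
    have h0 : (dM k - dkk k) * c ≤ 0 := mul_nonpos_of_nonpos_of_nonneg (by linarith) hc.le
    rw [← h] at h0
    generalize dM k * (k : ℝ) ^ 2 * P = x at *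
    generalize dM k * ((k : ℝ) + 1) ^ 2 * P = y at *
    unfold QQ at h0 hx
    have h1 : 0 < m * x - U := by
      have : 0 < (m * x - U) * x := by nlinarith [mul_pos hU hx0, mul_pos hU hU]
      exact pos_of_mul_pos_left this hx0.le
    nlinarith [mul_pos h1 (sub_pos.2 hxy)]
  · obtain ⟨c, hc, h⟩ := hdiff k hk _ hD
    rw [hQ] at h
    linarith
  · intro d hd he
    have hd0 : 0 < d := by
      refine lt_trans ?_ hd
      rw [hdk]; positivity
    obtain ⟨c, hc, h⟩ := hdiff k hk d hd0
    obtain ⟨c', hc', h'⟩ := QQ_factor m U P _ _ _ _ hm' hU hP hA hB hD hd0 hQ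
    rw [h', he, sub_self] at h
    have : d - dkk k = 0 := by
      rcases mul_eq_zero.1 h.symm with h | h
      · linarith
      · rcases mul_eq_zero.1 h with h | h <;> linarith
    linarith
  · intro d hd j hj
    have hd0 : 0 < d := lt_trans hD hd
    obtain ⟨c, hc, h⟩ := hdiff j (hk.trans hj) d hd0
    obtain ⟨c', hc', h'⟩ := QQ_factor m U P _ _ _ _ hm' hU hP hA hB hD hd0 hQ
    have hjk : (k : ℝ) ≤ j := by exact_mod_cast hj
    have hq : 0 < QQ m U (d * (k : ℝ) ^ 2 * P) (d * ((k : ℝ) + 1) ^ 2 * P) := by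
      rw [h']; exact mul_pos (by linarith) hc'
    have := QQ_mono m U _ _ (d * (j : ℝ) ^ 2 * P) (d * ((j : ℝ) + 1) ^ 2 * P) hm' hU
      (by positivity) (by positivity) (by gcongr) (by gcongr) hq
    have := mul_pos hc this
    linarith
end

section
/- Assume (N0). Define ε_*(d) piecewise by ε_*(d) = ε_*(k,d) for d ∈ [d_{k,k+1}, d_{k−1,k}) and k ≥ 1, with the convention d_{0,1} = +∞. Then ε_*(d) ≤ ε_B(d) for every d > 0, and equality ε_*(d) = ε_B(d) holds if and only if d = d_M(k) = u*²/((√(2u*v*) − 1) k²π²) for some integer k ≥ 1. -/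
lemma aux_f {s U x : ℝ} (hs : 1 < s) (hU : 0 < U) (hx : 0 < x) :
    (s - 1) ^ 2 / U - ((s ^ 2 - 1) * x - U) / (x * (x + U)) =
      ((s - 1) * x - U) ^ 2 / (U * (x * (x + U))) := by
  have : x + U ≠ 0 := by positivity
  field_simp
  ring

lemma aux_g {s U x y : ℝ} (hs : 1 < s) (hU : 0 < U) (hy : 0 < y) (hyx : y ≤ x) :
    ((s ^ 2 - 1) * x - U) / (x * (x + U)) < (s ^ 2 - 1) / (y + U) := by
  have hx : 0 < x := lt_of_lt_of_le hy hyx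
  have hp : 0 < s ^ 2 - 1 := by nlinarith
  calc ((s ^ 2 - 1) * x - U) / (x * (x + U)) < ((s ^ 2 - 1) * x) / (x * (x + U)) := by
        apply div_lt_div_of_pos_right _ (by positivity)
        linarith
    _ = (s ^ 2 - 1) / (x + U) := by
        rw [mul_comm x (x + U)]; exact mul_div_mul_right _ _ hx.ne'
    _ ≤ (s ^ 2 - 1) / (y + U) := by
        apply div_le_div_of_nonneg_left hp.le (by positivity)
        linarith

lemma aux_up {s A B : ℝ} (hs : 1 < s) (hB : 0 < B) (hAB : B < A) :
    A + B + Real.sqrt ((A + B) ^ 2 + 4 * (s ^ 2 - 1) * (A * B)) ≤ 2 * (s + 1) * A := by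
  have h : Real.sqrt ((A + B) ^ 2 + 4 * (s ^ 2 - 1) * (A * B)) ≤ (2 * s + 1) * A - B := by
    apply Real.sqrt_le_iff.2
    constructor
    · nlinarith
    · have : 0 ≤ s * (s + 1) * (A * (A - B)) := by
        have : 0 < A - B := by linarith
        have : 0 < A := by linarith
        positivity
      nlinarith
  linarith

lemma aux_lo {s A B : ℝ} (hs : 1 < s) (hB : 0 < B) (hAB : B < A) :
    2 * (s + 1) * B < A + B + Real.sqrt ((A + B) ^ 2 + 4 * (s ^ 2 - 1) * (A * B)) := by
  have h : (2 * s + 1) * B - A < Real.sqrt ((A + B) ^ 2 + 4 * (s ^ 2 - 1) * (A * B)) := by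
    apply Real.lt_sqrt_of_sq_lt
    have : 0 < s * (s + 1) * (B * (A - B)) := by
      have : 0 < A - B := by linarith
      positivity
    nlinarith
  linarith

/-- Under (N0), the piecewise first-Turing-curve `ε_*(d)` satisfies
`ε_*(d) ≤ ε_B(d)` for all `d > 0`, with equality if and only if `d = d_M k`
for some integer `k ≥ 1`. -/
theorem epsilonStar_le_epsilonB
    (a b : ℝ) (ha : 0 < a) (hb : 0 < b)
    (u v : ℝ) (hu : u = a + b) (hv : v = b / (a + b) ^ 2)
    (hN0 : u ^ 2 > 2 * u * v - 1 ∧ 2 * u * v - 1 > 0)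
    (ε₁ d₀ : ℝ) (ε₂ εB : ℝ → ℝ)
    (hε₁ : ε₁ = (Real.sqrt (2 * u * v) - 1) ^ 2 / u ^ 2)
    (hε₂ : ∀ d, ε₂ d = (2 * u * v - 1) / (Real.pi ^ 2 * d + u ^ 2))
    (hd₀ : d₀ = 2 * u ^ 2 / (Real.pi ^ 2 * (Real.sqrt (2 * u * v) - 1)))
    (hεB₁ : ∀ d, 0 < d → d ≤ d₀ → εB d = ε₁)
    (hεB₂ : ∀ d, d₀ ≤ d → εB d = ε₂ d)
    (dM : ℕ → ℝ)
    (hdM : ∀ k : ℕ, dM k = u ^ 2 / ((Real.sqrt (2 * u * v) - 1) * (k : ℝ) ^ 2 * Real.pi ^ 2))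
    (εs : ℕ → ℝ → ℝ)
    (hεs : ∀ (k : ℕ) (d : ℝ), εs k d =
      ((2 * u * v - 1) * d * (k : ℝ) ^ 2 * Real.pi ^ 2 - u ^ 2) /
        (d * (k : ℝ) ^ 2 * Real.pi ^ 2 * (d * (k : ℝ) ^ 2 * Real.pi ^ 2 + u ^ 2)))
    (dkk : ℕ → ℝ)
    (hdkk : ∀ k : ℕ, dkk k =
      u ^ 2 / (2 * Real.pi ^ 2 * (2 * u * v - 1)) *
        (1 / (k : ℝ) ^ 2 + 1 / ((k : ℝ) + 1) ^ 2 +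
          Real.sqrt ((1 / (k : ℝ) ^ 2 + 1 / ((k : ℝ) + 1) ^ 2) ^ 2 +
            4 * (2 * u * v - 1) / ((k : ℝ) ^ 2 * ((k : ℝ) + 1) ^ 2))))
    (εP : ℝ → ℝ)
    (hεP1 : ∀ d : ℝ, dkk 1 ≤ d → εP d = εs 1 d)
    (hεPk : ∀ k : ℕ, 2 ≤ k → ∀ d : ℝ, dkk k ≤ d → d < dkk (k - 1) → εP d = εs k d) :
    ∀ d : ℝ, 0 < d →
      εP d ≤ εB d ∧ (εP d = εB d ↔ ∃ k : ℕ, 1 ≤ k ∧ d = dM k) := by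
  obtain ⟨-, hp⟩ := hN0
  have hupos : 0 < u := by rw [hu]; positivity
  have hU : 0 < u ^ 2 := by positivity
  have hP : 0 < Real.pi ^ 2 := by have := Real.pi_pos; positivity
  obtain ⟨s, hsdef⟩ : ∃ s, s = Real.sqrt (2 * u * v) := ⟨_, rfl⟩
  have hs2 : 2 * u * v = s ^ 2 := by rw [hsdef, Real.sq_sqrt (by linarith)]
  have hs : 1 < s := by rw [hsdef]; exact Real.lt_sqrt_of_sq_lt (by linarith)
  rw [← hsdef] at hε₁ hd₀
  simp only [← hsdef] at hdM
  simp only [hs2] at hε₂ hεs hdkk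
  clear hsdef hs2 hp
  generalize Real.pi ^ 2 = P at *
  generalize u ^ 2 = U at *
  have hs1 : 0 < s - 1 := by linarith
  have hp : 0 < s ^ 2 - 1 := by nlinarith
  have hdkk' : ∀ k : ℕ, 1 ≤ k → dkk k = U / (2 * P * (s ^ 2 - 1)) *
      (1 / (k : ℝ) ^ 2 + 1 / ((k : ℝ) + 1) ^ 2 + Real.sqrt ((1 / (k : ℝ) ^ 2 + 1 / ((k : ℝ) + 1) ^ 2) ^ 2 + 4 * (s ^ 2 - 1) * (1 / (k : ℝ) ^ 2 * (1 / ((k : ℝ) + 1) ^ 2)))) := by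
    intro k hk
    rw [hdkk k]
    congr 4
    have hk1 : (0 : ℝ) < k := by exact_mod_cast hk
    field_simp
  have hdM' : ∀ k : ℕ, 1 ≤ k → dM k = U / (2 * P * (s ^ 2 - 1)) * (2 * (s + 1) * (1 / (k : ℝ) ^ 2)) := by
    intro k hk
    have hk' : (0 : ℝ) < k := by exact_mod_cast hk
    rw [hdM k, show s ^ 2 - 1 = (s - 1) * (s + 1) by ring]
    have : s + 1 ≠ 0 := by linarith
    field_simp
  have hc : 0 < U / (2 * P * (s ^ 2 - 1)) := by positivity
  have hAB : ∀ k : ℕ, 1 ≤ k → 1 / ((k : ℝ) + 1) ^ 2 < 1 / (k : ℝ) ^ 2 := by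
    intro k hk
    have hk' : (0 : ℝ) < k := by exact_mod_cast hk
    apply one_div_lt_one_div_of_lt (by positivity)
    nlinarith
  have hup : ∀ k : ℕ, 1 ≤ k → dkk k ≤ dM k := by
    intro k hk
    rw [hdkk' k hk, hdM' k hk]
    exact mul_le_mul_of_nonneg_left (aux_up hs (by positivity) (hAB k hk)) hc.le
  have hlo : ∀ k : ℕ, 1 ≤ k → dM (k + 1) < dkk k := by
    intro k hk
    rw [hdkk' k hk, hdM' (k + 1) (by omega)]
    push_cast
    exact mul_lt_mul_of_pos_left (aux_lo hs (by positivity) (hAB k hk)) hc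
  have hx : ∀ (k : ℕ) (d : ℝ), εs k d = ((s ^ 2 - 1) * (d * (k : ℝ) ^ 2 * P) - U) /
      (d * (k : ℝ) ^ 2 * P * (d * (k : ℝ) ^ 2 * P + U)) := by
    intro k d; rw [hεs]; congr 2; ring
  have hMd : ∀ (k : ℕ) (d : ℝ), 1 ≤ k → ((s - 1) * (d * (k : ℝ) ^ 2 * P) - U = 0 ↔ d = dM k) := by
    intro k d hk
    have hk' : (0 : ℝ) < k := by exact_mod_cast hk
    rw [hdM k, eq_div_iff (by positivity), sub_eq_zero]
    constructor <;> intro h <;> linarith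
  have hM : ∀ k : ℕ, 1 ≤ k → εP (dM k) = εs k (dM k) := by
    intro k hk
    rcases Nat.lt_or_ge 1 k with h | h
    · apply hεPk k h _ (hup k hk)
      have := hlo (k - 1) (by omega)
      rwa [Nat.sub_add_cancel hk] at this
    · obtain rfl : k = 1 := by omega
      exact hεP1 _ (hup 1 le_rfl)
  intro d hd
  obtain ⟨k, hk, hkd⟩ : ∃ k : ℕ, 1 ≤ k ∧ εP d = εs k d := by
    have hex : ∃ k : ℕ, 1 ≤ k ∧ dkk k ≤ d := by
      obtain ⟨n, hn⟩ := exists_nat_gt (U / ((s - 1) * P) / d)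
      refine ⟨n + 1, by omega, (hup _ (by omega)).trans ?_⟩
      rw [hdM, div_le_iff₀ (by positivity)]
      rw [div_lt_iff₀ hd, div_lt_iff₀ (by positivity)] at hn
      push_cast
      have h1 : (n : ℝ) ≤ ((n : ℝ) + 1) ^ 2 := by nlinarith [Nat.cast_nonneg (α := ℝ) n]
      have h2 : (n : ℝ) * (d * ((s - 1) * P)) ≤ ((n : ℝ) + 1) ^ 2 * (d * ((s - 1) * P)) :=
        mul_le_mul_of_nonneg_right h1 (by positivity)
      linarith
    classical
    obtain ⟨h1, h2⟩ := Nat.find_spec hex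
    have hmin := fun m => Nat.find_min (H := hex) (m := m)
    generalize Nat.find hex = k at *
    refine ⟨k, h1, ?_⟩
    rcases Nat.lt_or_ge 1 k with h | h
    · apply hεPk k h _ h2
      have := hmin (k - 1) (by omega)
      by_contra hcon
      exact this ⟨by omega, not_lt.1 hcon⟩
    · obtain rfl : k = 1 := by omega
      exact hεP1 _ h2
  have hk' : (1 : ℝ) ≤ k := by exact_mod_cast hk
  have hxpos : 0 < d * (k : ℝ) ^ 2 * P := by positivity
  rcases le_or_gt d d₀ with h | h
  · rw [hεB₁ d hd h, hε₁]
    have key := aux_f hs hU hxpos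
    rw [← hx, ← hkd] at key
    refine ⟨?_, ?_, ?_⟩
    · have : 0 ≤ ((s - 1) * (d * (k : ℝ) ^ 2 * P) - U) ^ 2 / (U * (d * (k : ℝ) ^ 2 * P * (d * (k : ℝ) ^ 2 * P + U))) := by positivity
      linarith
    · intro he
      rw [he, sub_self, eq_comm, div_eq_zero_iff] at key
      rcases key with h0 | h0
      · exact ⟨k, hk, (hMd k d hk).1 (by simpa using h0)⟩
      · exact absurd h0 (by positivity)
    · rintro ⟨j, hj, rfl⟩
      have hj' : (1 : ℝ) ≤ j := by exact_mod_cast hj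
      have key := aux_f (x := dM j * (j : ℝ) ^ 2 * P) hs hU (by positivity)
      rw [(hMd j _ hj).2 rfl, ← hx, ← hM j hj] at key
      simp only [ne_eq, OfNat.ofNat_ne_zero, not_false_eq_true, zero_pow, zero_div] at key
      linarith
  · have hlt : εP d < εB d := by
      rw [hεB₂ d h.le, hε₂, hkd, hx]
      apply aux_g hs hU (by positivity)
      have : 1 ≤ (k : ℝ) ^ 2 := by nlinarith
      have := mul_le_mul_of_nonneg_right this (by positivity : 0 ≤ d * P)
      linarith
    refine ⟨hlt.le, fun he => absurd he hlt.ne, ?_⟩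
    rintro ⟨j, hj, rfl⟩
    exfalso
    have hj' : (1 : ℝ) ≤ j := by exact_mod_cast hj
    have h0 := (hMd j _ hj).2 rfl
    rw [hd₀, div_lt_iff₀ (by positivity)] at h
    have : 1 ≤ (j : ℝ) ^ 2 := by nlinarith
    have := mul_le_mul_of_nonneg_right this (by positivity : 0 ≤ dM j * (P * (s - 1)))
    linarith
end

section
/- Assume (N0) and suppose 0 < ε < ε₁ (condition (N1)) and 0 < ε < ε₂(d) (condition (N2)) for some d > 0. Then: (i) ε u*² < 2u*v* − 1 and ε < 1; (ii) the function x ↦ ε d²π⁴ x² + (ε u*² − 2u*v* + 1) d π² x + u*² (obtained from DET_k by substituting x = k²) attains a strictly negative value at some x > 0, and its unique minimizer over x ∈ ℝ is x_min = (2u*v* − ε u*² − 1)/(2 d ε π²), which satisfies x_min > 1/2. -/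
/-- Under (N0), (N1) and (N2): (i) `ε u² < 2uv − 1` and `ε < 1`;
(ii) the quadratic-in-`x` function obtained from `DET_k` via `x = k²` takes a
negative value at some `x > 0`, and its unique minimizer over `ℝ` is
`x_min = (2uv − εu² − 1)/(2dεπ²)`, which satisfies `x_min > 1/2`. -/
theorem turing_instability_necessary_conditions
    (a b d ε : ℝ) (ha : 0 < a) (hb : 0 < b) (hd : 0 < d)
    (u v : ℝ) (hu : u = a + b) (hv : v = b / (a + b) ^ 2)
    (hN0 : u ^ 2 > 2 * u * v - 1 ∧ 2 * u * v - 1 > 0)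
    (ε₁ : ℝ) (hε₁ : ε₁ = (Real.sqrt (2 * u * v) - 1) ^ 2 / u ^ 2)
    (ε₂ : ℝ → ℝ) (hε₂ : ∀ d', ε₂ d' = (2 * u * v - 1) / (Real.pi ^ 2 * d' + u ^ 2))
    (hN1 : 0 < ε ∧ ε < ε₁) (hN2 : 0 < ε ∧ ε < ε₂ d)
    (f : ℝ → ℝ)
    (hf : ∀ x, f x = ε * d ^ 2 * Real.pi ^ 4 * x ^ 2 +
      (ε * u ^ 2 - 2 * u * v + 1) * d * Real.pi ^ 2 * x + u ^ 2)
    (xmin : ℝ) (hxmin : xmin = (2 * u * v - ε * u ^ 2 - 1) / (2 * d * ε * Real.pi ^ 2)) :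
    (ε * u ^ 2 < 2 * u * v - 1 ∧ ε < 1) ∧
      (∃ x : ℝ, 0 < x ∧ f x < 0) ∧
      (∀ x : ℝ, x ≠ xmin → f xmin < f x) ∧
      xmin > 1 / 2 := by
  obtain ⟨h1, h2⟩ := hN0
  obtain ⟨he, hN1⟩ := hN1
  have hN2 := hN2.2
  have hupos : 0 < u := by rw [hu]; positivity
  have hu2 : 0 < u ^ 2 := by positivity
  have hP : 0 < Real.pi ^ 2 := by have := Real.pi_pos; positivity
  rw [hε₂, lt_div_iff₀ (by positivity)] at hN2
  rw [hε₁, lt_div_iff₀ hu2] at hN1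
  have hpd : 0 < ε * (Real.pi ^ 2 * d) := by positivity
  have hi : ε * u ^ 2 < 2 * u * v - 1 := by nlinarith
  have hc : 0 < 2 * d * ε * Real.pi ^ 2 := by positivity
  have hx : 2 * d * ε * Real.pi ^ 2 * xmin = 2 * u * v - ε * u ^ 2 - 1 := by
    rw [hxmin]; field_simp
  have hx2 : xmin > 1 / 2 := by
    rw [hxmin, gt_iff_lt, lt_div_iff₀ hc]; nlinarith
  have key : ∀ x, 4 * ε * f x = (2 * d * ε * Real.pi ^ 2 * (x - xmin)) ^ 2
      - (2 * u * v - ε * u ^ 2 - 1) ^ 2 + 4 * (ε * u ^ 2) := by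
    intro x
    rw [mul_sub, hx, hf]; ring
  have hs1 : 1 < Real.sqrt (2 * u * v) := by
    rw [Real.lt_sqrt (by norm_num)]; linarith
  have hs2 : Real.sqrt (2 * u * v) ^ 2 = 2 * u * v := Real.sq_sqrt (by linarith)
  have ht2 : Real.sqrt (ε * u ^ 2) ^ 2 = ε * u ^ 2 := Real.sq_sqrt (by positivity)
  have ht0 : 0 ≤ Real.sqrt (ε * u ^ 2) := Real.sqrt_nonneg _
  have hts : Real.sqrt (ε * u ^ 2) < Real.sqrt (2 * u * v) - 1 := by
    rw [Real.sqrt_lt' (by linarith)]; exact hN1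
  have hB : 2 * Real.sqrt (ε * u ^ 2) < 2 * u * v - ε * u ^ 2 - 1 := by
    nlinarith
  have hB2 : 4 * (ε * u ^ 2) < (2 * u * v - ε * u ^ 2 - 1) ^ 2 := by
    nlinarith
  refine ⟨⟨hi, ?_⟩, ⟨xmin, by linarith, ?_⟩, ?_, hx2⟩
  · by_contra! h
    nlinarith
  · have := key xmin
    rw [sub_self, mul_zero] at this
    by_contra! h
    have : 0 ≤ 4 * ε * f xmin := by positivity
    linarith
  · intro x hne
    have k1 := key xmin
    have k2 := key x
    rw [sub_self, mul_zero] at k1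
    have : 0 < (2 * d * ε * Real.pi ^ 2 * (x - xmin)) ^ 2 := by
      have := mul_ne_zero hc.ne' (sub_ne_zero.mpr hne)
      positivity
    have h4 : 4 * ε * f xmin < 4 * ε * f x := by linarith
    exact lt_of_mul_lt_mul_left h4 (by positivity)
end

section
/- Assume (N0). Fix an integer k₁ ≥ 1 and d ∈ (d_{k₁,k₁+1}, d_{k₁−1,k₁}) (with the convention d_{0,1} = +∞), and set ε = ε_*(k₁,d). Then DET_{k₁} = 0, DET_k > 0 for every integer k ≥ 0 with k ≠ k₁, and TR_k < TR_0 = −1 − u*² + 2u*v* < 0 for every integer k ≥ 1. -/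
lemma aux_root (c m P α β : ℝ) (hc : 0 < c) (hm : 0 < m) (hP : 0 < P) (hα : 0 < α) (hβ : 0 < β)
    (D : ℝ) (hD : D = m / (2 * P * c) * (1 / α + 1 / β +
      Real.sqrt ((1 / α + 1 / β) ^ 2 + 4 * c / (α * β)))) :
    0 < D ∧ c * (D * α * P) * (D * β * P) - m * (D * α * P + D * β * P) - m ^ 2 = 0 := by
  have hR0 := Real.sqrt_nonneg ((1 / α + 1 / β) ^ 2 + 4 * c / (α * β))
  have hR : Real.sqrt ((1 / α + 1 / β) ^ 2 + 4 * c / (α * β)) ^ 2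
      = (1 / α + 1 / β) ^ 2 + 4 * c / (α * β) := Real.sq_sqrt (by positivity)
  generalize Real.sqrt ((1 / α + 1 / β) ^ 2 + 4 * c / (α * β)) = R at *
  refine ⟨by rw [hD]; positivity, ?_⟩
  have h1 : R ^ 2 * (α * β) ^ 2 = (α + β) ^ 2 + 4 * c * (α * β) := by
    rw [hR]; field_simp; ring
  have h2 : 2 * c * P * (α * β) * D = m * (α + β + R * (α * β)) := by
    rw [hD]; field_simp; ring
  have h3 : (4 * c * α * β) * (c * (D * α * P) * (D * β * P) - m * (D * α * P + D * β * P) - m ^ 2) = 0 := by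
    linear_combination (2 * c * P * (α * β) * D + m * (α + β + R * (α * β)) - 2 * m * (α + β)) * h2 + m ^ 2 * h1
  rcases mul_eq_zero.mp h3 with h | h
  · exact absurd h (by positivity)
  · exact h

lemma aux_cmp (c m P α β : ℝ) (hc : 0 < c) (hm : 0 < m) (hP : 0 < P) (hα : 0 < α) (hβ : 0 < β)
    (D d : ℝ) (hd : 0 < d) (hD : D = m / (2 * P * c) * (1 / α + 1 / β +
      Real.sqrt ((1 / α + 1 / β) ^ 2 + 4 * c / (α * β)))) :
    (D < d → 0 < c * (d * α * P) * (d * β * P) - m * (d * α * P + d * β * P) - m ^ 2) ∧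
    (d < D → c * (d * α * P) * (d * β * P) - m * (d * α * P + d * β * P) - m ^ 2 < 0) := by
  obtain ⟨hD0, hF⟩ := aux_root c m P α β hc hm hP hα hβ D hD
  have key : (c * (d * α * P) * (d * β * P) - m * (d * α * P + d * β * P) - m ^ 2) * D
      = (d - D) * (c * (d * α * P) * (D * β * P) + m ^ 2) := by
    linear_combination d * hF
  have hpos : 0 < c * (d * α * P) * (D * β * P) + m ^ 2 := by positivity
  constructor
  · intro h
    have := mul_pos (sub_pos.mpr h) hpos
    rw [← key] at this
    exact pos_of_mul_pos_left this hD0.le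
  · intro h
    have := mul_neg_of_neg_of_pos (sub_neg.mpr h) hpos
    rw [← key] at this
    by_contra hc
    exact absurd this (not_lt.mpr (mul_nonneg (not_lt.mp hc) hD0.le))

/-- Under (N0), for `k₁ ≥ 1`, `d ∈ (d_{k₁,k₁+1}, d_{k₁−1,k₁})` and `ε = ε_*(k₁,d)`:
`DET_{k₁} = 0`, `DET_k > 0` for all integers `k ≠ k₁`, and
`TR_k < TR_0 = −1 − u² + 2uv < 0` for all integers `k ≥ 1`. -/
theorem DET_TR_at_turing_value
    (a b d ε : ℝ) (ha : 0 < a) (hb : 0 < b) (hd : 0 < d)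
    (u v : ℝ) (hu : u = a + b) (hv : v = b / (a + b) ^ 2)
    (hN0 : u ^ 2 > 2 * u * v - 1 ∧ 2 * u * v - 1 > 0)
    (εs : ℕ → ℝ → ℝ)
    (hεs : ∀ (k : ℕ) (d' : ℝ), εs k d' =
      ((2 * u * v - 1) * d' * (k : ℝ) ^ 2 * Real.pi ^ 2 - u ^ 2) /
        (d' * (k : ℝ) ^ 2 * Real.pi ^ 2 * (d' * (k : ℝ) ^ 2 * Real.pi ^ 2 + u ^ 2)))
    (dkk : ℕ → ℝ)
    (hdkk : ∀ k : ℕ, dkk k =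
      u ^ 2 / (2 * Real.pi ^ 2 * (2 * u * v - 1)) *
        (1 / (k : ℝ) ^ 2 + 1 / ((k : ℝ) + 1) ^ 2 +
          Real.sqrt ((1 / (k : ℝ) ^ 2 + 1 / ((k : ℝ) + 1) ^ 2) ^ 2 +
            4 * (2 * u * v - 1) / ((k : ℝ) ^ 2 * ((k : ℝ) + 1) ^ 2))))
    (k₁ : ℕ) (hk₁ : 1 ≤ k₁)
    (hdlo : dkk k₁ < d) (hdhi : k₁ = 1 ∨ d < dkk (k₁ - 1))
    (hε : ε = εs k₁ d)
    (p r q DET TR : ℕ → ℝ) (s : ℝ)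
    (hp : ∀ k : ℕ, p k = (ε + 1) * d * (k : ℝ) ^ 2 * Real.pi ^ 2 + 1)
    (hr : ∀ k : ℕ, r k = ε * d ^ 2 * (k : ℝ) ^ 4 * Real.pi ^ 4 + d * (k : ℝ) ^ 2 * Real.pi ^ 2)
    (hs : s = u ^ 2 - 2 * u * v)
    (hq : ∀ k : ℕ, q k = (ε * u ^ 2 - 2 * u * v) * d * (k : ℝ) ^ 2 * Real.pi ^ 2 + u ^ 2)
    (hDET : ∀ k : ℕ, DET k = r k + q k)
    (hTR : ∀ k : ℕ, TR k = -(p k + s)) :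
    DET k₁ = 0 ∧
      (∀ k : ℕ, k ≠ k₁ → DET k > 0) ∧
      TR 0 = -1 - u ^ 2 + 2 * u * v ∧ TR 0 < 0 ∧
      (∀ k : ℕ, 1 ≤ k → TR k < TR 0) := by
  obtain ⟨hN1, hN2⟩ := hN0
  have hu0 : 0 < u := by rw [hu]; positivity
  have hm : 0 < u ^ 2 := by positivity
  have hP : 0 < Real.pi ^ 2 := by positivity
  have hk0 : (0 : ℝ) < (k₁ : ℝ) ^ 2 := by
    have : (0 : ℝ) < k₁ := by exact_mod_cast hk₁
    positivity
  obtain ⟨c, hc⟩ : ∃ c, c = 2 * u * v - 1 := ⟨_, rfl⟩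
  have hc0 : 0 < c := by rw [hc]; exact hN2
  have hlo := (aux_cmp c (u ^ 2) (Real.pi ^ 2) ((k₁ : ℝ) ^ 2) (((k₁ : ℝ) + 1) ^ 2) hc0 hm hP hk0
    (by positivity) (dkk k₁) d hd (by rw [hdkk, hc])).1 hdlo
  have hx1 : 0 < d * (k₁ : ℝ) ^ 2 * Real.pi ^ 2 := by positivity
  have hcx : 0 < c * (d * (k₁ : ℝ) ^ 2 * Real.pi ^ 2) - u ^ 2 := by
    have hx2 : 0 < d * ((k₁ : ℝ) + 1) ^ 2 * Real.pi ^ 2 := by positivity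
    have h4 : 0 < (c * (d * (k₁ : ℝ) ^ 2 * Real.pi ^ 2) - u ^ 2) * (d * ((k₁ : ℝ) + 1) ^ 2 * Real.pi ^ 2) := by
      have : 0 < u ^ 2 * (d * (k₁ : ℝ) ^ 2 * Real.pi ^ 2) + (u ^ 2) ^ 2 := by positivity
      linarith
    exact pos_of_mul_pos_left h4 hx2.le
  have hlo2 : ∀ k : ℕ, k₁ < k → 0 < c * (d * (k₁ : ℝ) ^ 2 * Real.pi ^ 2) * (d * (k : ℝ) ^ 2 * Real.pi ^ 2)
      - u ^ 2 * (d * (k₁ : ℝ) ^ 2 * Real.pi ^ 2 + d * (k : ℝ) ^ 2 * Real.pi ^ 2) - (u ^ 2) ^ 2 ∧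
      d * (k₁ : ℝ) ^ 2 * Real.pi ^ 2 < d * (k : ℝ) ^ 2 * Real.pi ^ 2 := by
    intro k hk
    have h1 : (k₁ : ℝ) + 1 ≤ k := by exact_mod_cast hk
    have h2 : d * ((k₁ : ℝ) + 1) ^ 2 * Real.pi ^ 2 ≤ d * (k : ℝ) ^ 2 * Real.pi ^ 2 := by gcongr
    have h3 : d * (k₁ : ℝ) ^ 2 * Real.pi ^ 2 < d * ((k₁ : ℝ) + 1) ^ 2 * Real.pi ^ 2 := by
      gcongr; linarith
    refine ⟨?_, by linarith⟩
    have := mul_le_mul_of_nonneg_left h2 hcx.le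
    linarith
  have hhi2 : ∀ k : ℕ, k < k₁ → c * (d * (k₁ : ℝ) ^ 2 * Real.pi ^ 2) * (d * (k : ℝ) ^ 2 * Real.pi ^ 2)
      - u ^ 2 * (d * (k₁ : ℝ) ^ 2 * Real.pi ^ 2 + d * (k : ℝ) ^ 2 * Real.pi ^ 2) - (u ^ 2) ^ 2 < 0 ∧
      d * (k : ℝ) ^ 2 * Real.pi ^ 2 < d * (k₁ : ℝ) ^ 2 * Real.pi ^ 2 := by
    intro k hk
    have h0 : (k : ℝ) < k₁ := by exact_mod_cast hk
    have h3 : d * (k : ℝ) ^ 2 * Real.pi ^ 2 < d * (k₁ : ℝ) ^ 2 * Real.pi ^ 2 := by gcongr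
    refine ⟨?_, h3⟩
    rcases Nat.eq_zero_or_pos k with rfl | hkp
    · have : 0 < u ^ 2 * (d * (k₁ : ℝ) ^ 2 * Real.pi ^ 2) + (u ^ 2) ^ 2 := by positivity
      simp only [Nat.cast_zero]
      linarith
    · rcases hdhi with h | hdhi
      · omega
      obtain ⟨j, rfl⟩ : ∃ j, k₁ = j + 1 := ⟨k₁ - 1, by omega⟩
      simp only [Nat.add_sub_cancel] at hdhi
      have hj : (k : ℝ) ≤ j := by exact_mod_cast Nat.lt_succ_iff.mp hk
      have hkp' : (0 : ℝ) < k := by exact_mod_cast hkp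
      have hj0 : (0 : ℝ) < j := by linarith
      have hhi := (aux_cmp c (u ^ 2) (Real.pi ^ 2) ((j : ℝ) ^ 2) (((j : ℝ) + 1) ^ 2) hc0 hm hP
        (by positivity) (by positivity) (dkk j) d hd (by rw [hdkk, hc])).2 hdhi
      have h2 : d * (k : ℝ) ^ 2 * Real.pi ^ 2 ≤ d * (j : ℝ) ^ 2 * Real.pi ^ 2 := by gcongr
      have := mul_le_mul_of_nonneg_left h2 hcx.le
      push_cast at this ⊢
      linarith
  have hε1 : ε * ((d * (k₁ : ℝ) ^ 2 * Real.pi ^ 2) * (d * (k₁ : ℝ) ^ 2 * Real.pi ^ 2 + u ^ 2))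
      = c * (d * (k₁ : ℝ) ^ 2 * Real.pi ^ 2) - u ^ 2 := by
    rw [hε, hεs, ← hc, div_mul_cancel₀ _ (by positivity)]; ring
  have hW : 0 < (d * (k₁ : ℝ) ^ 2 * Real.pi ^ 2) * (d * (k₁ : ℝ) ^ 2 * Real.pi ^ 2 + u ^ 2) := by
    positivity
  have hε0 : 0 < ε := by
    rw [← hε1] at hcx
    exact pos_of_mul_pos_left hcx hW.le
  have hdet : ∀ k : ℕ, DET k * ((d * (k₁ : ℝ) ^ 2 * Real.pi ^ 2) * (d * (k₁ : ℝ) ^ 2 * Real.pi ^ 2 + u ^ 2))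
      = (d * (k : ℝ) ^ 2 * Real.pi ^ 2 - d * (k₁ : ℝ) ^ 2 * Real.pi ^ 2) *
        (c * (d * (k₁ : ℝ) ^ 2 * Real.pi ^ 2) * (d * (k : ℝ) ^ 2 * Real.pi ^ 2)
      - u ^ 2 * (d * (k₁ : ℝ) ^ 2 * Real.pi ^ 2 + d * (k : ℝ) ^ 2 * Real.pi ^ 2) - (u ^ 2) ^ 2) := by
    intro k
    have e : DET k = ε * (d * (k : ℝ) ^ 2 * Real.pi ^ 2) * (d * (k : ℝ) ^ 2 * Real.pi ^ 2 + u ^ 2)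
        - c * (d * (k : ℝ) ^ 2 * Real.pi ^ 2) + u ^ 2 := by
      rw [hDET, hr, hq, hc]; ring
    rw [e]
    linear_combination ((d * (k : ℝ) ^ 2 * Real.pi ^ 2) * (d * (k : ℝ) ^ 2 * Real.pi ^ 2 + u ^ 2)) * hε1
  have hTR0 : TR 0 = -1 - u ^ 2 + 2 * u * v := by
    rw [hTR, hp, hs]; push_cast; ring
  refine ⟨?_, ?_, hTR0, by rw [hTR0]; linarith, ?_⟩
  · have h := hdet k₁
    rw [sub_self, zero_mul] at h
    exact (mul_eq_zero.mp h).resolve_right hW.ne'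
  · intro k hk
    have h : 0 < DET k * ((d * (k₁ : ℝ) ^ 2 * Real.pi ^ 2) * (d * (k₁ : ℝ) ^ 2 * Real.pi ^ 2 + u ^ 2)) := by
      rw [hdet]
      rcases lt_or_gt_of_ne hk with h | h
      · obtain ⟨h1, h2⟩ := hhi2 k h
        exact mul_pos_of_neg_of_neg (by linarith) h1
      · obtain ⟨h1, h2⟩ := hlo2 k h
        exact mul_pos (by linarith) h1
    exact pos_of_mul_pos_left h hW.le
  · intro k hk
    have hk' : (0 : ℝ) < k := by exact_mod_cast hk
    have : 0 < (ε + 1) * d * (k : ℝ) ^ 2 * Real.pi ^ 2 := by positivity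
    rw [hTR0, hTR, hp, hs]
    linarith
end

section
/- Assume (N0). Fix an integer k₁ ≥ 1 and d ∈ (d_{k₁,k₁+1}, d_{k₁−1,k₁}) (with d_{0,1} = +∞), and set ε = ε_*(k₁,d). Then for every τ ≥ 0, λ = 0 is a root of D_{k₁}(λ,τ,ε) = 0, and it is a simple root: the derivative ∂D_{k₁}/∂λ evaluated at λ = 0 equals p_{k₁} + s − τ q_{k₁} = −TR_{k₁} + τ r_{k₁}, which is strictly positive for all τ ≥ 0. -/
open Complex in
/-- Under (N0), for `k₁ ≥ 1`, `d ∈ (d_{k₁,k₁+1}, d_{k₁−1,k₁})` and `ε = ε_*(k₁,d)`: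
for every `τ ≥ 0`, `λ = 0` is a root of `D_{k₁}(λ,τ,ε) = 0`, and it is simple:
`∂D_{k₁}/∂λ` at `λ = 0` equals `p_{k₁} + s − τ q_{k₁} = −TR_{k₁} + τ r_{k₁} > 0`. -/
theorem zero_is_simple_root_at_turing_value
    (a b d ε : ℝ) (ha : 0 < a) (hb : 0 < b) (hd : 0 < d)
    (u v : ℝ) (hu : u = a + b) (hv : v = b / (a + b) ^ 2)
    (hN0 : u ^ 2 > 2 * u * v - 1 ∧ 2 * u * v - 1 > 0)
    (εs : ℕ → ℝ → ℝ)
    (hεs : ∀ (k : ℕ) (d' : ℝ), εs k d' =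
      ((2 * u * v - 1) * d' * (k : ℝ) ^ 2 * Real.pi ^ 2 - u ^ 2) /
        (d' * (k : ℝ) ^ 2 * Real.pi ^ 2 * (d' * (k : ℝ) ^ 2 * Real.pi ^ 2 + u ^ 2)))
    (dkk : ℕ → ℝ)
    (hdkk : ∀ k : ℕ, dkk k =
      u ^ 2 / (2 * Real.pi ^ 2 * (2 * u * v - 1)) *
        (1 / (k : ℝ) ^ 2 + 1 / ((k : ℝ) + 1) ^ 2 +
          Real.sqrt ((1 / (k : ℝ) ^ 2 + 1 / ((k : ℝ) + 1) ^ 2) ^ 2 +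
            4 * (2 * u * v - 1) / ((k : ℝ) ^ 2 * ((k : ℝ) + 1) ^ 2))))
    (k₁ : ℕ) (hk₁ : 1 ≤ k₁)
    (hdlo : dkk k₁ < d) (hdhi : k₁ = 1 ∨ d < dkk (k₁ - 1))
    (hε : ε = εs k₁ d)
    (p r q TR : ℕ → ℝ) (s : ℝ)
    (hp : ∀ k : ℕ, p k = (ε + 1) * d * (k : ℝ) ^ 2 * Real.pi ^ 2 + 1)
    (hr : ∀ k : ℕ, r k = ε * d ^ 2 * (k : ℝ) ^ 4 * Real.pi ^ 4 + d * (k : ℝ) ^ 2 * Real.pi ^ 2)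
    (hs : s = u ^ 2 - 2 * u * v)
    (hq : ∀ k : ℕ, q k = (ε * u ^ 2 - 2 * u * v) * d * (k : ℝ) ^ 2 * Real.pi ^ 2 + u ^ 2)
    (hTR : ∀ k : ℕ, TR k = -(p k + s))
    (D : ℕ → ℂ → ℝ → ℂ)
    (hD : ∀ (k : ℕ) (lam : ℂ) (τ : ℝ),
      D k lam τ = lam ^ 2 + (p k : ℂ) * lam + (r k : ℂ) +
        ((s : ℂ) * lam + (q k : ℂ)) * Complex.exp (-lam * (τ : ℂ))) :
    ∀ τ : ℝ, 0 ≤ τ →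
      D k₁ 0 τ = 0 ∧
        deriv (fun lam : ℂ => D k₁ lam τ) 0 = ((p k₁ + s - τ * q k₁ : ℝ) : ℂ) ∧
        p k₁ + s - τ * q k₁ = -TR k₁ + τ * r k₁ ∧
        0 < p k₁ + s - τ * q k₁ := by
  intro τ hτ
  obtain ⟨hN1, hN2⟩ := hN0
  have hupos : 0 < u := by rw [hu]; positivity
  have hkpos : (0:ℝ) < (k₁:ℝ) := by exact_mod_cast hk₁
  have hpi := Real.pi_pos
  obtain ⟨c, hc⟩ : ∃ c, c = 2 * u * v - 1 := ⟨_, rfl⟩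
  have hdl := hdkk k₁
  have he := hεs k₁ d
  rw [← hc] at hN1 hN2 hdl he
  have hcpos : 0 < c := hN2
  obtain ⟨x, hx⟩ : ∃ x, x = d * (k₁:ℝ) ^ 2 * Real.pi ^ 2 := ⟨_, rfl⟩
  have hxpos : 0 < x := by rw [hx]; positivity
  have hcx : u ^ 2 < c * x := by
    have h1 : u ^ 2 / (2 * Real.pi ^ 2 * c) * (2 * (1 / (k₁:ℝ) ^ 2)) < d := by
      refine lt_of_le_of_lt ?_ hdlo
      rw [hdl]
      apply mul_le_mul_of_nonneg_left _ (by positivity)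
      have hA : 1 / (k₁:ℝ) ^ 2 ≤ 1 / (k₁:ℝ) ^ 2 + 1 / ((k₁:ℝ) + 1) ^ 2 := by
        have : 0 ≤ 1 / ((k₁:ℝ) + 1) ^ 2 := by positivity
        linarith
      have hS : 1 / (k₁:ℝ) ^ 2 + 1 / ((k₁:ℝ) + 1) ^ 2 ≤
          Real.sqrt ((1 / (k₁ : ℝ) ^ 2 + 1 / ((k₁ : ℝ) + 1) ^ 2) ^ 2 +
            4 * c / ((k₁ : ℝ) ^ 2 * ((k₁ : ℝ) + 1) ^ 2)) := by
        apply Real.le_sqrt_of_sq_le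
        have : 0 ≤ 4 * c / ((k₁ : ℝ) ^ 2 * ((k₁ : ℝ) + 1) ^ 2) := by positivity
        linarith
      linarith
    have h2 : u ^ 2 / (2 * Real.pi ^ 2 * c) * (2 * (1 / (k₁:ℝ) ^ 2))
        = u ^ 2 / (c * (k₁:ℝ) ^ 2 * Real.pi ^ 2) := by
      field_simp
    rw [h2, div_lt_iff₀ (by positivity)] at h1
    rw [hx]; linarith
  have hex : ε * (x * (x + u ^ 2)) = c * x - u ^ 2 := by
    have h3 : ε = (c * x - u ^ 2) / (x * (x + u ^ 2)) := by
      rw [hε, he, hx]; ring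
    rw [h3]
    field_simp
  have hεpos : 0 < ε := by
    have h4 : 0 < ε * (x * (x + u ^ 2)) := by rw [hex]; linarith
    exact pos_of_mul_pos_left h4 (by positivity)
  have hp1 : p k₁ = ε * x + x + 1 := by rw [hp, hx]; ring
  have hr1 : r k₁ = ε * x ^ 2 + x := by rw [hr, hx]; ring
  have hq1 : q k₁ = (ε * u ^ 2 - (c + 1)) * x + u ^ 2 := by rw [hq, hx, hc]; ring
  have hs1 : s = u ^ 2 - (c + 1) := by rw [hs, hc]; ring
  have hrq : r k₁ + q k₁ = 0 := by rw [hr1, hq1]; linear_combination hex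
  have hrpos : 0 < r k₁ := by rw [hr1]; positivity
  have hps : 0 < p k₁ + s := by
    rw [hp1, hs1]
    have : 0 < ε * x := by positivity
    linarith
  refine ⟨?_, ?_, ?_, ?_⟩
  · rw [hD]
    have : (r k₁ : ℂ) + (q k₁ : ℂ) = 0 := by exact_mod_cast hrq
    simpa using this
  · have hfun : (fun lam : ℂ => D k₁ lam τ) = fun lam : ℂ =>
        lam ^ 2 + (p k₁ : ℂ) * lam + (r k₁ : ℂ) +
        ((s : ℂ) * lam + (q k₁ : ℂ)) * Complex.exp (-lam * (τ : ℂ)) := by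
      funext lam; exact hD _ _ _
    rw [hfun]
    have hid := hasDerivAt_id (0:ℂ)
    have h5 := (((hid.pow 2).add (hid.const_mul (p k₁ : ℂ))).add_const (r k₁ : ℂ)).add
      (((hid.const_mul (s : ℂ)).add_const (q k₁ : ℂ)).mul ((hid.neg.mul_const (τ : ℂ)).cexp))
    refine (HasDerivAt.deriv (f' := _) h5).trans ?_
    simp
    ring
  · rw [hTR]; linear_combination (-τ) * hrq
  · have : 0 ≤ τ * r k₁ := by positivity
    have h6 : q k₁ = - r k₁ := by linarith
    rw [h6]; linarith
end

section
/- Assume (N0). Fix an integer k₁ ≥ 1, d ∈ (d_{k₁,k₁+1}, d_{k₁−1,k₁}) (with d_{0,1} = +∞), set ε_* = ε_*(k₁,d), and fix τ ≥ 0. Suppose λ : I → ℂ is a differentiable function on an open interval I containing ε_* such that D_{k₁}(λ(ε), τ, ε) = 0 for all ε ∈ I and λ(ε_*) = 0 (here D_{k₁}(λ,τ,ε) is evaluated with the coefficients p_{k₁}, r_{k₁}, q_{k₁} depending on ε). Then λ'(ε_*) = −(d²k₁⁴π⁴ + d k₁²π² u*²)/(p_{k₁} + s − τ q_{k₁}) evaluated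 at ε = ε_*, which is a strictly negative real number for every τ ≥ 0. -/
/-- Under (N0), for `k₁ ≥ 1`, `d ∈ (d_{k₁,k₁+1}, d_{k₁−1,k₁})`, `ε_* = ε_*(k₁,d)` and
`τ ≥ 0`: if `lam : I → ℂ` is differentiable on an open interval `I ∋ ε_*` with
`D_{k₁}(lam ε, τ, ε) = 0` on `I` and `lam ε_* = 0`, then
`lam'(ε_*) = −(d²k₁⁴π⁴ + dk₁²π²u²)/(p_{k₁}(ε_*) + s − τ q_{k₁}(ε_*))`,
a strictly negative real number. -/
theorem turing_transversality_in_epsilon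
    (a b d : ℝ) (ha : 0 < a) (hb : 0 < b) (hd : 0 < d)
    (u v : ℝ) (hu : u = a + b) (hv : v = b / (a + b) ^ 2)
    (hN0 : u ^ 2 > 2 * u * v - 1 ∧ 2 * u * v - 1 > 0)
    (εs : ℕ → ℝ → ℝ)
    (hεs : ∀ (k : ℕ) (d' : ℝ), εs k d' =
      ((2 * u * v - 1) * d' * (k : ℝ) ^ 2 * Real.pi ^ 2 - u ^ 2) /
        (d' * (k : ℝ) ^ 2 * Real.pi ^ 2 * (d' * (k : ℝ) ^ 2 * Real.pi ^ 2 + u ^ 2)))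
    (dkk : ℕ → ℝ)
    (hdkk : ∀ k : ℕ, dkk k =
      u ^ 2 / (2 * Real.pi ^ 2 * (2 * u * v - 1)) *
        (1 / (k : ℝ) ^ 2 + 1 / ((k : ℝ) + 1) ^ 2 +
          Real.sqrt ((1 / (k : ℝ) ^ 2 + 1 / ((k : ℝ) + 1) ^ 2) ^ 2 +
            4 * (2 * u * v - 1) / ((k : ℝ) ^ 2 * ((k : ℝ) + 1) ^ 2))))
    (k₁ : ℕ) (hk₁ : 1 ≤ k₁)
    (hdlo : dkk k₁ < d) (hdhi : k₁ = 1 ∨ d < dkk (k₁ - 1))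
    (εstar : ℝ) (hεstar : εstar = εs k₁ d)
    (τ : ℝ) (hτ : 0 ≤ τ)
    (p r q : ℝ → ℝ) (s : ℝ)
    (hp : ∀ e : ℝ, p e = (e + 1) * d * (k₁ : ℝ) ^ 2 * Real.pi ^ 2 + 1)
    (hr : ∀ e : ℝ, r e = e * d ^ 2 * (k₁ : ℝ) ^ 4 * Real.pi ^ 4 + d * (k₁ : ℝ) ^ 2 * Real.pi ^ 2)
    (hs : s = u ^ 2 - 2 * u * v)
    (hq : ∀ e : ℝ, q e = (e * u ^ 2 - 2 * u * v) * d * (k₁ : ℝ) ^ 2 * Real.pi ^ 2 + u ^ 2)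
    (D : ℂ → ℝ → ℝ → ℂ)
    (hD : ∀ (lam : ℂ) (τ' e : ℝ),
      D lam τ' e = lam ^ 2 + (p e : ℂ) * lam + (r e : ℂ) +
        ((s : ℂ) * lam + (q e : ℂ)) * Complex.exp (-lam * (τ' : ℂ)))
    (I : Set ℝ) (hIopen : IsOpen I) (hIint : εstar ∈ I)
    (lam : ℝ → ℂ)
    (hdiff : ∀ e ∈ I, DifferentiableAt ℝ lam e)
    (hroot : ∀ e ∈ I, D (lam e) τ e = 0)
    (hzero : lam εstar = 0) :
    deriv lam εstar =
        ((-((d ^ 2 * (k₁ : ℝ) ^ 4 * Real.pi ^ 4 + d * (k₁ : ℝ) ^ 2 * Real.pi ^ 2 * u ^ 2) /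
          (p εstar + s - τ * q εstar)) : ℝ) : ℂ) ∧
      -((d ^ 2 * (k₁ : ℝ) ^ 4 * Real.pi ^ 4 + d * (k₁ : ℝ) ^ 2 * Real.pi ^ 2 * u ^ 2) /
          (p εstar + s - τ * q εstar)) < 0 := by
  obtain ⟨hN1, hN2⟩ := hN0
  have hpi := Real.pi_pos
  have hk : (0 : ℝ) < k₁ := by exact_mod_cast hk₁
  have hu0 : 0 < u := by rw [hu]; positivity
  obtain ⟨w, hw⟩ : ∃ w, w = d * (k₁ : ℝ) ^ 2 * Real.pi ^ 2 := ⟨_, rfl⟩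
  have hw0 : 0 < w := by rw [hw]; positivity
  obtain ⟨c, hc⟩ : ∃ c, c = 2 * u * v - 1 := ⟨_, rfl⟩
  have hc0 : 0 < c := by rw [hc]; exact hN2
  -- lower bound on w
  have hcw : u ^ 2 < c * w := by
    have h1 := hdkk k₁
    rw [← hc] at h1
    have hs1 : 1 / (k₁ : ℝ) ^ 2 + 1 / ((k₁ : ℝ) + 1) ^ 2 ≤
        Real.sqrt ((1 / (k₁ : ℝ) ^ 2 + 1 / ((k₁ : ℝ) + 1) ^ 2) ^ 2 +
            4 * c / ((k₁ : ℝ) ^ 2 * ((k₁ : ℝ) + 1) ^ 2)) := by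
      apply Real.le_sqrt_of_sq_le
      have : 0 ≤ 4 * c / ((k₁ : ℝ) ^ 2 * ((k₁ : ℝ) + 1) ^ 2) := by positivity
      linarith
    have hB : 0 < 1 / ((k₁ : ℝ) + 1) ^ 2 := by positivity
    have h2 : u ^ 2 / (2 * Real.pi ^ 2 * c) * (2 * (1 / (k₁ : ℝ) ^ 2)) < d := by
      refine lt_of_le_of_lt ?_ hdlo
      rw [h1]
      apply mul_le_mul_of_nonneg_left _ (by positivity)
      linarith
    have h3 : u ^ 2 / (2 * Real.pi ^ 2 * c) * (2 * (1 / (k₁ : ℝ) ^ 2)) =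
        u ^ 2 / (c * ((k₁ : ℝ) ^ 2 * Real.pi ^ 2)) := by field_simp
    rw [h3, div_lt_iff₀ (by positivity)] at h2
    rw [hw]; linarith
  have hεv : εstar = (c * w - u ^ 2) / (w * (w + u ^ 2)) := by
    rw [hεstar, hεs, hw, hc]; ring
  have hε0 : 0 < εstar := by
    rw [hεv]; apply div_pos (by linarith) (by positivity)
  have hεm : εstar * (w * (w + u ^ 2)) = c * w - u ^ 2 := by
    rw [hεv]; field_simp
  have hp' : ∀ e, p e = (e + 1) * w + 1 := by intro e; rw [hp, hw]; ring
  have hr' : ∀ e, r e = e * w ^ 2 + w := by intro e; rw [hr, hw]; ring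
  have hq' : ∀ e, q e = e * (u ^ 2 * w) + (u ^ 2 - 2 * u * v * w) := by
    intro e; rw [hq, hw]; ring
  have hnum : d ^ 2 * (k₁ : ℝ) ^ 4 * Real.pi ^ 4 + d * (k₁ : ℝ) ^ 2 * Real.pi ^ 2 * u ^ 2
      = w ^ 2 + w * u ^ 2 := by rw [hw]; ring
  have hqneg : q εstar < 0 := by
    have h1 : q εstar = - r εstar := by
      rw [hq', hr']; linear_combination hεm + w * hc
    rw [h1, hr']
    have : 0 < εstar * w ^ 2 := by positivity
    linarith
  have hden : 0 < p εstar + s - τ * q εstar := by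
    have h1 : 0 ≤ τ * (- q εstar) := mul_nonneg hτ (by linarith)
    have h2 : 0 < εstar * w := by positivity
    rw [hp', hs]
    linarith
  rw [hnum]
  refine ⟨?_, by rw [neg_lt_zero]; positivity⟩
  have hL : HasDerivAt lam (deriv lam εstar) εstar := (hdiff _ hIint).hasDerivAt
  generalize deriv lam εstar = L at hL ⊢
  have hid : HasDerivAt (fun e : ℝ => (e : ℂ)) 1 εstar := Complex.ofRealCLM.hasDerivAt
  have dp : HasDerivAt (fun e : ℝ => (p e : ℂ)) (w : ℂ) εstar := by
    have : (fun e : ℝ => (p e : ℂ)) = fun e : ℝ => ((e : ℂ) + 1) * w + 1 := by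
      funext e; rw [hp']; push_cast; ring
    rw [this]
    simpa using ((hid.add_const 1).mul_const (w : ℂ)).add_const 1
  have dr : HasDerivAt (fun e : ℝ => (r e : ℂ)) ((w : ℂ) ^ 2) εstar := by
    have : (fun e : ℝ => (r e : ℂ)) = fun e : ℝ => (e : ℂ) * (w : ℂ) ^ 2 + w := by
      funext e; rw [hr']; push_cast; ring
    rw [this]
    simpa using (hid.mul_const ((w : ℂ) ^ 2)).add_const (w : ℂ)
  have dq : HasDerivAt (fun e : ℝ => (q e : ℂ)) ((u : ℂ) ^ 2 * w) εstar := by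
    have : (fun e : ℝ => (q e : ℂ)) = fun e : ℝ =>
        (e : ℂ) * ((u : ℂ) ^ 2 * w) + ((u : ℂ) ^ 2 - 2 * u * v * w) := by
      funext e; rw [hq']; push_cast; ring
    rw [this]
    simpa using (hid.mul_const ((u : ℂ) ^ 2 * w)).add_const ((u : ℂ) ^ 2 - 2 * u * v * w)
  have dE : HasDerivAt (fun e : ℝ => Complex.exp (-lam e * (τ : ℂ)))
      (Complex.exp (-lam εstar * (τ : ℂ)) * (-L * τ)) εstar :=
    (hL.neg.mul_const (τ : ℂ)).cexp
  have dF := (((hL.mul hL).add (dp.mul hL)).add dr).add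
    (((hL.const_mul (s : ℂ)).add dq).mul dE)
  have d0 := (hasDerivAt_const εstar (0 : ℂ)).congr_of_eventuallyEq
    (f₁ := fun e : ℝ => D (lam e) τ e)
    (by filter_upwards [hIopen.mem_nhds hIint] with e he using hroot e he)
  have hEq := dF.unique (d0.congr_of_eventuallyEq (by
    refine Filter.Eventually.of_forall fun e => ?_
    simp only [hD, Pi.add_apply, Pi.mul_apply]
    ring))
  simp only [hzero, Pi.add_apply, Pi.mul_apply, neg_zero, zero_mul, Complex.exp_zero, mul_zero] at hEq
  have hden' : ((p εstar : ℂ) + s - τ * q εstar) ≠ 0 := by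
    exact_mod_cast hden.ne'
  push_cast
  rw [← neg_div, eq_div_iff hden']
  linear_combination hEq
end

section
/- Assume (N0) and let d > 0 and ε > ε_*(d). Then for every integer k ≥ 0, every complex root λ of the quadratic D_k(λ, 0, ε) = λ² + (p_k + s)λ + (r_k + q_k) = 0 has strictly negative real part. -/
lemma aux_root_s10 (T D : ℝ) (hT : 0 < T) (hD : 0 < D) (lam : ℂ)
    (h : lam ^ 2 + (T : ℂ) * lam + (D : ℂ) = 0) : lam.re < 0 := by
  by_contra hn
  push Not at hn
  have h1 := congrArg Complex.re h
  have h2 := congrArg Complex.im h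
  simp [pow_two] at h1 h2
  have h3 : lam.im * (2 * lam.re + T) = 0 := by linarith
  rcases mul_eq_zero.mp h3 with h4 | h4
  · rw [h4] at h1
    nlinarith [mul_nonneg hn hn, mul_nonneg hT.le hn]
  · linarith

lemma aux_d (c U A B P d : ℝ) (hc : 0 < c) (hU : 0 < U) (hA : 0 < A) (hB : 0 < B)
    (hP : 0 < P) (hd : 0 < d) :
    U / (2 * P * c) * (1 / A + 1 / B + Real.sqrt ((1 / A + 1 / B) ^ 2 + 4 * c / (A * B))) ≤ d ↔
      0 ≤ c * (d * A * P) * (d * B * P) - U * (d * A * P + d * B * P) - U ^ 2 := by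
  set S := 1 / A + 1 / B with hS
  have hSp : 0 < S := by positivity
  have hq : 0 < 4 * c / (A * B) := by positivity
  set w := Real.sqrt (S ^ 2 + 4 * c / (A * B)) with hw
  have hw2 : w ^ 2 = S ^ 2 + 4 * c / (A * B) := Real.sq_sqrt (by positivity)
  have hwS : S ≤ w := Real.le_sqrt_of_sq_le (by linarith)
  set t := 2 * c * (d * P) / U with ht
  have htp : 0 < t := by positivity
  have key : c * (d * A * P) * (d * B * P) - U * (d * A * P + d * B * P) - U ^ 2
      = (A * B * U ^ 2 / (4 * c)) * (t - S + w) * (t - (S + w)) := by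
    have : (t - S + w) * (t - (S + w)) = t ^ 2 - 2 * t * S - 4 * c / (A * B) := by
      linear_combination -hw2
    rw [mul_assoc (A * B * U ^ 2 / (4 * c)), this, ht, hS]
    field_simp
    ring
  have e1 : U / (2 * P * c) * (S + w) ≤ d ↔ S + w ≤ t := by
    rw [ht, le_div_iff₀ hU, div_mul_eq_mul_div, div_le_iff₀ (by positivity)]
    constructor <;> intro h <;> linarith
  have hpos : 0 < (A * B * U ^ 2 / (4 * c)) * (t - S + w) :=
    mul_pos (by positivity) (by linarith)
  rw [e1, key, mul_nonneg_iff_of_pos_left hpos, sub_nonneg]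

lemma aux_P (c U ε x y : ℝ) (hU : 0 < U) (hx : 0 < x) (hy : 0 < y)
    (hP : 0 < ε * (x * (x + U)) - (c * x - U))
    (hG : 0 ≤ (y - x) * (c * x * y - U * (x + y) - U ^ 2)) :
    0 < ε * (y * (y + U)) - (c * y - U) := by
  have h1 : x * (x + U) * (ε * (y * (y + U)) - (c * y - U)) =
      y * (y + U) * (ε * (x * (x + U)) - (c * x - U)) +
       (y - x) * (c * x * y - U * (x + y) - U ^ 2) := by ring
  have h2 : 0 < y * (y + U) * (ε * (x * (x + U)) - (c * x - U)) := by positivity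
  have h3 : 0 < x * (x + U) := by positivity
  exact pos_of_mul_pos_right (by rw [h1]; linarith) h3.le

/-- Under (N0), if `d > 0` and `ε > ε_*(d)` then for every integer `k ≥ 0`
every complex root of `λ² + (p_k + s)λ + (r_k + q_k) = 0` has negative real part. -/
theorem no_turing_instability_above_first_turing_curve
    (a b d ε : ℝ) (ha : 0 < a) (hb : 0 < b) (hd : 0 < d) (hεpos : 0 < ε)
    (u v : ℝ) (hu : u = a + b) (hv : v = b / (a + b) ^ 2)
    (hN0 : u ^ 2 > 2 * u * v - 1 ∧ 2 * u * v - 1 > 0)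
    (εs : ℕ → ℝ → ℝ)
    (hεs : ∀ (k : ℕ) (d' : ℝ), εs k d' =
      ((2 * u * v - 1) * d' * (k : ℝ) ^ 2 * Real.pi ^ 2 - u ^ 2) /
        (d' * (k : ℝ) ^ 2 * Real.pi ^ 2 * (d' * (k : ℝ) ^ 2 * Real.pi ^ 2 + u ^ 2)))
    (dkk : ℕ → ℝ)
    (hdkk : ∀ k : ℕ, dkk k =
      u ^ 2 / (2 * Real.pi ^ 2 * (2 * u * v - 1)) *
        (1 / (k : ℝ) ^ 2 + 1 / ((k : ℝ) + 1) ^ 2 +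
          Real.sqrt ((1 / (k : ℝ) ^ 2 + 1 / ((k : ℝ) + 1) ^ 2) ^ 2 +
            4 * (2 * u * v - 1) / ((k : ℝ) ^ 2 * ((k : ℝ) + 1) ^ 2))))
    (εP : ℝ → ℝ)
    (hεP1 : ∀ x : ℝ, dkk 1 ≤ x → εP x = εs 1 x)
    (hεPk : ∀ k : ℕ, 2 ≤ k → ∀ x : ℝ, dkk k ≤ x → x < dkk (k - 1) → εP x = εs k x)
    (hε : εP d < ε)
    (p r q : ℕ → ℝ) (s : ℝ)
    (hp : ∀ k : ℕ, p k = (ε + 1) * d * (k : ℝ) ^ 2 * Real.pi ^ 2 + 1)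
    (hr : ∀ k : ℕ, r k = ε * d ^ 2 * (k : ℝ) ^ 4 * Real.pi ^ 4 + d * (k : ℝ) ^ 2 * Real.pi ^ 2)
    (hs : s = u ^ 2 - 2 * u * v)
    (hq : ∀ k : ℕ, q k = (ε * u ^ 2 - 2 * u * v) * d * (k : ℝ) ^ 2 * Real.pi ^ 2 + u ^ 2) :
    ∀ k : ℕ, ∀ lam : ℂ,
      lam ^ 2 + ((p k + s : ℝ) : ℂ) * lam + ((r k + q k : ℝ) : ℂ) = 0 →
        lam.re < 0 := by
  obtain ⟨hN1, hc⟩ := hN0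
  have hup : 0 < u := by rw [hu]; linarith
  have hU : 0 < u ^ 2 := by positivity
  have hpi : 0 < Real.pi ^ 2 := by positivity
  obtain ⟨c, hcd⟩ : ∃ c, c = 2 * u * v - 1 := ⟨_, rfl⟩
  have huv : 2 * u * v = c + 1 := by linarith
  obtain ⟨U, hUd⟩ : ∃ U, U = u ^ 2 := ⟨_, rfl⟩
  obtain ⟨X, hX⟩ : ∃ X : ℕ → ℝ, ∀ k, X k = d * (k : ℝ) ^ 2 * Real.pi ^ 2 := ⟨_, fun _ => rfl⟩
  rw [← hcd] at hc hN1
  rw [← hUd] at hU hN1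
  simp only [← hcd, ← hUd] at hεs hdkk
  have hXpos : ∀ k : ℕ, 1 ≤ k → 0 < X k := by
    intro k hk
    have : (0 : ℝ) < k := by exact_mod_cast hk
    rw [hX]; positivity
  have hXmono : ∀ m n : ℕ, m ≤ n → X m ≤ X n := by
    intro m n h
    rw [hX, hX]
    gcongr
  have hdiff : ∀ k : ℕ, 1 ≤ k → (dkk k ≤ d ↔
      0 ≤ c * X k * X (k + 1) - U * (X k + X (k + 1)) - U ^ 2) := by
    intro k hk
    have hk' : (0 : ℝ) < k := by exact_mod_cast hk
    rw [hdkk, hX, hX]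
    push_cast
    exact aux_d c U ((k : ℝ) ^ 2) (((k : ℝ) + 1) ^ 2) (Real.pi ^ 2) d hc hU (by positivity)
      (by positivity) hpi hd
  have hex : ∃ k : ℕ, 1 ≤ k ∧ dkk k ≤ d := by
    obtain ⟨n, hn⟩ := exists_nat_ge ((2 * U / c + U) / (d * Real.pi ^ 2))
    refine ⟨n + 1, by omega, ?_⟩
    rw [hdiff _ (by omega)]
    have h1 : 2 * U / c + U ≤ X (n + 1) := by
      rw [div_le_iff₀ (by positivity)] at hn
      refine hn.trans ?_
      rw [hX]; push_cast
      have : (n : ℝ) ≤ ((n : ℝ) + 1) ^ 2 := by nlinarith [Nat.cast_nonneg (α := ℝ) n]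
      have h5 : 0 < d * Real.pi ^ 2 := by positivity
      nlinarith
    have h2 := hXmono (n + 1) (n + 1 + 1) (by omega)
    generalize X (n + 1) = x at *
    generalize X (n + 1 + 1) = y at *
    have h0 : 0 < 2 * U / c := by positivity
    have h3 : U + U + c * U ≤ c * x := by
      have : c * (2 * U / c + U) ≤ c * x := by gcongr
      have e : c * (2 * U / c + U) = U + U + c * U := by field_simp; ring
      linarith
    have h4 : U ≤ y := by linarith
    have hcU : 0 < c * U := by positivity
    have hy : 0 < y := by linarith
    have h6 : (U + U) * y + (c * U) * y ≤ c * x * y := by nlinarith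
    have h7 : c * x ≥ 0 := by linarith
    have h8 : U * x ≤ U * y := by gcongr
    have h9 : U * U ≤ c * U * y := by
      have : U * U ≤ U * (c * y) := by
        have : c * x ≤ c * y := by gcongr
        gcongr
        linarith
      linarith
    nlinarith
  classical
  obtain ⟨K, hK1, hKd, hKmin⟩ : ∃ K : ℕ, 1 ≤ K ∧ dkk K ≤ d ∧ ∀ j, 1 ≤ j → j < K → d < dkk j := by
    refine ⟨Nat.find hex, (Nat.find_spec hex).1, (Nat.find_spec hex).2, ?_⟩
    intro j hj hjK
    have := Nat.find_min hex hjK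
    push Not at this
    exact this hj
  have hεK : εs K d < ε := by
    rcases Nat.lt_or_ge K 2 with h | h
    · have : K = 1 := by omega
      subst this
      rwa [← hεP1 d hKd]
    · rwa [← hεPk K h d hKd (hKmin (K - 1) (by omega) (by omega))]
  have hKp := hXpos K hK1
  have hPK : 0 < ε * (X K * (X K + U)) - (c * X K - U) := by
    have e : εs K d = (c * X K - U) / (X K * (X K + U)) := by
      rw [hεs, hX]; congr 1; ring
    rw [e, div_lt_iff₀ (by positivity)] at hεK
    linarith
  have hG := (hdiff K hK1).mp hKd
  have hcK : 0 < c * X K - U := by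
    have h1 := hXpos (K + 1) (by omega)
    have h2 : 0 < U * X K := by positivity
    have h3 : 0 < X (K + 1) * (c * X K - U) := by nlinarith
    exact pos_of_mul_pos_right h3 h1.le
  have hall : ∀ m : ℕ, 0 < ε * (X m * (X m + U)) - (c * X m - U) := by
    intro m
    rcases Nat.eq_zero_or_pos m with h0 | h0
    · subst h0
      have : X 0 = 0 := by rw [hX]; simp
      rw [this]; simpa using hU
    apply aux_P c U ε (X K) (X m) hU hKp (hXpos m h0) hPK
    rcases lt_trichotomy m K with h | h | h
    · have hm := hXmono m (K - 1) (by omega)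
      have h1 := hKmin (K - 1) (by omega) (by omega)
      have h2 := (hdiff (K - 1) (by omega)).not.mp (not_le.mpr h1)
      rw [Nat.sub_add_cancel hK1] at h2
      have h3 := hXmono m K h.le
      apply mul_nonneg_of_nonpos_of_nonpos
      · linarith
      · nlinarith [mul_le_mul_of_nonneg_right hm hcK.le]
    · subst h; simp
    · have hm := hXmono (K + 1) m (by omega)
      have h3 := hXmono K m h.le
      apply mul_nonneg
      · linarith
      · nlinarith [mul_le_mul_of_nonneg_right hm hcK.le]
  intro k lam hl
  refine aux_root_s10 _ _ ?_ ?_ lam hl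
  · have : 0 ≤ X k := by rw [hX]; positivity
    have e : p k + s = (ε + 1) * X k + U - c := by
      rw [hp, hs, hX, huv, ← hUd]; ring
    rw [e]
    have : 0 ≤ (ε + 1) * X k := by positivity
    linarith
  · have e : r k + q k = ε * (X k * (X k + U)) - (c * X k - U) := by
      rw [hr, hq, hX, huv, ← hUd]; ring
    rw [e]; exact hall k
end

section
/- Assume (N0) and let d > 0 and 0 < ε < ε_*(d). Then there exists an integer k ≥ 1 with DET_k < 0, and for this k and every τ ≥ 0 the characteristic equation D_k(λ, τ, ε) = 0 has a real root λ > 0 (so the positive equilibrium is unstable for every delay τ ≥ 0: Turing instability occurs). -/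
/-- Under (N0), if `d > 0` and `0 < ε < ε_*(d)` then some mode `k ≥ 1` has
`DET_k < 0`, and for this `k` the characteristic equation `D_k(λ,τ,ε) = 0`
has a positive real root for every delay `τ ≥ 0` (Turing instability). -/
theorem turing_instability_below_first_turing_curve
    (a b d ε : ℝ) (ha : 0 < a) (hb : 0 < b) (hd : 0 < d)
    (u v : ℝ) (hu : u = a + b) (hv : v = b / (a + b) ^ 2)
    (hN0 : u ^ 2 > 2 * u * v - 1 ∧ 2 * u * v - 1 > 0)
    (εs : ℕ → ℝ → ℝ)
    (hεs : ∀ (k : ℕ) (d' : ℝ), εs k d' =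
      ((2 * u * v - 1) * d' * (k : ℝ) ^ 2 * Real.pi ^ 2 - u ^ 2) /
        (d' * (k : ℝ) ^ 2 * Real.pi ^ 2 * (d' * (k : ℝ) ^ 2 * Real.pi ^ 2 + u ^ 2)))
    (dkk : ℕ → ℝ)
    (hdkk : ∀ k : ℕ, dkk k =
      u ^ 2 / (2 * Real.pi ^ 2 * (2 * u * v - 1)) *
        (1 / (k : ℝ) ^ 2 + 1 / ((k : ℝ) + 1) ^ 2 +
          Real.sqrt ((1 / (k : ℝ) ^ 2 + 1 / ((k : ℝ) + 1) ^ 2) ^ 2 +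
            4 * (2 * u * v - 1) / ((k : ℝ) ^ 2 * ((k : ℝ) + 1) ^ 2))))
    (εP : ℝ → ℝ)
    (hεP1 : ∀ x : ℝ, dkk 1 ≤ x → εP x = εs 1 x)
    (hεPk : ∀ k : ℕ, 2 ≤ k → ∀ x : ℝ, dkk k ≤ x → x < dkk (k - 1) → εP x = εs k x)
    (hε : 0 < ε ∧ ε < εP d)
    (p r q DET : ℕ → ℝ) (s : ℝ)
    (hp : ∀ k : ℕ, p k = (ε + 1) * d * (k : ℝ) ^ 2 * Real.pi ^ 2 + 1)
    (hr : ∀ k : ℕ, r k = ε * d ^ 2 * (k : ℝ) ^ 4 * Real.pi ^ 4 + d * (k : ℝ) ^ 2 * Real.pi ^ 2)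
    (hs : s = u ^ 2 - 2 * u * v)
    (hq : ∀ k : ℕ, q k = (ε * u ^ 2 - 2 * u * v) * d * (k : ℝ) ^ 2 * Real.pi ^ 2 + u ^ 2)
    (hDET : ∀ k : ℕ, DET k = r k + q k) :
    ∃ k : ℕ, 1 ≤ k ∧ DET k < 0 ∧
      ∀ τ : ℝ, 0 ≤ τ →
        ∃ lam : ℝ, 0 < lam ∧
          lam ^ 2 + p k * lam + r k + (s * lam + q k) * Real.exp (-lam * τ) = 0 := by
  obtain ⟨hN1, hN2⟩ := hN0
  obtain ⟨hε0, hε1⟩ := hε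
  have hpi := Real.pi_pos
  have hupos : 0 < u := by rw [hu]; positivity
  have hA : Filter.Tendsto (fun k : ℕ => 1 / (k : ℝ) ^ 2) Filter.atTop (nhds 0) := by
    have := (tendsto_one_div_atTop_nhds_zero_nat (𝕜 := ℝ)).pow 2
    simpa using this
  have hB : Filter.Tendsto (fun k : ℕ => 1 / ((k : ℝ) + 1) ^ 2) Filter.atTop (nhds 0) := by
    have := (tendsto_one_div_add_atTop_nhds_zero_nat (𝕜 := ℝ)).pow 2
    simpa using this
  have hlim : Filter.Tendsto dkk Filter.atTop (nhds 0) := by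
    have h1 := (hA.add hB).add
      ((((hA.add hB).pow 2).add ((hA.mul hB).const_mul (4 * (2 * u * v - 1)))).sqrt)
    have h2 := h1.const_mul (u ^ 2 / (2 * Real.pi ^ 2 * (2 * u * v - 1)))
    have e : (u ^ 2 / (2 * Real.pi ^ 2 * (2 * u * v - 1))) *
        ((0:ℝ) + 0 + Real.sqrt ((0 + 0) ^ 2 + 4 * (2 * u * v - 1) * (0 * 0))) = 0 := by simp
    rw [e] at h2
    refine h2.congr (fun k => ?_)
    rw [hdkk k]
    congr 4
    rw [one_div_mul_one_div, mul_one_div]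
  have hex : ∃ k : ℕ, 1 ≤ k ∧ dkk k ≤ d := by
    obtain ⟨k, h1, h2⟩ := ((Filter.eventually_ge_atTop 1).and
      (hlim.eventually (gt_mem_nhds hd))).exists
    exact ⟨k, h1, h2.le⟩
  have hk : ∃ k : ℕ, 1 ≤ k ∧ εP d = εs k d := by
    classical
    obtain ⟨h1, h2⟩ := Nat.find_spec hex
    have h3 := fun m => Nat.find_min hex (m := m)
    generalize Nat.find hex = k at h1 h2 h3
    refine ⟨k, h1, ?_⟩
    rcases Nat.lt_or_ge k 2 with h | h
    · obtain rfl : k = 1 := by omega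
      exact hεP1 d h2
    · refine hεPk k h d h2 ?_
      have := h3 (k - 1) (by omega)
      by_contra hc
      exact this ⟨by omega, not_lt.mp hc⟩
  obtain ⟨k, hk1, hk2⟩ := hk
  have hkpos : (0:ℝ) < k := by exact_mod_cast hk1
  have hdet : DET k < 0 := by
    rw [hk2, hεs, lt_div_iff₀ (by positivity)] at hε1
    rw [hDET, hr, hq]
    nlinarith
  refine ⟨k, hk1, hdet, fun τ hτ => ?_⟩
  have hp0 : 0 < p k := by rw [hp]; positivity
  have hr0 : 0 < r k := by rw [hr]; positivity
  rw [hDET] at hdet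
  generalize p k = P at *
  generalize r k = R at *
  generalize q k = Q at *
  set f : ℝ → ℝ := fun x => x ^ 2 + P * x + R + (s * x + Q) * Real.exp (-x * τ) with hf
  have hfc : Continuous f := by fun_prop
  set L : ℝ := 1 + |s| + |Q| with hL
  have hs0 := abs_nonneg s
  have hQ0 := abs_nonneg Q
  have hLpos : 0 < L := by positivity
  have hf0 : f 0 < 0 := by simpa [hf] using hdet
  have hfL : 0 < f L := by
    have he1 : Real.exp (-L * τ) ≤ 1 := Real.exp_le_one_iff.mpr (by nlinarith)
    have he0 := Real.exp_pos (-L * τ)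
    have h1 : -(|s| * L + |Q|) ≤ (s * L + Q) * Real.exp (-L * τ) := by
      have h2 : |(s * L + Q) * Real.exp (-L * τ)| ≤ |s| * L + |Q| := by
        rw [abs_mul, abs_of_pos he0]
        have h3 : |s * L + Q| ≤ |s| * L + |Q| := by
          calc _ ≤ |s * L| + |Q| := abs_add_le _ _
            _ = _ := by rw [abs_mul, abs_of_pos hLpos]
        calc _ ≤ |s * L + Q| * 1 := by gcongr
          _ ≤ _ := by linarith
      exact (abs_le.mp h2).1
    have h4 : |s| * L + |Q| ≤ L ^ 2 := by nlinarith
    have h5 : 0 < P * L := by positivity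
    simp only [hf]
    linarith
  obtain ⟨x, hx, hx0⟩ := intermediate_value_Ioo hLpos.le hfc.continuousOn
    (show (0:ℝ) ∈ Set.Ioo (f 0) (f L) from ⟨hf0, hfL⟩)
  exact ⟨x, hx.1, hx0⟩
end

section
/- Assume (N0) and suppose ε > ε₁ = (√(2u*v*) − 1)²/u*². Then for every d > 0 and every integer k ≥ 0 one has DET_k > 0, and consequently every complex root of the quadratic λ² + (p_k + s)λ + DET_k = 0 has strictly negative real part; in particular Turing instability does not occur, and this criterion is independent of the diffusion rates. -/
theorem aux_root_s12 (P D : ℝ) (hP : 0 < P) (hD : 0 < D) (z : ℂ)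
    (h : z ^ 2 + (P : ℂ) * z + (D : ℂ) = 0) : z.re < 0 := by
  have h1 := congrArg Complex.re h
  have h2 := congrArg Complex.im h
  simp [pow_two] at h1 h2
  by_contra hc
  push Not at hc
  have h3 : z.im * (2 * z.re + P) = 0 := by linarith
  rcases mul_eq_zero.mp h3 with h4 | h4
  · rw [h4] at h1
    nlinarith [mul_nonneg hP.le hc, mul_nonneg hc hc]
  · linarith

theorem aux_det (ε u c x : ℝ) (hε : 0 < ε) (hu : 0 < u) (hc : 1 < c)
    (h : (Real.sqrt c - 1) ^ 2 / u ^ 2 < ε) (hx : 0 ≤ x) :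
    0 < ε * x ^ 2 + (1 + ε * u ^ 2 - c) * x + u ^ 2 := by
  have he : Real.sqrt ε ^ 2 = ε := Real.sq_sqrt hε.le
  have hw : Real.sqrt c ^ 2 = c := Real.sq_sqrt (by linarith)
  have he0 : 0 < Real.sqrt ε := Real.sqrt_pos.mpr hε
  have hw0 : 0 ≤ Real.sqrt c := Real.sqrt_nonneg c
  generalize Real.sqrt ε = e at *
  generalize Real.sqrt c = w at *
  subst he hw
  rw [div_lt_iff₀ (by positivity), ← mul_pow] at h
  have h1 : w - 1 < e * u := lt_of_pow_lt_pow_left₀ 2 (by positivity) h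
  have h2 : w ^ 2 < (e * u + 1) ^ 2 := by
    apply pow_lt_pow_left₀ (by linarith) hw0 (by norm_num)
  rcases hx.eq_or_lt with rfl | hx
  · simp; positivity
  · nlinarith [mul_pos (sub_pos.mpr h2) hx, sq_nonneg (e * x - u)]

/-- Under (N0), if `ε > ε₁ = (√(2uv) − 1)²/u²`, then for every `d > 0` and every
integer `k ≥ 0` one has `DET_k > 0`, and every complex root of
`λ² + (p_k + s)λ + DET_k = 0` has strictly negative real part:
Turing instability does not occur, independently of diffusion rates. -/
theorem no_turing_instability_above_eps1
    (a b ε : ℝ) (ha : 0 < a) (hb : 0 < b) (hεpos : 0 < ε)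
    (u v : ℝ) (hu : u = a + b) (hv : v = b / (a + b) ^ 2)
    (hN0 : u ^ 2 > 2 * u * v - 1 ∧ 2 * u * v - 1 > 0)
    (ε₁ : ℝ) (hε₁ : ε₁ = (Real.sqrt (2 * u * v) - 1) ^ 2 / u ^ 2)
    (hε : ε > ε₁) :
    ∀ d : ℝ, 0 < d → ∀ k : ℕ,
      (0 < ε * d ^ 2 * (k : ℝ) ^ 4 * Real.pi ^ 4 + d * (k : ℝ) ^ 2 * Real.pi ^ 2 +
          ((ε * u ^ 2 - 2 * u * v) * d * (k : ℝ) ^ 2 * Real.pi ^ 2 + u ^ 2)) ∧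
        ∀ lam : ℂ,
          lam ^ 2 +
              ((((ε + 1) * d * (k : ℝ) ^ 2 * Real.pi ^ 2 + 1) + (u ^ 2 - 2 * u * v) : ℝ) : ℂ) *
                lam +
              ((ε * d ^ 2 * (k : ℝ) ^ 4 * Real.pi ^ 4 + d * (k : ℝ) ^ 2 * Real.pi ^ 2 +
                  ((ε * u ^ 2 - 2 * u * v) * d * (k : ℝ) ^ 2 * Real.pi ^ 2 + u ^ 2) : ℝ) : ℂ) = 0 →
            lam.re < 0 := by
  intro d hd k
  have hu0 : 0 < u := by rw [hu]; positivity
  rw [hε₁] at hε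
  have hx : 0 ≤ d * (k : ℝ) ^ 2 * Real.pi ^ 2 := by positivity
  have hD := aux_det ε u (2 * u * v) _ hεpos hu0 (by linarith [hN0.2]) hε hx
  have hD' : 0 < ε * d ^ 2 * (k : ℝ) ^ 4 * Real.pi ^ 4 + d * (k : ℝ) ^ 2 * Real.pi ^ 2 +
          ((ε * u ^ 2 - 2 * u * v) * d * (k : ℝ) ^ 2 * Real.pi ^ 2 + u ^ 2) := by
    refine lt_of_lt_of_eq hD ?_
    ring
  refine ⟨hD', fun lam hl => aux_root_s12 _ _ ?_ hD' lam hl⟩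
  have : 0 ≤ (ε + 1) * d * (k : ℝ) ^ 2 * Real.pi ^ 2 := by positivity
  linarith [hN0.1]
end

section
/- Fix d>0, ε>0 and an integer k ≥ 0. If ω > 0 and τ ≥ 0 satisfy D_k(iω, τ, ε) = 0, then ω⁴ + (p_k² − s² − 2r_k)ω² + r_k² − q_k² = 0; moreover, if s²ω² + q_k² > 0 then cos(ωτ) = (q_k(ω² − r_k) − p_k s ω²)/(s²ω² + q_k²) and sin(ωτ) = (sω(ω² − r_k) + p_k q_k ω)/(s²ω² + q_k²). -/
/-- If `ω > 0` and `τ ≥ 0` satisfy `D_k(iω, τ, ε) = 0`, then `ω` solves the quartic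
`ω⁴ + (p_k² − s² − 2r_k)ω² + r_k² − q_k² = 0`; moreover if `s²ω² + q_k² > 0` then
`cos(ωτ)` and `sin(ωτ)` are given by the stated formulas. -/
theorem purely_imaginary_root_equations
    (a b d ε : ℝ) (ha : 0 < a) (hb : 0 < b) (hd : 0 < d) (hεpos : 0 < ε)
    (u v : ℝ) (hu : u = a + b) (hv : v = b / (a + b) ^ 2)
    (k : ℕ)
    (p r q s : ℝ)
    (hp : p = (ε + 1) * d * (k : ℝ) ^ 2 * Real.pi ^ 2 + 1)
    (hr : r = ε * d ^ 2 * (k : ℝ) ^ 4 * Real.pi ^ 4 + d * (k : ℝ) ^ 2 * Real.pi ^ 2)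
    (hs : s = u ^ 2 - 2 * u * v)
    (hq : q = (ε * u ^ 2 - 2 * u * v) * d * (k : ℝ) ^ 2 * Real.pi ^ 2 + u ^ 2)
    (ω τ : ℝ) (hω : 0 < ω) (hτ : 0 ≤ τ)
    (hroot : (Complex.I * (ω : ℂ)) ^ 2 + (p : ℂ) * (Complex.I * (ω : ℂ)) + (r : ℂ) +
        ((s : ℂ) * (Complex.I * (ω : ℂ)) + (q : ℂ)) *
          Complex.exp (-(Complex.I * (ω : ℂ)) * (τ : ℂ)) = 0) :
    ω ^ 4 + (p ^ 2 - s ^ 2 - 2 * r) * ω ^ 2 + r ^ 2 - q ^ 2 = 0 ∧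
      (s ^ 2 * ω ^ 2 + q ^ 2 > 0 →
        Real.cos (ω * τ) = (q * (ω ^ 2 - r) - p * s * ω ^ 2) / (s ^ 2 * ω ^ 2 + q ^ 2) ∧
        Real.sin (ω * τ) = (s * ω * (ω ^ 2 - r) + p * q * ω) / (s ^ 2 * ω ^ 2 + q ^ 2)) := by
  have he : Complex.exp (-(Complex.I * (ω : ℂ)) * (τ : ℂ)) =
      (Real.cos (ω * τ) : ℂ) - (Real.sin (ω * τ) : ℂ) * Complex.I := by
    have h : -(Complex.I * (ω : ℂ)) * (τ : ℂ) = ((-(ω * τ) : ℝ) : ℂ) * Complex.I := by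
      push_cast; ring
    rw [h, Complex.exp_mul_I, ← Complex.ofReal_cos, ← Complex.ofReal_sin, Real.cos_neg,
      Real.sin_neg]
    push_cast; ring
  rw [he] at hroot
  have hcs := Real.sin_sq_add_cos_sq (ω * τ)
  generalize Real.cos (ω * τ) = C at *
  generalize Real.sin (ω * τ) = S at *
  have hre : q * C + s * ω * S - (ω ^ 2 - r) = 0 := by
    have h := congrArg Complex.re hroot
    simp [pow_two] at h
    linarith
  have him : s * ω * C - q * S + p * ω = 0 := by
    have h := congrArg Complex.im hroot
    simp [pow_two] at h
    linarith
  refine ⟨?_, fun hpos => ⟨?_, ?_⟩⟩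
  · linear_combination -(q * C + s * ω * S + (ω ^ 2 - r)) * hre -
      (s * ω * C - q * S - p * ω) * him + (s ^ 2 * ω ^ 2 + q ^ 2) * hcs
  · rw [eq_div_iff hpos.ne']
    linear_combination q * hre + s * ω * him
  · rw [eq_div_iff hpos.ne']
    linear_combination s * ω * hre - q * him
end

section
/- Fix d>0, ε>0 and an integer k ≥ 0, and suppose ω > 0 satisfies ω⁴ + (p_k² − s² − 2r_k)ω² + r_k² − q_k² = 0 and s²ω² + q_k² > 0. Then there exists a unique τ_k ∈ (0, 2π/ω] such that D_k(iω, τ_k, ε) = 0, and for every integer j ≥ 0 one has D_k(iω, τ_k + 2πj/ω, ε) = 0; that is, ±iω are purely imaginary roots of the characteristic equation exactly at the delays τ_k^{(j)} = τ_k + 2πj/ω. -/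
/-- If `ω > 0` solves the quartic `ω⁴ + (p_k² − s² − 2r_k)ω² + r_k² − q_k² = 0` and
`s²ω² + q_k² > 0`, then there is a unique `τ_k ∈ (0, 2π/ω]` with `D_k(iω, τ_k, ε) = 0`,
and `±iω` are roots of `D_k(·, τ_k + 2πj/ω, ε)` for every integer `j ≥ 0`. -/
theorem critical_delays_for_purely_imaginary_roots
    (a b d ε : ℝ) (ha : 0 < a) (hb : 0 < b) (hd : 0 < d) (hεpos : 0 < ε)
    (u v : ℝ) (hu : u = a + b) (hv : v = b / (a + b) ^ 2)
    (k : ℕ)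
    (p r q s : ℝ)
    (hp : p = (ε + 1) * d * (k : ℝ) ^ 2 * Real.pi ^ 2 + 1)
    (hr : r = ε * d ^ 2 * (k : ℝ) ^ 4 * Real.pi ^ 4 + d * (k : ℝ) ^ 2 * Real.pi ^ 2)
    (hs : s = u ^ 2 - 2 * u * v)
    (hq : q = (ε * u ^ 2 - 2 * u * v) * d * (k : ℝ) ^ 2 * Real.pi ^ 2 + u ^ 2)
    (D : ℂ → ℝ → ℂ)
    (hD : ∀ (lam : ℂ) (τ : ℝ),
      D lam τ = lam ^ 2 + (p : ℂ) * lam + (r : ℂ) +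
        ((s : ℂ) * lam + (q : ℂ)) * Complex.exp (-lam * (τ : ℂ)))
    (ω : ℝ) (hω : 0 < ω)
    (hquartic : ω ^ 4 + (p ^ 2 - s ^ 2 - 2 * r) * ω ^ 2 + r ^ 2 - q ^ 2 = 0)
    (hpos : s ^ 2 * ω ^ 2 + q ^ 2 > 0) :
    ∃ τk : ℝ, 0 < τk ∧ τk ≤ 2 * Real.pi / ω ∧
      D (Complex.I * (ω : ℂ)) τk = 0 ∧
      (∀ τ' : ℝ, 0 < τ' → τ' ≤ 2 * Real.pi / ω →
        D (Complex.I * (ω : ℂ)) τ' = 0 → τ' = τk) ∧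
      ∀ j : ℕ,
        D (Complex.I * (ω : ℂ)) (τk + 2 * Real.pi * (j : ℝ) / ω) = 0 ∧
        D (-(Complex.I * (ω : ℂ))) (τk + 2 * Real.pi * (j : ℝ) / ω) = 0 := by
  have hωc : (ω : ℂ) ≠ 0 := by exact_mod_cast hω.ne'
  set A : ℂ := ⟨r - ω ^ 2, p * ω⟩ with hA
  set B : ℂ := ⟨q, s * ω⟩ with hB
  have hDI : ∀ τ : ℝ, D (Complex.I * (ω : ℂ)) τ =
      A + B * Complex.exp (-(Complex.I * (ω : ℂ)) * (τ : ℂ)) := by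
    intro τ
    rw [hD]
    have h1 : (Complex.I * (ω : ℂ)) ^ 2 + (p : ℂ) * (Complex.I * (ω : ℂ)) + (r : ℂ) = A := by
      apply Complex.ext <;> simp [hA, pow_two] <;> ring
    have h2 : (s : ℂ) * (Complex.I * (ω : ℂ)) + (q : ℂ) = B := by
      apply Complex.ext <;> simp [hB]
    rw [h1, h2]
  have hconj : ∀ τ : ℝ, D (-(Complex.I * (ω : ℂ))) τ =
      (starRingEnd ℂ) (D (Complex.I * (ω : ℂ)) τ) := by
    intro τ
    rw [hD, hD]
    simp only [map_add, map_mul, map_pow, ← Complex.exp_conj, map_neg, Complex.conj_I,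
      Complex.conj_ofReal]
    simp only [neg_mul]
  have hnB : Complex.normSq B = s ^ 2 * ω ^ 2 + q ^ 2 := by
    rw [hB, Complex.normSq_mk]; ring
  have hnA : Complex.normSq A = Complex.normSq B := by
    rw [hnB, hA, Complex.normSq_mk]; linarith
  have hB0 : B ≠ 0 := by
    rw [← Complex.normSq_pos, hnB]; exact hpos
  have hnorm : ‖-A / B‖ = 1 := by
    rw [norm_div, norm_neg, Complex.norm_def, Complex.norm_def, hnA, div_self]
    rw [hnB]; exact (Real.sqrt_pos.mpr hpos).ne'
  have hW : Complex.exp ((Complex.arg (-A / B) : ℂ) * Complex.I) = -A / B := by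
    have := Complex.norm_mul_exp_arg_mul_I (-A / B)
    rwa [hnorm, Complex.ofReal_one, one_mul] at this
  have hiff : ∀ τ : ℝ, D (Complex.I * (ω : ℂ)) τ = 0 ↔
      Complex.exp (-(Complex.I * (ω : ℂ)) * (τ : ℂ)) = -A / B := by
    intro τ
    rw [hDI, eq_div_iff hB0]
    constructor
    · intro h; linear_combination h
    · intro h; linear_combination h
  set θ := Complex.arg (-A / B)
  have hmem := toIocMod_mem_Ioc Real.two_pi_pos 0 (-θ)
  have hself := toIocMod_add_toIocDiv_zsmul Real.two_pi_pos 0 (-θ)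
  set φ := toIocMod Real.two_pi_pos 0 (-θ)
  set n := toIocDiv Real.two_pi_pos 0 (-θ)
  rw [zero_add] at hmem
  have hselfc : (φ : ℂ) + n * (2 * Real.pi) = -θ := by
    rw [zsmul_eq_mul] at hself
    exact_mod_cast hself
  have hroot : ∀ j : ℕ,
      D (Complex.I * (ω : ℂ)) (φ / ω + 2 * Real.pi * (j : ℝ) / ω) = 0 := by
    intro j
    rw [hiff, ← hW, Complex.exp_eq_exp_iff_exists_int]
    refine ⟨n - j, ?_⟩
    push_cast
    field_simp
    linear_combination (-1 : ℂ) * hselfc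
  have hroot0 : D (Complex.I * (ω : ℂ)) (φ / ω) = 0 := by
    simpa using hroot 0
  refine ⟨φ / ω, div_pos hmem.1 hω, by have := hmem.2; gcongr, hroot0, ?_, ?_⟩
  · intro τ' h1 h2 h3
    rw [hiff] at h3
    have h4 := (hiff _).1 hroot0
    obtain ⟨m, hm⟩ := Complex.exp_eq_exp_iff_exists_int.1 (h3.trans h4.symm)
    have hm2 : ω * τ' = φ - m * (2 * Real.pi) := by
      have : (ω : ℂ) * τ' = φ - m * (2 * Real.pi) := by
        push_cast at hm
        field_simp at hm
        apply mul_left_cancel₀ Complex.I_ne_zero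
        linear_combination (-Complex.I) * hm
      exact_mod_cast this
    have h5 : 0 < ω * τ' := mul_pos hω h1
    have h6 : ω * τ' ≤ 2 * Real.pi := by
      rw [le_div_iff₀ hω] at h2; linarith
    have hpi := Real.pi_pos
    have hm0 : m = 0 := by
      have ha1 : (m : ℝ) < 1 := by
        by_contra hc
        push Not at hc
        nlinarith [hmem.2]
      have ha2 : (-1 : ℝ) < m := by
        by_contra hc
        push Not at hc
        nlinarith [hmem.1]
      have ha1' : m < 1 := by exact_mod_cast ha1
      have ha2' : -1 < m := by exact_mod_cast ha2
      omega
    rw [eq_div_iff hω.ne']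
    rw [hm0] at hm2
    push_cast at hm2
    linarith
  · intro j
    exact ⟨hroot j, by rw [hconj, hroot j, map_zero]⟩
end

section
/- Assume (N0), d > 0 and ε ≥ ε_*(d). Then for every integer k with 0 ≤ k < K⁰(ε), the quantity ω_k⁺ = (√2/2)·( s² − p_k² + 2r_k + √( (s² − p_k² + 2r_k)² − 4(r_k² − q_k²) ) )^{1/2} is a well-defined strictly positive real number and is a root of the quartic equation ω⁴ + (p_k² − s² − 2r_k)ω² + r_k² − q_k² = 0. -/
/-- Under (N0), `d > 0` and `ε ≥ ε_*(d)`: for every integer `k` with `0 ≤ k < K⁰(ε)`,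
the quantity `ω_k⁺` is a well-defined strictly positive real number and solves the
quartic `ω⁴ + (p_k² − s² − 2r_k)ω² + r_k² − q_k² = 0`. -/
theorem omega_plus_positive_root
    (a b d ε : ℝ) (ha : 0 < a) (hb : 0 < b) (hd : 0 < d) (hεpos : 0 < ε)
    (u v : ℝ) (hu : u = a + b) (hv : v = b / (a + b) ^ 2)
    (hN0 : u ^ 2 > 2 * u * v - 1 ∧ 2 * u * v - 1 > 0)
    (εs : ℕ → ℝ → ℝ)
    (hεs : ∀ (k : ℕ) (d' : ℝ), εs k d' =
      ((2 * u * v - 1) * d' * (k : ℝ) ^ 2 * Real.pi ^ 2 - u ^ 2) /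
        (d' * (k : ℝ) ^ 2 * Real.pi ^ 2 * (d' * (k : ℝ) ^ 2 * Real.pi ^ 2 + u ^ 2)))
    (dkk : ℕ → ℝ)
    (hdkk : ∀ k : ℕ, dkk k =
      u ^ 2 / (2 * Real.pi ^ 2 * (2 * u * v - 1)) *
        (1 / (k : ℝ) ^ 2 + 1 / ((k : ℝ) + 1) ^ 2 +
          Real.sqrt ((1 / (k : ℝ) ^ 2 + 1 / ((k : ℝ) + 1) ^ 2) ^ 2 +
            4 * (2 * u * v - 1) / ((k : ℝ) ^ 2 * ((k : ℝ) + 1) ^ 2))))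
    (εP : ℝ → ℝ)
    (hεP1 : ∀ x : ℝ, dkk 1 ≤ x → εP x = εs 1 x)
    (hεPk : ∀ k : ℕ, 2 ≤ k → ∀ x : ℝ, dkk k ≤ x → x < dkk (k - 1) → εP x = εs k x)
    (hε : εP d ≤ ε)
    (p r q : ℕ → ℝ) (s : ℝ)
    (hp : ∀ k : ℕ, p k = (ε + 1) * d * (k : ℝ) ^ 2 * Real.pi ^ 2 + 1)
    (hr : ∀ k : ℕ, r k = ε * d ^ 2 * (k : ℝ) ^ 4 * Real.pi ^ 4 + d * (k : ℝ) ^ 2 * Real.pi ^ 2)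
    (hs : s = u ^ 2 - 2 * u * v)
    (hq : ∀ k : ℕ, q k = (ε * u ^ 2 - 2 * u * v) * d * (k : ℝ) ^ 2 * Real.pi ^ 2 + u ^ 2)
    (K0 : ℝ)
    (hK0 : K0 = 1 / (Real.sqrt (2 * ε * d) * Real.pi) *
      Real.sqrt ((ε * u ^ 2 - 2 * u * v - 1) +
        Real.sqrt ((ε * u ^ 2 - 2 * u * v - 1) ^ 2 + 4 * ε * u ^ 2)))
    (ωp : ℕ → ℝ)
    (hωp : ∀ k : ℕ, ωp k = Real.sqrt 2 / 2 *
      Real.sqrt (s ^ 2 - p k ^ 2 + 2 * r k +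
        Real.sqrt ((s ^ 2 - p k ^ 2 + 2 * r k) ^ 2 - 4 * (r k ^ 2 - q k ^ 2)))) :
    ∀ k : ℕ, (k : ℝ) < K0 →
      (s ^ 2 - p k ^ 2 + 2 * r k) ^ 2 - 4 * (r k ^ 2 - q k ^ 2) ≥ 0 ∧
        0 < ωp k ∧
        ωp k ^ 4 + (p k ^ 2 - s ^ 2 - 2 * r k) * ωp k ^ 2 + r k ^ 2 - q k ^ 2 = 0 := by
  intro k hk
  have hA : 0 < u ^ 2 := by
    have : 0 < u := by rw [hu]; linarith
    positivity
  have hpi := Real.pi_pos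
  have key : r k < q k := by
    rw [hr, hq]
    rw [hK0] at hk
    set M : ℝ := ε * u ^ 2 - 2 * u * v - 1 with hM
    set S : ℝ := Real.sqrt (M ^ 2 + 4 * ε * u ^ 2) with hS
    have hpos : 0 < 4 * ε * u ^ 2 := by positivity
    have hSsq : S ^ 2 = M ^ 2 + 4 * ε * u ^ 2 := Real.sq_sqrt (by positivity)
    have hS0 : 0 ≤ S := Real.sqrt_nonneg _
    have habs : |M| < S := by
      apply abs_lt_of_sq_lt_sq _ hS0
      linarith
    obtain ⟨h1, h2⟩ := abs_lt.mp habs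
    have hc : 0 < Real.sqrt (2 * ε * d) := Real.sqrt_pos.mpr (by positivity)
    have hc2 : Real.sqrt (2 * ε * d) ^ 2 = 2 * ε * d := Real.sq_sqrt (by positivity)
    have hk2 : (k : ℝ) * (Real.sqrt (2 * ε * d) * Real.pi) < Real.sqrt (M + S) := by
      rwa [one_div, inv_mul_eq_div, lt_div_iff₀ (by positivity)] at hk
    have hk3 := Real.lt_sqrt (by positivity) |>.mp hk2
    have hk4 : (k : ℝ) ^ 2 * (2 * ε * d * Real.pi ^ 2) < M + S := by
      rw [mul_pow, mul_pow, hc2] at hk3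
      exact hk3
    set x : ℝ := d * (k : ℝ) ^ 2 * Real.pi ^ 2 with hx
    have hx0 : 0 ≤ x := by positivity
    have h3 : 2 * ε * x < M + S := by rw [hx]; linarith
    have h4 : 0 ≤ ε * x := by positivity
    have h5 : 0 < (S - (2 * ε * x - M)) * (S + (2 * ε * x - M)) :=
      mul_pos (by linarith) (by linarith)
    have h6 : 0 < 4 * ε * (u ^ 2 + M * x - ε * x ^ 2) := by nlinarith
    have h7 : 0 < u ^ 2 + M * x - ε * x ^ 2 := (mul_pos_iff_of_pos_left (by positivity)).mp h6
    have e1 : ε * d ^ 2 * (k : ℝ) ^ 4 * Real.pi ^ 4 = ε * x ^ 2 := by rw [hx]; ring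
    have e2 : (ε * u ^ 2 - 2 * u * v) * d * (k : ℝ) ^ 2 * Real.pi ^ 2 = (M + 1) * x := by
      rw [hx, hM]; ring
    rw [e1, e2]
    linarith
  have hr0 : 0 ≤ r k := by rw [hr]; positivity
  have hneg : r k ^ 2 - q k ^ 2 < 0 := by nlinarith
  rw [hωp]
  set T : ℝ := s ^ 2 - p k ^ 2 + 2 * r k with hT
  set E : ℝ := r k ^ 2 - q k ^ 2 with hE
  have hD : 0 ≤ T ^ 2 - 4 * E := by nlinarith [sq_nonneg T]
  set R : ℝ := Real.sqrt (T ^ 2 - 4 * E) with hR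
  have hRsq : R ^ 2 = T ^ 2 - 4 * E := Real.sq_sqrt hD
  have hR0 : 0 ≤ R := Real.sqrt_nonneg _
  have habs : |T| < R := by
    apply abs_lt_of_sq_lt_sq _ hR0
    linarith
  obtain ⟨h1, h2⟩ := abs_lt.mp habs
  have hW : 0 < T + R := by linarith
  refine ⟨hD, ?_, ?_⟩
  · have := Real.sqrt_pos.mpr hW
    positivity
  · have hsq : (Real.sqrt 2 / 2 * Real.sqrt (T + R)) ^ 2 = (T + R) / 2 := by
      rw [mul_pow, div_pow, Real.sq_sqrt hW.le, Real.sq_sqrt (by norm_num)]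
      ring
    have h4 : (Real.sqrt 2 / 2 * Real.sqrt (T + R)) ^ 4 = ((T + R) / 2) ^ 2 := by
      rw [← hsq]; ring
    have e : p k ^ 2 - s ^ 2 - 2 * r k = -T := by rw [hT]; ring
    rw [h4, hsq, e]
    linear_combination hRsq / 4 - hE
end

section
/- Assume (N0), d > 0 and ε ≥ ε_*(d). Suppose either (a) (u*² − 2u*v*)²(ε² + 1) < 1, or (b) (u*² − 2u*v*)²(ε² + 1) ≥ 1 and K⁰(ε) ≥ K⁺. Then for every integer k ≥ K⁰(ε), the quartic equation ω⁴ + (p_k² − s² − 2r_k)ω² + r_k² − q_k² = 0 has no root ω > 0. -/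
set_option maxHeartbeats 2000000

lemma aux_char (A U c S T : ℝ) (hA : 0 < A) (hU : 0 < U) (hc : 0 < c) (hS : 0 ≤ S) (hT : 0 ≤ T) :
    U / (2 * A) * (S + Real.sqrt (S ^ 2 + 4 * A * T)) ≤ c ↔
      0 ≤ A * c ^ 2 - U * c * S - U ^ 2 * T := by
  have hD : 0 ≤ S ^ 2 + 4 * A * T := by positivity
  have h1 : U / (2 * A) * (S + Real.sqrt (S ^ 2 + 4 * A * T)) ≤ c ↔
      Real.sqrt (S ^ 2 + 4 * A * T) ≤ 2 * A * c / U - S := by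
    rw [le_sub_iff_add_le, le_div_iff₀ hU, div_mul_eq_mul_div, div_le_iff₀ (by positivity)]
    constructor <;> intro h <;> linarith
  rw [h1, Real.sqrt_le_iff]
  obtain ⟨w, hw⟩ : ∃ w, w = c / U := ⟨_, rfl⟩
  have hw0 : 0 < w := by rw [hw]; positivity
  have hcw : c = w * U := by rw [hw]; field_simp
  have e1 : 2 * A * c / U = 2 * A * w := by rw [hw]; ring
  have e2 : A * c ^ 2 - U * c * S - U ^ 2 * T = U ^ 2 * (A * w ^ 2 - w * S - T) := by
    rw [hcw]; ring
  have hU2 : 0 < U ^ 2 := by positivity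
  rw [e1, e2, mul_nonneg_iff_of_pos_left hU2]
  constructor
  · rintro ⟨_, h⟩
    have : 0 ≤ 4 * A * (A * w ^ 2 - w * S - T) := by nlinarith
    exact (mul_nonneg_iff_of_pos_left (by positivity)).1 this
  · intro h
    have hws : 0 ≤ w * (A * w - S) := by nlinarith
    have := (mul_nonneg_iff_of_pos_left hw0).1 hws
    have hAw : 0 < A * w := by positivity
    refine ⟨by nlinarith, ?_⟩
    have := mul_nonneg hA.le h
    nlinarith

/-- a scaled square root below `k`. -/
lemma aux_sq (e d k X : ℝ) (he : 0 < e) (hd : 0 < d)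
    (h : 1 / (Real.sqrt (e * d) * Real.pi) * Real.sqrt X ≤ k) :
    X ≤ e * (d * k ^ 2 * Real.pi ^ 2) := by
  have hpi := Real.pi_pos
  have hs : 0 < Real.sqrt (e * d) := Real.sqrt_pos.2 (by positivity)
  rw [div_mul_eq_mul_div, one_mul, div_le_iff₀ (by positivity)] at h
  have h2 := (Real.sqrt_le_iff.1 h).2
  have h3 : Real.sqrt (e * d) ^ 2 = e * d := Real.sq_sqrt (by positivity)
  calc X ≤ _ := h2
    _ = Real.sqrt (e * d) ^ 2 * k ^ 2 * Real.pi ^ 2 := by ring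
    _ = _ := by rw [h3]; ring

lemma aux_max (A U e x y : ℝ) (hU : 0 < U) (hx : 0 < x) (hy : 0 < y)
    (h : (A * x - U) / (x * (x + U)) ≤ e)
    (hc : (0 ≤ (A * x - U) * y - U * x - U ^ 2 ∧ x ≤ y) ∨
      ((A * x - U) * y - U * x - U ^ 2 ≤ 0 ∧ y ≤ x)) :
    A * y - U ≤ e * (y * (y + U)) := by
  have key : (A * y - U) / (y * (y + U)) ≤ (A * x - U) / (x * (x + U)) := by
    rw [div_le_div_iff₀ (by positivity) (by positivity)]
    have : 0 ≤ ((A * x - U) * y - U * x - U ^ 2) * (y - x) := by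
      rcases hc with ⟨h1, h2⟩ | ⟨h1, h2⟩
      · exact mul_nonneg h1 (by linarith)
      · exact mul_nonneg_of_nonpos_of_nonpos h1 (by linarith)
    nlinarith
  exact (div_le_iff₀ (by positivity)).1 (key.trans h)

/-- Under (N0), `d > 0`, `ε ≥ ε_*(d)`, and either (a) `(u² − 2uv)²(ε²+1) < 1` or
(b) `(u² − 2uv)²(ε²+1) ≥ 1` and `K⁰(ε) ≥ K⁺`: for every integer `k ≥ K⁰(ε)` the
quartic `ω⁴ + (p_k² − s² − 2r_k)ω² + r_k² − q_k² = 0` has no positive root. -/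
theorem no_positive_quartic_root_above_K0
    (a b d ε : ℝ) (ha : 0 < a) (hb : 0 < b) (hd : 0 < d) (hεpos : 0 < ε)
    (u v : ℝ) (hu : u = a + b) (hv : v = b / (a + b) ^ 2)
    (hN0 : u ^ 2 > 2 * u * v - 1 ∧ 2 * u * v - 1 > 0)
    (εs : ℕ → ℝ → ℝ)
    (hεs : ∀ (k : ℕ) (d' : ℝ), εs k d' =
      ((2 * u * v - 1) * d' * (k : ℝ) ^ 2 * Real.pi ^ 2 - u ^ 2) /
        (d' * (k : ℝ) ^ 2 * Real.pi ^ 2 * (d' * (k : ℝ) ^ 2 * Real.pi ^ 2 + u ^ 2)))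
    (dkk : ℕ → ℝ)
    (hdkk : ∀ k : ℕ, dkk k =
      u ^ 2 / (2 * Real.pi ^ 2 * (2 * u * v - 1)) *
        (1 / (k : ℝ) ^ 2 + 1 / ((k : ℝ) + 1) ^ 2 +
          Real.sqrt ((1 / (k : ℝ) ^ 2 + 1 / ((k : ℝ) + 1) ^ 2) ^ 2 +
            4 * (2 * u * v - 1) / ((k : ℝ) ^ 2 * ((k : ℝ) + 1) ^ 2))))
    (εP : ℝ → ℝ)
    (hεP1 : ∀ x : ℝ, dkk 1 ≤ x → εP x = εs 1 x)
    (hεPk : ∀ k : ℕ, 2 ≤ k → ∀ x : ℝ, dkk k ≤ x → x < dkk (k - 1) → εP x = εs k x)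
    (hε : εP d ≤ ε)
    (p r q : ℕ → ℝ) (s : ℝ)
    (hp : ∀ k : ℕ, p k = (ε + 1) * d * (k : ℝ) ^ 2 * Real.pi ^ 2 + 1)
    (hr : ∀ k : ℕ, r k = ε * d ^ 2 * (k : ℝ) ^ 4 * Real.pi ^ 4 + d * (k : ℝ) ^ 2 * Real.pi ^ 2)
    (hs : s = u ^ 2 - 2 * u * v)
    (hq : ∀ k : ℕ, q k = (ε * u ^ 2 - 2 * u * v) * d * (k : ℝ) ^ 2 * Real.pi ^ 2 + u ^ 2)
    (K0 Kp : ℝ)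
    (hK0 : K0 = 1 / (Real.sqrt (2 * ε * d) * Real.pi) *
      Real.sqrt ((ε * u ^ 2 - 2 * u * v - 1) +
        Real.sqrt ((ε * u ^ 2 - 2 * u * v - 1) ^ 2 + 4 * ε * u ^ 2)))
    (hKp : Kp = 1 / (Real.pi * Real.sqrt ((ε ^ 2 + 1) * d)) *
      Real.sqrt (-ε + Real.sqrt ((u ^ 2 - 2 * u * v) ^ 2 * (ε ^ 2 + 1) - 1)))
    (hcase : (u ^ 2 - 2 * u * v) ^ 2 * (ε ^ 2 + 1) < 1 ∨
      ((u ^ 2 - 2 * u * v) ^ 2 * (ε ^ 2 + 1) ≥ 1 ∧ K0 ≥ Kp)) :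
    ∀ k : ℕ, K0 ≤ (k : ℝ) →
      ∀ ω : ℝ, 0 < ω →
        ω ^ 4 + (p k ^ 2 - s ^ 2 - 2 * r k) * ω ^ 2 + r k ^ 2 - q k ^ 2 ≠ 0 := by
  have hpi := Real.pi_pos
  have hupos : 0 < u := by rw [hu]; positivity
  obtain ⟨U, hU⟩ : ∃ U, U = u ^ 2 := ⟨_, rfl⟩
  have hUpos : 0 < U := by rw [hU]; positivity
  obtain ⟨A, hA⟩ : ∃ A, A = 2 * u * v - 1 := ⟨_, rfl⟩
  have hApos : 0 < A := by rw [hA]; exact hN0.2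
  obtain ⟨c, hc⟩ : ∃ c, c = d * Real.pi ^ 2 := ⟨_, rfl⟩
  have hcpos : 0 < c := by rw [hc]; positivity
  have hG : ∀ k : ℕ, 1 ≤ k → (dkk k ≤ d ↔
      0 ≤ (A * (c * (k : ℝ) ^ 2) - U) * (c * ((k : ℝ) + 1) ^ 2) - U * (c * (k : ℝ) ^ 2) - U ^ 2) := by
    intro k hk
    have hk0 : (0 : ℝ) < k := by exact_mod_cast hk
    have h1 := aux_char A U c (1 / (k : ℝ) ^ 2 + 1 / ((k : ℝ) + 1) ^ 2)
      (1 / ((k : ℝ) ^ 2 * ((k : ℝ) + 1) ^ 2)) hApos hUpos hcpos (by positivity) (by positivity)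
    have h2 : dkk k ≤ d ↔ U / (2 * A) * ((1 / (k : ℝ) ^ 2 + 1 / ((k : ℝ) + 1) ^ 2) +
        Real.sqrt ((1 / (k : ℝ) ^ 2 + 1 / ((k : ℝ) + 1) ^ 2) ^ 2 +
          4 * A * (1 / ((k : ℝ) ^ 2 * ((k : ℝ) + 1) ^ 2)))) ≤ c := by
      rw [hdkk k, ← hA, ← hU, hc, mul_one_div (4 * A), ← div_le_iff₀ (by positivity)]
      have : ∀ Z : ℝ, U / (2 * Real.pi ^ 2 * A) * Z = U / (2 * A) * Z / Real.pi ^ 2 := by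
        intro Z; field_simp
      rw [this]
    rw [h2, h1]
    have h3 : (A * (c * (k : ℝ) ^ 2) - U) * (c * ((k : ℝ) + 1) ^ 2) - U * (c * (k : ℝ) ^ 2) - U ^ 2
        = ((k : ℝ) ^ 2 * ((k : ℝ) + 1) ^ 2) *
        (A * c ^ 2 - U * c * (1 / (k : ℝ) ^ 2 + 1 / ((k : ℝ) + 1) ^ 2) -
          U ^ 2 * (1 / ((k : ℝ) ^ 2 * ((k : ℝ) + 1) ^ 2))) := by
      field_simp
      ring
    rw [h3, mul_nonneg_iff_of_pos_left (by positivity)]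
  have hex : ∃ n : ℕ, 1 ≤ n ∧ dkk n ≤ d := by
    obtain ⟨n, hn⟩ := exists_nat_ge (max 1 (max (U / c) (3 * U / (A * c))))
    have n1 : (1 : ℝ) ≤ n := (le_max_left _ _).trans hn
    have n2 : U / c ≤ n := ((le_max_left _ _).trans (le_max_right _ _)).trans hn
    have n3 : 3 * U / (A * c) ≤ n := ((le_max_right _ _).trans (le_max_right _ _)).trans hn
    rw [div_le_iff₀ (by positivity)] at n2 n3
    have hn1 : 1 ≤ n := by exact_mod_cast n1
    refine ⟨n, hn1, (hG n hn1).2 ?_⟩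
    have nn : (n : ℝ) ≤ (n : ℝ) ^ 2 := by nlinarith
    obtain ⟨x, hx⟩ : ∃ x, x = c * (n : ℝ) ^ 2 := ⟨_, rfl⟩
    obtain ⟨y, hy⟩ : ∃ y, y = c * ((n : ℝ) + 1) ^ 2 := ⟨_, rfl⟩
    have hxy : x ≤ y := by
      rw [hx, hy]; apply mul_le_mul_of_nonneg_left _ hcpos.le; nlinarith
    have hxU : U ≤ x := by
      have := mul_le_mul_of_nonneg_left nn hcpos.le
      rw [hx]; linarith
    have hAx : 3 * U ≤ A * x := by
      have := mul_le_mul_of_nonneg_left nn (mul_pos hApos hcpos).le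
      rw [hx]; linarith
    rw [← hx, ← hy]
    have h1 : 2 * U * y ≤ (A * x - U) * y :=
      mul_le_mul_of_nonneg_right (by linarith) (by linarith)
    nlinarith
  classical
  obtain ⟨n, hn1, hnd, hmin⟩ : ∃ n : ℕ, 1 ≤ n ∧ dkk n ≤ d ∧
      ∀ m, m < n → ¬ (1 ≤ m ∧ dkk m ≤ d) :=
    ⟨Nat.find hex, (Nat.find_spec hex).1, (Nat.find_spec hex).2, fun m hm => Nat.find_min hex hm⟩
  have hn0 : (0 : ℝ) < n := by exact_mod_cast hn1
  have hεn : εs n d ≤ ε := by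
    rcases Nat.lt_or_ge n 2 with h | h
    · have : n = 1 := by omega
      subst this
      rw [← hεP1 d hnd]; exact hε
    · have h3 : d < dkk (n - 1) := by
        by_contra h4
        exact hmin (n - 1) (by omega) ⟨by omega, not_lt.1 h4⟩
      rw [← hεPk n h d hnd h3]; exact hε
  have hεn' : (A * (c * (n : ℝ) ^ 2) - U) / ((c * (n : ℝ) ^ 2) * (c * (n : ℝ) ^ 2 + U)) ≤ ε := by
    rw [hεs] at hεn
    rw [hA, hU, hc]
    convert hεn using 1
    ring
  have hmax : ∀ m : ℕ, A * (c * (m : ℝ) ^ 2) - U ≤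
      ε * ((c * (m : ℝ) ^ 2) * (c * (m : ℝ) ^ 2 + U)) := by
    intro m
    rcases Nat.eq_zero_or_pos m with h0 | hm
    · subst h0; simp; exact hUpos.le
    have hm0 : (0 : ℝ) < m := by exact_mod_cast hm
    have hGn := (hG n hn1).1 hnd
    by_cases hmn : m = n
    · rw [hmn]
      exact (div_le_iff₀ (by positivity)).1 hεn'
    refine aux_max A U ε (c * (n : ℝ) ^ 2) (c * (m : ℝ) ^ 2) hUpos (by positivity) (by positivity)
      hεn' ?_
    have hxp : 0 < c * (n : ℝ) ^ 2 := by positivity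
    have hyp : 0 < c * ((n : ℝ) + 1) ^ 2 := by positivity
    have hcoef : 0 < A * (c * (n : ℝ) ^ 2) - U := by
      have : 0 < (A * (c * (n : ℝ) ^ 2) - U) * (c * ((n : ℝ) + 1) ^ 2) := by
        have := mul_pos hUpos hxp
        have := pow_pos hUpos 2
        linarith
      exact (pos_iff_pos_of_mul_pos this).2 hyp
    rcases lt_trichotomy m n with h | h | h
    · right
      have hn2 : 2 ≤ n := by omega
      obtain ⟨j, rfl⟩ : ∃ j, n = j + 1 := ⟨n - 1, by omega⟩
      have hj : 1 ≤ j := by omega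
      have hGj : ¬ dkk j ≤ d := fun h4 => hmin j (by omega) ⟨hj, h4⟩
      rw [hG j hj, not_le] at hGj
      push_cast at *
      have hmj : (m : ℝ) ≤ j := by exact_mod_cast Nat.lt_succ_iff.1 h
      have h5 : c * (m : ℝ) ^ 2 ≤ c * (j : ℝ) ^ 2 := by gcongr
      have h6 : c * (j : ℝ) ^ 2 ≤ c * ((j : ℝ) + 1) ^ 2 := by gcongr; linarith
      refine ⟨?_, h5.trans h6⟩
      have := mul_le_mul_of_nonneg_left h5 hcoef.le
      linarith
    · exact absurd h hmn
    · left
      have hmj : (n : ℝ) + 1 ≤ m := by exact_mod_cast h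
      have h5 : c * ((n : ℝ) + 1) ^ 2 ≤ c * (m : ℝ) ^ 2 := by gcongr
      have h6 : c * (n : ℝ) ^ 2 ≤ c * ((n : ℝ) + 1) ^ 2 := by gcongr; linarith
      refine ⟨?_, h6.trans h5⟩
      have := mul_le_mul_of_nonneg_left h5 hcoef.le
      linarith
  intro k hk ω hω
  obtain ⟨x, hx⟩ : ∃ x, x = c * (k : ℝ) ^ 2 := ⟨_, rfl⟩
  have hx0 : 0 ≤ x := by rw [hx]; positivity
  have hxd : d * (k : ℝ) ^ 2 * Real.pi ^ 2 = x := by rw [hx, hc]; ring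
  have hp' : p k = (ε + 1) * x + 1 := by rw [hp, ← hxd]; ring
  have hr' : r k = ε * x ^ 2 + x := by rw [hr, ← hxd]; ring
  have hq' : q k = (ε * U - 2 * u * v) * x + U := by rw [hq, ← hxd, hU]; ring
  have hplus : 0 ≤ r k + q k := by
    have := hmax k
    rw [← hx, hA] at this
    rw [hr', hq']; nlinarith
  have hminus : 0 ≤ r k - q k := by
    rw [hK0] at hk
    have h1 := aux_sq (2 * ε) d k _ (by positivity) hd hk
    rw [hxd, ← hU] at h1
    obtain ⟨B, hB⟩ : ∃ B, B = ε * U - 2 * u * v - 1 := ⟨_, rfl⟩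
    rw [← hB] at h1
    have h2 : Real.sqrt (B ^ 2 + 4 * ε * U) ≤ 2 * ε * x - B := by linarith
    have h3 := (Real.sqrt_le_iff.1 h2).2
    have h4 : 0 ≤ 4 * ε * (ε * x ^ 2 - B * x - U) := by nlinarith
    have h5 := (mul_nonneg_iff_of_pos_left (by positivity)).1 h4
    have h6 : r k - q k = ε * x ^ 2 - B * x - U := by rw [hr', hq', hB]; ring
    rw [h6]; exact h5
  have hmid : 0 ≤ p k ^ 2 - s ^ 2 - 2 * r k := by
    have h0 : p k ^ 2 - s ^ 2 - 2 * r k = (ε ^ 2 + 1) * x ^ 2 + 2 * ε * x + 1 - s ^ 2 := by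
      rw [hp', hr']; ring
    rw [h0]
    have hE : 0 < ε ^ 2 + 1 := by positivity
    refine (mul_nonneg_iff_of_pos_left hE).1 ?_
    have h7 : (ε ^ 2 + 1) * ((ε ^ 2 + 1) * x ^ 2 + 2 * ε * x + 1 - s ^ 2) =
      ((ε ^ 2 + 1) * x + ε) ^ 2 - (s ^ 2 * (ε ^ 2 + 1) - 1) := by ring
    rw [h7]
    rw [← hs] at hcase hKp
    rcases hcase with h | ⟨_, h⟩
    · nlinarith [sq_nonneg ((ε ^ 2 + 1) * x + ε)]
    · have h8 : Kp ≤ k := le_trans h hk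
      rw [hKp, mul_comm Real.pi] at h8
      have h9 := aux_sq (ε ^ 2 + 1) d k _ hE hd h8
      rw [hxd] at h9
      have h10 : Real.sqrt (s ^ 2 * (ε ^ 2 + 1) - 1) ≤ (ε ^ 2 + 1) * x + ε := by linarith
      have := (Real.sqrt_le_iff.1 h10).2
      linarith
  have e1 : 0 < ω ^ 4 := by positivity
  have e2 : 0 ≤ (p k ^ 2 - s ^ 2 - 2 * r k) * ω ^ 2 := by positivity
  have e3 := mul_nonneg hplus hminus
  apply ne_of_gt
  nlinarith
end

section
/- Assume (N0), d > 0, ε ≥ ε_*(d), (u*² − 2u*v*)²(ε² + 1) ≥ 1 and K⁰(ε) < K⁺. Then there exists a real number K_* ∈ (K⁰(ε), K⁺) such that, for integers k ≥ 0, the quartic equation ω⁴ + (p_k² − s² − 2r_k)ω² + r_k² − q_k² = 0 has exactly two distinct positive roots ω_k^± when K⁰(ε) < k < K_*, exactly one positive root when k = K⁰(ε) or k = K_* (the single root being ω_{K⁰}^+ and ω_{K_*}^+ = ω_{K_*}^− respectively), and no positive root when k > K_*, where ω_k^± = (√2/2)·( s² − p_k² + 2r_k ± √( (s² − p_k² +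 2r_k)² − 4(r_k² − q_k²) ) )^{1/2}. -/
set_option maxHeartbeats 2000000


/-- threshold equivalence -/
lemma aux_dkk (U c d X Y P : ℝ) (hU : 0 < U) (hc : 0 < c) (hd : 0 < d) (hX : 0 < X) (hY : 0 < Y)
    (hP : 0 < P) :
    U / (2 * P * c) * (1 / X + 1 / Y + Real.sqrt ((1 / X + 1 / Y) ^ 2 + 4 * c / (X * Y))) ≤ d ↔
      U * (d * X * P + d * Y * P + U) ≤ c * (d * X * P) * (d * Y * P) := by
  have e1 : U / (2 * P * c) * (1 / X + 1 / Y + Real.sqrt ((1 / X + 1 / Y) ^ 2 + 4 * c / (X * Y))) ≤ d ↔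
      Real.sqrt ((1 / X + 1 / Y) ^ 2 + 4 * c / (X * Y)) ≤ 2 * P * c * d / U - (1 / X + 1 / Y) := by
    rw [le_sub_iff_add_le, le_div_iff₀ hU, div_mul_eq_mul_div, div_le_iff₀ (by positivity)]
    constructor <;> intro h <;> nlinarith
  have e2 : (2 * P * c * d / U - (1 / X + 1 / Y)) ^ 2 - ((1 / X + 1 / Y) ^ 2 + 4 * c / (X * Y)) =
      4 * c / (U ^ 2 * X * Y) *
        (c * (d * X * P) * (d * Y * P) - U * (d * X * P + d * Y * P + U)) := by
    field_simp
    ring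
  have hpos : 0 < 4 * c / (U ^ 2 * X * Y) := by positivity
  rw [e1, Real.sqrt_le_iff]
  constructor
  · rintro ⟨_, h⟩
    have : 0 ≤ 4 * c / (U ^ 2 * X * Y) *
        (c * (d * X * P) * (d * Y * P) - U * (d * X * P + d * Y * P + U)) := by
      rw [← e2]; linarith
    have := nonneg_of_mul_nonneg_right this hpos
    linarith
  · intro h
    refine ⟨?_, ?_⟩
    · have e3 : 2 * P * c * d / U - (1 / X + 1 / Y) =
        (2 * (P * c * d * X * Y) - U * (X + Y)) / (U * X * Y) := by
        field_simp
        ring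
      rw [e3]
      apply div_nonneg _ (by positivity)
      have h1 : 0 ≤ d * P * (P * c * d * X * Y - U * (X + Y)) := by nlinarith [sq_nonneg U]
      have h2 := nonneg_of_mul_nonneg_right h1 (by positivity)
      have : 0 < U * (X + Y) := by positivity
      linarith
    · have : 0 ≤ 4 * c / (U ^ 2 * X * Y) *
        (c * (d * X * P) * (d * Y * P) - U * (d * X * P + d * Y * P + U)) :=
        mul_nonneg hpos.le (by linarith)
      rw [← e2] at this
      linarith

lemma aux_cmp_s18 (U c ε x y : ℝ) (hU : 0 < U) (hx : 0 < x) (hy : 0 < y)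
    (hε : (c * y - U) / (y * (y + U)) ≤ ε)
    (h : (c * x - U) * (y * (y + U)) ≤ (c * y - U) * (x * (x + U))) :
    c * x - U ≤ ε * (x * (x + U)) := by
  have hxx : 0 < x * (x + U) := by positivity
  have hyy : 0 < y * (y + U) := by positivity
  have : (c * x - U) / (x * (x + U)) ≤ (c * y - U) / (y * (y + U)) := by
    rw [div_le_div_iff₀ hxx hyy]; exact h
  rw [← div_le_iff₀ hxx]
  linarith

/-- abstract Turing condition: `t = d π²` -/
lemma aux_turing (U c t ε : ℝ) (hU : 0 < U) (hc : 0 < c) (ht : 0 < t) (E : ℕ → Prop)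
    (hE : ∀ k : ℕ, 1 ≤ k → (E k ↔ U * (t * (k:ℝ)^2 + t * ((k:ℝ)+1)^2 + U) ≤
      c * (t * (k:ℝ)^2) * (t * ((k:ℝ)+1)^2)))
    (h1 : E 1 → (c * (t * ((1:ℕ):ℝ)^2) - U) / (t * ((1:ℕ):ℝ)^2 * (t * ((1:ℕ):ℝ)^2 + U)) ≤ ε)
    (h2 : ∀ k : ℕ, 2 ≤ k → E k → ¬ E (k-1) →
      (c * (t * (k:ℝ)^2) - U) / (t * (k:ℝ)^2 * (t * (k:ℝ)^2 + U)) ≤ ε)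
    (k : ℕ) (hk : 1 ≤ k) :
    c * (t * (k:ℝ)^2) - U ≤ ε * (t * (k:ℝ)^2 * (t * (k:ℝ)^2 + U)) := by
  classical
  have hex : ∃ j : ℕ, 1 ≤ j ∧ E j := by
    obtain ⟨n, hn⟩ := exists_nat_gt (max 1 (U * (2 * t + U) / (c * t ^ 2) + U / (c * t)))
    have hn1 : (1:ℝ) < n := lt_of_le_of_lt (le_max_left _ _) hn
    have hn2 := lt_of_le_of_lt (le_max_right _ _) hn
    have hn1' : 1 ≤ n := by exact_mod_cast hn1.le
    refine ⟨n, hn1', (hE n hn1').2 ?_⟩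
    have h3 : U * (2 * t + U) + U * t < c * t ^ 2 * n := by
      have : U * (2 * t + U) / (c * t ^ 2) + U / (c * t) =
        (U * (2 * t + U) + U * t) / (c * t ^ 2) := by field_simp
      rw [this, div_lt_iff₀ (by positivity)] at hn2
      linarith
    clear hn2 hn hn1'
    generalize (n:ℝ) = m at *
    have hm2 : (m:ℝ) ≤ m^2 := by nlinarith
    have hA : (1:ℝ) ≤ (m+1)^2 := by nlinarith
    have hB : m^2 ≤ (m+1)^2 := by nlinarith
    calc U * (t * m ^ 2 + t * (m + 1) ^ 2 + U) 
        ≤ (U * (2 * t + U)) * (m+1)^2 := by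
          have e1 : U * t * m^2 ≤ U * t * (m+1)^2 := by gcongr
          have e2 : U^2 * 1 ≤ U^2 * (m+1)^2 := by gcongr
          nlinarith
      _ ≤ (c * t^2 * m) * (m+1)^2 := by
          apply mul_le_mul_of_nonneg_right _ (by positivity)
          have : 0 < U * t := by positivity
          linarith
      _ ≤ (c * t^2 * m^2) * (m+1)^2 := by gcongr
      _ = _ := by ring
  obtain ⟨hj1, hEj⟩ := Nat.find_spec hex
  have hmin := fun i (hi : i < Nat.find hex) => Nat.find_min hex hi
  set j := Nat.find hex with hjdef
  have hjR : (1:ℝ) ≤ j := by exact_mod_cast hj1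
  have hkR : (1:ℝ) ≤ k := by exact_mod_cast hk
  have hx : 0 < t * (k:ℝ)^2 := by positivity
  have hy : 0 < t * (j:ℝ)^2 := by positivity
  have hεj : (c * (t * (j:ℝ)^2) - U) / (t * (j:ℝ)^2 * (t * (j:ℝ)^2 + U)) ≤ ε := by
    rcases Nat.lt_or_ge j 2 with h | h
    · have : j = 1 := by omega
      rw [this] at hEj ⊢
      exact h1 hEj
    · refine h2 j h hEj ?_
      intro hE'
      exact hmin (j-1) (by omega) ⟨by omega, hE'⟩
  refine aux_cmp_s18 U c ε _ _ hU hx hy hεj ?_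
  have hEj' := (hE j hj1).1 hEj
  rcases lt_trichotomy k j with h | h | h
  · have hne : ¬ E (j-1) := fun hE' => hmin (j-1) (by omega) ⟨by omega, hE'⟩
    rw [hE (j-1) (by omega)] at hne
    have hcast : ((j-1:ℕ):ℝ) = (j:ℝ) - 1 := by push_cast [Nat.cast_sub hj1]; ring
    rw [hcast, sub_add_cancel] at hne
    push Not at hne
    have hkj : (k:ℝ) ≤ (j:ℝ) - 1 := by
      have : (k:ℝ) + 1 ≤ j := by exact_mod_cast h
      linarith
    have hxz : t * (k:ℝ)^2 ≤ t * ((j:ℝ)-1)^2 := by gcongr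
    have hxy : t * (k:ℝ)^2 ≤ t * (j:ℝ)^2 := by
      have : (k:ℝ) ≤ j := by linarith
      gcongr
    generalize t * (k:ℝ)^2 = x at *
    generalize t * ((j:ℝ)-1)^2 = z at *
    generalize t * (j:ℝ)^2 = y at *
    have key : c * x * y ≤ U * (x + y + U) := by
      rcases le_or_gt (c * y - U) 0 with h0 | h0
      · nlinarith [mul_nonneg hx.le (sub_nonneg.2 h0), mul_pos hU hy, mul_pos hU hU]
      · nlinarith [mul_nonneg h0.le (sub_nonneg.2 hxz)]
    nlinarith [mul_nonneg (sub_nonneg.2 hxy) (sub_nonneg.2 key)]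
  · rw [h]
  · have hkj : (j:ℝ) + 1 ≤ k := by exact_mod_cast h
    have hxz : t * ((j:ℝ)+1)^2 ≤ t * (k:ℝ)^2 := by gcongr
    have hxy : t * (j:ℝ)^2 ≤ t * (k:ℝ)^2 := by
      have : (j:ℝ) ≤ k := by linarith
      gcongr
    have hz : 0 < t * ((j:ℝ)+1)^2 := by positivity
    generalize t * (k:ℝ)^2 = x at *
    generalize t * ((j:ℝ)+1)^2 = z at *
    generalize t * (j:ℝ)^2 = y at *
    have h0 : 0 < c * y - U := by
      have : 0 < (c * y - U) * z := by nlinarith [mul_pos hU hy, mul_pos hU hU]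
      exact pos_of_mul_pos_left this hz.le
    have key : U * (x + y + U) ≤ c * x * y := by
      nlinarith [mul_nonneg h0.le (sub_nonneg.2 hxz)]
    nlinarith [mul_nonneg (sub_nonneg.2 hxy) (sub_nonneg.2 key)]

/-- r + q > 0 as long as A ≥ 0 -/
lemma aux_rq (U w ε x : ℝ) (hw1 : 1 < w) (hw2 : w < 2) (hU : 0 < U)
    (hs : 1 < U - w) (hε : 0 < ε) (hx : 0 ≤ x)
    (hA : 0 ≤ (U - w) ^ 2 - x ^ 2 - (ε * x + 1) ^ 2) :
    x < U - w ∧ 0 < x * (ε * x + 1) + (U * (ε * x + 1) - w * x) := by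
  have hy : 1 ≤ ε * x + 1 := by nlinarith [mul_nonneg hε.le hx]
  have hxs : x < U - w := by nlinarith
  refine ⟨hxs, ?_⟩
  have : 0 ≤ (ε * x) * (x + U) := by positivity
  nlinarith

lemma aux_core (U x A : ℝ) (hx : 0 < x) (hxU : x < U) (hx2 : U < 2 * x) (hA0 : 0 < A)
    (hSU' : A + x ^ 2 < U ^ 2) :
    A * ((2 * x - U) * U) < (A + 2 * x ^ 2) * ((U - x) * (3 * x - U)) := by
  obtain ⟨S, hS⟩ : ∃ S, S = A + x ^ 2 := ⟨_, rfl⟩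
  have hSU : S < U ^ 2 := by linarith
  have hSx : 0 < S := by rw [hS]; positivity
  have hAS : A = S - x ^ 2 := by linarith
  have hU : 0 < U := hx.trans hxU
  have hfin : 0 < S * (2 * U - 3 * x) + x * (6 * U * x - 3 * x ^ 2 - 2 * U ^ 2) := by
    rcases le_or_gt (3 * x) (2 * U) with h | h
    · have : 0 < 6 * U * x - 3 * x ^ 2 - 2 * U ^ 2 := by
        nlinarith [mul_pos (sub_pos.2 hx2) (sub_pos.2 hxU), mul_pos hU (sub_pos.2 hx2)]
      have h1 : 0 < x * (6 * U * x - 3 * x ^ 2 - 2 * U ^ 2) := mul_pos hx this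
      have h2 : 0 ≤ S * (2 * U - 3 * x) := mul_nonneg hSx.le (by linarith)
      linarith
    · have h1 : 0 ≤ (U ^ 2 - S) * (3 * x - 2 * U) :=
        mul_nonneg (by linarith) (by linarith)
      have h2 : 0 < (U - x) * (2 * U ^ 2 - 3 * U * x + 3 * x ^ 2) := by
        apply mul_pos (by linarith)
        nlinarith [sq_nonneg (U - x), sq_nonneg x]
      linarith
  have h3 := mul_pos hx hfin
  rw [hAS]
  linarith

/-- key derivative inequality -/
lemma aux_key (U w ε x : ℝ) (hw1 : 1 < w) (hw2 : w < 2) (hU : 0 < U)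
    (hs : 1 < U - w) (hε : 0 < ε) (hx : 0 < x)
    (hA : 0 < (U - w) ^ 2 - x ^ 2 - (ε * x + 1) ^ 2)
    (hrq : 0 < x * (ε * x + 1) - (U * (ε * x + 1) - w * x)) :
    0 < ((U - w) ^ 2 - x ^ 2 - (ε * x + 1) ^ 2) *
        (x * (ε * x + 1) * (2 * ε * x + 1) - (U * (ε * x + 1) - w * x) * (ε * U - w)) +
      2 * (x + ε * (ε * x + 1)) *
        ((x * (ε * x + 1)) ^ 2 - (U * (ε * x + 1) - w * x) ^ 2) := by
  obtain ⟨hxs, hrq2⟩ := aux_rq U w ε x hw1 hw2 hU hs hε hx.le hA.le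
  have hεx : 0 < ε * x := by positivity
  have hC : 0 < (x * (ε * x + 1)) ^ 2 - (U * (ε * x + 1) - w * x) ^ 2 := by
    nlinarith [mul_pos hrq hrq2]
  have hsecond : 0 < 2 * (x + ε * (ε * x + 1)) *
        ((x * (ε * x + 1)) ^ 2 - (U * (ε * x + 1) - w * x) ^ 2) := by positivity
  have hrr : 0 < x * (ε * x + 1) * (2 * ε * x + 1) := by positivity
  rcases le_or_gt w (ε * U) with hm | hm
  · have hq : 0 < U * (ε * x + 1) - w * x := by nlinarith
    have hd : ε * U - w < 2 * ε * x + 1 := by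
      have : 0 < x * (2 * ε * x + 1 - (ε * U - w)) := by nlinarith
      have := pos_of_mul_pos_right this hx.le
      linarith
    have : (U * (ε * x + 1) - w * x) * (ε * U - w) ≤ x * (ε * x + 1) * (2 * ε * x + 1) := by
      apply mul_le_mul <;> linarith [mul_pos hx hx]
    have := mul_nonneg hA.le (sub_nonneg.2 this)
    linarith
  rcases le_or_gt 0 (U * (ε * x + 1) - w * x) with hq | hq
  · have h1 : (U * (ε * x + 1) - w * x) * (ε * U - w) ≤ 0 := by
      apply mul_nonpos_of_nonneg_of_nonpos hq; linarith
    have := mul_nonneg hA.le (sub_nonneg.2 (h1.trans hrr.le))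
    linarith
  -- main case
  obtain ⟨y, hy⟩ : ∃ y, y = ε * x + 1 := ⟨_, rfl⟩
  obtain ⟨Q, hQ⟩ : ∃ Q, Q = w * x - U * y := ⟨_, rfl⟩
  obtain ⟨A, hAe⟩ : ∃ A, A = (U - w) ^ 2 - x ^ 2 - y ^ 2 := ⟨_, rfl⟩
  have hy1 : 1 < y := by linarith
  have hQ0 : 0 < Q := by rw [hQ, hy]; linarith
  have hA0 : 0 < A := by rw [hAe, hy]; exact hA
  have hC' : 0 < x ^ 2 * y ^ 2 - Q ^ 2 := by rw [hQ, hy]; nlinarith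
  have hxU : x < U := by linarith
  have hQle : Q ≤ 2 * x - U := by rw [hQ]; nlinarith
  have hClow : (U - x) * (3 * x - U) ≤ x ^ 2 * y ^ 2 - Q ^ 2 := by
    have h1 : x ^ 2 * 1 ≤ x ^ 2 * y ^ 2 := by
      apply mul_le_mul_of_nonneg_left _ (by positivity); nlinarith
    have h2 : Q ^ 2 ≤ (2 * x - U) ^ 2 := by gcongr
    linarith
  have hx2 : U < 2 * x := by linarith
  have hcore : A * ((2 * x - U) * U) < (A + 2 * x ^ 2) * ((U - x) * (3 * x - U)) := by
    refine aux_core U x A hx hxU hx2 hA0 ?_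
    have h1 : (U - w) ^ 2 < U ^ 2 := by
      apply pow_lt_pow_left₀ <;> linarith
    have h2 : 0 < y ^ 2 := by positivity
    linarith
  have hxG : 0 < x * (A * (x * y * (y + ε * x) - Q * (w - ε * U)) +
      2 * (x + ε * y) * (x ^ 2 * y ^ 2 - Q ^ 2)) := by
    have hQx : x * (w - ε * U) = Q + U := by rw [hQ, hy]; ring
    have e : x * (A * (x * y * (y + ε * x) - Q * (w - ε * U)) +
      2 * (x + ε * y) * (x ^ 2 * y ^ 2 - Q ^ 2)) =
      (A + 2 * x ^ 2) * (x ^ 2 * y ^ 2 - Q ^ 2) - A * (Q * U)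
       + A * (ε * x ^ 3 * y) + 2 * ε * x * y * (x ^ 2 * y ^ 2 - Q ^ 2) := by
      linear_combination (-A * Q) * hQx
    rw [e]
    have h1 : A * (Q * U) ≤ A * ((2 * x - U) * U) := by gcongr
    have h2 : (A + 2 * x ^ 2) * ((U - x) * (3 * x - U)) ≤
      (A + 2 * x ^ 2) * (x ^ 2 * y ^ 2 - Q ^ 2) := by gcongr
    have h3 : 0 < A * (ε * x ^ 3 * y) := by positivity
    have h4 : 0 < 2 * ε * x * y * (x ^ 2 * y ^ 2 - Q ^ 2) := by positivity
    linarith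
  have := pos_of_mul_pos_right hxG hx.le
  rw [hAe, hQ, hy] at this
  refine lt_of_lt_of_eq this ?_
  ring

/-- ratio C / A² strictly monotone -/
lemma aux_mono (U w ε x0 xp : ℝ) (hw1 : 1 < w) (hw2 : w < 2) (hU : 0 < U)
    (hs : 1 < U - w) (hε : 0 < ε) (hx0 : 0 < x0)
    (hA : ∀ x, 0 < x → x < xp → 0 < (U - w) ^ 2 - x ^ 2 - (ε * x + 1) ^ 2)
    (hrq : ∀ x, x0 < x → 0 < x * (ε * x + 1) - (U * (ε * x + 1) - w * x)) :
    StrictMonoOn (fun x => ((x * (ε * x + 1)) ^ 2 - (U * (ε * x + 1) - w * x) ^ 2) /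
      ((U - w) ^ 2 - x ^ 2 - (ε * x + 1) ^ 2) ^ 2) (Set.Ico x0 xp) := by
  have hne : ∀ x ∈ Set.Ico x0 xp, (((U - w) ^ 2 - x ^ 2 - (ε * x + 1) ^ 2) ^ 2) ≠ 0 := by
    intro x hx
    have := hA x (lt_of_lt_of_le hx0 hx.1) hx.2
    positivity
  apply strictMonoOn_of_deriv_pos (convex_Ico x0 xp)
  · apply ContinuousOn.div (by fun_prop) (by fun_prop) hne
  · intro x hx
    rw [interior_Ico] at hx
    have hxpos : 0 < x := hx0.trans hx.1
    have hAx := hA x hxpos hx.2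
    have key := aux_key U w ε x hw1 hw2 hU hs hε hxpos hAx (hrq x hx.1)
    have hid := hasDerivAt_id' x
    have hy : HasDerivAt (fun x => ε * x + 1) ε x := by
      simpa using (hid.const_mul ε).add_const 1
    have hC : HasDerivAt (fun x => (x * (ε * x + 1)) ^ 2 - (U * (ε * x + 1) - w * x) ^ 2) _ x :=
      ((hid.mul hy).pow 2).sub (((hy.const_mul U).sub (hid.const_mul w)).pow 2)
    have hAd : HasDerivAt (fun x => ((U - w) ^ 2 - x ^ 2 - (ε * x + 1) ^ 2) ^ 2) _ x :=
      ((((hid.pow 2).const_sub ((U - w)^2)).sub (hy.pow 2)).pow 2)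
    have hq := hC.div hAd (hne x ⟨hx.1.le, hx.2⟩)
    have hq' := hq.deriv
    have : deriv (fun x => ((x * (ε * x + 1)) ^ 2 - (U * (ε * x + 1) - w * x) ^ 2) /
      ((U - w) ^ 2 - x ^ 2 - (ε * x + 1) ^ 2) ^ 2) x = _ := hq'
    rw [this]
    apply div_pos _ (by positivity)
    have h2 := mul_pos hAx key
    simp only [Pi.mul_apply, Pi.sub_apply, Pi.pow_apply]
    push_cast
    convert (mul_pos two_pos h2) using 1
    ring

/-- roots of the biquadratic -/
lemma aux_roots (A C B wp wm : ℝ) (hB : B = A ^ 2 - 4 * C)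
    (hwp : wp = Real.sqrt 2 / 2 * Real.sqrt (A + Real.sqrt B))
    (hwm : wm = Real.sqrt 2 / 2 * Real.sqrt (A - Real.sqrt B))
    (hA : 0 < A) (hC : 0 ≤ C) (hD : 0 ≤ B) :
    0 < wp ∧ 0 ≤ wm ∧ wp ^ 2 = (A + Real.sqrt B) / 2 ∧ wm ^ 2 = (A - Real.sqrt B) / 2 ∧
    wp ^ 4 - A * wp ^ 2 + C = 0 ∧ wm ^ 4 - A * wm ^ 2 + C = 0 ∧
    ∀ ω : ℝ, 0 < ω → ω ^ 4 - A * ω ^ 2 + C = 0 → ω = wm ∨ ω = wp := by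
  have hsq : Real.sqrt B ^ 2 = B := Real.sq_sqrt hD
  have hs0 := Real.sqrt_nonneg B
  have hle : Real.sqrt B ≤ A := by
    rw [Real.sqrt_le_left hA.le]; linarith
  have h2 : Real.sqrt 2 ^ 2 = 2 := Real.sq_sqrt (by norm_num)
  have hp2 : wp ^ 2 = (A + Real.sqrt B) / 2 := by
    rw [hwp, mul_pow, div_pow, h2, Real.sq_sqrt (by linarith)]; ring
  have hm2 : wm ^ 2 = (A - Real.sqrt B) / 2 := by
    rw [hwm, mul_pow, div_pow, h2, Real.sq_sqrt (by linarith)]; ring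
  have hp0 : 0 < wp := by
    rw [hwp]
    have : 0 < Real.sqrt (A + Real.sqrt B) := Real.sqrt_pos.2 (by linarith)
    positivity
  have hm0 : 0 ≤ wm := by rw [hwm]; positivity
  refine ⟨hp0, hm0, hp2, hm2, ?_, ?_, ?_⟩
  · have : wp ^ 4 = (wp ^ 2) ^ 2 := by ring
    rw [this, hp2]; nlinarith
  · have : wm ^ 4 = (wm ^ 2) ^ 2 := by ring
    rw [this, hm2]; nlinarith
  · intro ω hω h
    have : (ω ^ 2 - wm ^ 2) * (ω ^ 2 - wp ^ 2) = 0 := by rw [hp2, hm2]; nlinarith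
    rcases mul_eq_zero.1 this with h | h
    · left
      exact (pow_left_inj₀ hω.le hm0 two_ne_zero).1 (by linarith)
    · right
      exact (pow_left_inj₀ hω.le hp0.le two_ne_zero).1 (by linarith)


lemma aux_core2 (U w ε x0 xp : ℝ) (hw1 : 1 < w) (hw2 : w < 2) (hU : 0 < U)
    (hs' : -1 < U - w) (hε : 0 < ε) (hx0 : 0 < x0) (hx0p : x0 < xp)
    (e0 : ε * x0 ^ 2 - (ε * U - w - 1) * x0 - U = 0)
    (ep : (ε ^ 2 + 1) * xp ^ 2 + 2 * ε * xp + 1 - (U - w) ^ 2 = 0)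
    (A C : ℝ → ℝ) (hAdef : ∀ x, A x = (U - w) ^ 2 - x ^ 2 - (ε * x + 1) ^ 2)
    (hCdef : ∀ x, C x = (x * (ε * x + 1)) ^ 2 - (U * (ε * x + 1) - w * x) ^ 2) :
    ∃ xs, x0 < xs ∧ xs < xp ∧
      (∀ x, x0 < x → x < xs → 0 < A x ∧ 0 < C x ∧ 0 < A x ^ 2 - 4 * C x) ∧
      (0 < A x0 ∧ C x0 = 0) ∧
      (0 < A xs ∧ 0 < C xs ∧ A xs ^ 2 - 4 * C xs = 0) ∧
      (∀ x, xs < x → x < xp → A x ^ 2 - 4 * C x < 0) ∧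
      (∀ x, xp ≤ x → A x ≤ 0 ∧ 0 < x * (ε * x + 1) - (U * (ε * x + 1) - w * x)) := by
  have hxp : 0 < xp := hx0.trans hx0p
  have hs : 1 < U - w := by
    have : 1 < (U - w) ^ 2 := by
      have : 0 < (ε ^ 2 + 1) * xp ^ 2 + 2 * ε * xp := by positivity
      linarith
    nlinarith
  have hAfac : ∀ x, A x = (xp - x) * ((ε ^ 2 + 1) * (xp + x) + 2 * ε) := by
    intro x; rw [hAdef]; linear_combination -ep
  have hApos : ∀ x, 0 < x → x < xp → 0 < A x := by
    intro x h1 h2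
    rw [hAfac]
    have : 0 < xp - x := by linarith
    positivity
  have hrqfac : ∀ x, x * (ε * x + 1) - (U * (ε * x + 1) - w * x) =
      (x - x0) * (ε * (x + x0) - (ε * U - w - 1)) := by
    intro x; linear_combination e0
  have hB : 0 < ε * x0 - (ε * U - w - 1) := by
    have : 0 < x0 * (ε * x0 - (ε * U - w - 1)) := by nlinarith
    exact pos_of_mul_pos_right this hx0.le
  have hrq : ∀ x, x0 < x → 0 < x * (ε * x + 1) - (U * (ε * x + 1) - w * x) := by
    intro x hx
    rw [hrqfac]
    apply mul_pos (by linarith)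
    nlinarith [mul_pos hε (hx0.trans hx)]
  have hCpos : ∀ x, x0 < x → x ≤ xp → 0 < C x := by
    intro x h1 h2
    have hA0 : 0 ≤ A x := by
      rw [hAfac]
      have : 0 ≤ xp - x := by linarith
      have : 0 < x := hx0.trans h1
      positivity
    rw [hAdef] at hA0
    have h3 := (aux_rq U w ε x hw1 hw2 hU hs hε (hx0.trans h1).le hA0).2
    have := mul_pos (hrq x h1) h3
    rw [hCdef]
    nlinarith
  have hC0 : C x0 = 0 := by
    have := hrqfac x0
    rw [sub_self, zero_mul] at this
    rw [hCdef]
    linear_combination (x0 * (ε * x0 + 1) + (U * (ε * x0 + 1) - w * x0)) * this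
  have hAp : A xp = 0 := by rw [hAfac]; ring
  have hmono := aux_mono U w ε x0 xp hw1 hw2 hU hs hε hx0
    (fun x h1 h2 => by rw [← hAdef]; exact hApos x h1 h2) hrq
  have hmono' : ∀ x y, x0 ≤ x → x < y → y < xp → C x / A x ^ 2 < C y / A y ^ 2 := by
    intro x y h1 h2 h3
    have := hmono ⟨h1, h2.trans h3⟩ ⟨h1.trans h2.le, h3⟩ h2
    simpa only [hAdef, hCdef] using this
  have hcont : ContinuousOn (fun x => A x ^ 2 - 4 * C x) (Set.Icc x0 xp) := by
    simp only [hAdef, hCdef]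
    fun_prop
  have hA0 := hApos x0 hx0 hx0p
  have hmem : (0:ℝ) ∈ Set.Ioo (A xp ^ 2 - 4 * C xp) (A x0 ^ 2 - 4 * C x0) := by
    constructor
    · rw [hAp]; have := hCpos xp hx0p le_rfl; nlinarith
    · rw [hC0]; have : 0 < A x0 ^ 2 := by positivity
      linarith
  obtain ⟨xs, ⟨hs1, hs2⟩, hs3⟩ := intermediate_value_Ioo' hx0p.le hcont hmem
  simp only at hs3
  have hAs := hApos xs (hx0.trans hs1) hs2
  have hratio : C xs / A xs ^ 2 = 1 / 4 := by
    rw [div_eq_iff (by positivity)]; linarith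
  refine ⟨xs, hs1, hs2, ?_, ⟨hA0, hC0⟩, ⟨hAs, hCpos xs hs1 hs2.le, hs3⟩, ?_, ?_⟩
  · intro x h1 h2
    have hAx := hApos x (hx0.trans h1) (h2.trans hs2)
    refine ⟨hAx, hCpos x h1 (h2.trans hs2).le, ?_⟩
    have := hmono' x xs h1.le h2 hs2
    rw [hratio, div_lt_iff₀ (by positivity)] at this
    linarith
  · intro x h1 h2
    have hAx := hApos x ((hx0.trans hs1).trans h1) h2
    have := hmono' xs x hs1.le h1 h2
    rw [hratio, lt_div_iff₀ (by positivity)] at this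
    linarith
  · intro x h1
    refine ⟨?_, hrq x (hx0p.trans_le h1)⟩
    rw [hAfac]
    apply mul_nonpos_of_nonpos_of_nonneg (by linarith)
    have : 0 < x := hxp.trans_le h1
    positivity

/-- Under (N0), `d > 0`, `ε ≥ ε_*(d)`, `(u² − 2uv)²(ε²+1) ≥ 1` and `K⁰(ε) < K⁺`:
there is `K_* ∈ (K⁰(ε), K⁺)` such that for integers `k`, the quartic
`ω⁴ + (p_k² − s² − 2r_k)ω² + r_k² − q_k² = 0` has exactly two distinct positive
roots `ω_k^±` when `K⁰(ε) < k < K_*`, exactly one positive root when `k = K⁰(ε)`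
(namely `ω_k⁺`) or `k = K_*` (where `ω_k⁺ = ω_k⁻`), and no positive root when
`k > K_*`. -/
theorem two_positive_roots_between_K0_and_Kstar
    (a b d ε : ℝ) (ha : 0 < a) (hb : 0 < b) (hd : 0 < d) (hεpos : 0 < ε)
    (u v : ℝ) (hu : u = a + b) (hv : v = b / (a + b) ^ 2)
    (hN0 : u ^ 2 > 2 * u * v - 1 ∧ 2 * u * v - 1 > 0)
    (εs : ℕ → ℝ → ℝ)
    (hεs : ∀ (k : ℕ) (d' : ℝ), εs k d' =
      ((2 * u * v - 1) * d' * (k : ℝ) ^ 2 * Real.pi ^ 2 - u ^ 2) /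
        (d' * (k : ℝ) ^ 2 * Real.pi ^ 2 * (d' * (k : ℝ) ^ 2 * Real.pi ^ 2 + u ^ 2)))
    (dkk : ℕ → ℝ)
    (hdkk : ∀ k : ℕ, dkk k =
      u ^ 2 / (2 * Real.pi ^ 2 * (2 * u * v - 1)) *
        (1 / (k : ℝ) ^ 2 + 1 / ((k : ℝ) + 1) ^ 2 +
          Real.sqrt ((1 / (k : ℝ) ^ 2 + 1 / ((k : ℝ) + 1) ^ 2) ^ 2 +
            4 * (2 * u * v - 1) / ((k : ℝ) ^ 2 * ((k : ℝ) + 1) ^ 2))))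
    (εP : ℝ → ℝ)
    (hεP1 : ∀ x : ℝ, dkk 1 ≤ x → εP x = εs 1 x)
    (hεPk : ∀ k : ℕ, 2 ≤ k → ∀ x : ℝ, dkk k ≤ x → x < dkk (k - 1) → εP x = εs k x)
    (hε : εP d ≤ ε)
    (p r q : ℝ → ℝ) (s : ℝ)
    (hp : ∀ k : ℝ, p k = (ε + 1) * d * k ^ 2 * Real.pi ^ 2 + 1)
    (hr : ∀ k : ℝ, r k = ε * d ^ 2 * k ^ 4 * Real.pi ^ 4 + d * k ^ 2 * Real.pi ^ 2)
    (hs : s = u ^ 2 - 2 * u * v)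
    (hq : ∀ k : ℝ, q k = (ε * u ^ 2 - 2 * u * v) * d * k ^ 2 * Real.pi ^ 2 + u ^ 2)
    (K0 Kp : ℝ)
    (hK0 : K0 = 1 / (Real.sqrt (2 * ε * d) * Real.pi) *
      Real.sqrt ((ε * u ^ 2 - 2 * u * v - 1) +
        Real.sqrt ((ε * u ^ 2 - 2 * u * v - 1) ^ 2 + 4 * ε * u ^ 2)))
    (hKp : Kp = 1 / (Real.pi * Real.sqrt ((ε ^ 2 + 1) * d)) *
      Real.sqrt (-ε + Real.sqrt ((u ^ 2 - 2 * u * v) ^ 2 * (ε ^ 2 + 1) - 1)))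
    (hcase : (u ^ 2 - 2 * u * v) ^ 2 * (ε ^ 2 + 1) ≥ 1 ∧ K0 < Kp)
    (ωp ωm : ℝ → ℝ)
    (hωp : ∀ k : ℝ, ωp k = Real.sqrt 2 / 2 *
      Real.sqrt (s ^ 2 - p k ^ 2 + 2 * r k +
        Real.sqrt ((s ^ 2 - p k ^ 2 + 2 * r k) ^ 2 - 4 * (r k ^ 2 - q k ^ 2))))
    (hωm : ∀ k : ℝ, ωm k = Real.sqrt 2 / 2 *
      Real.sqrt (s ^ 2 - p k ^ 2 + 2 * r k -
        Real.sqrt ((s ^ 2 - p k ^ 2 + 2 * r k) ^ 2 - 4 * (r k ^ 2 - q k ^ 2)))) :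
    ∃ Kstar : ℝ, K0 < Kstar ∧ Kstar < Kp ∧
      ∀ k : ℕ,
        ((K0 < (k : ℝ) ∧ (k : ℝ) < Kstar) →
          ωm (k : ℝ) ≠ ωp (k : ℝ) ∧ 0 < ωm (k : ℝ) ∧ 0 < ωp (k : ℝ) ∧
            (ωm (k : ℝ) ^ 4 + (p (k : ℝ) ^ 2 - s ^ 2 - 2 * r (k : ℝ)) * ωm (k : ℝ) ^ 2 +
              r (k : ℝ) ^ 2 - q (k : ℝ) ^ 2 = 0) ∧
            (ωp (k : ℝ) ^ 4 + (p (k : ℝ) ^ 2 - s ^ 2 - 2 * r (k : ℝ)) * ωp (k : ℝ) ^ 2 +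
              r (k : ℝ) ^ 2 - q (k : ℝ) ^ 2 = 0) ∧
            (∀ ω : ℝ, 0 < ω →
              ω ^ 4 + (p (k : ℝ) ^ 2 - s ^ 2 - 2 * r (k : ℝ)) * ω ^ 2 +
                r (k : ℝ) ^ 2 - q (k : ℝ) ^ 2 = 0 →
              ω = ωm (k : ℝ) ∨ ω = ωp (k : ℝ))) ∧
        ((k : ℝ) = K0 →
          0 < ωp (k : ℝ) ∧
            (ωp (k : ℝ) ^ 4 + (p (k : ℝ) ^ 2 - s ^ 2 - 2 * r (k : ℝ)) * ωp (k : ℝ) ^ 2 +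
              r (k : ℝ) ^ 2 - q (k : ℝ) ^ 2 = 0) ∧
            (∀ ω : ℝ, 0 < ω →
              ω ^ 4 + (p (k : ℝ) ^ 2 - s ^ 2 - 2 * r (k : ℝ)) * ω ^ 2 +
                r (k : ℝ) ^ 2 - q (k : ℝ) ^ 2 = 0 →
              ω = ωp (k : ℝ))) ∧
        ((k : ℝ) = Kstar →
          ωp (k : ℝ) = ωm (k : ℝ) ∧ 0 < ωp (k : ℝ) ∧
            (ωp (k : ℝ) ^ 4 + (p (k : ℝ) ^ 2 - s ^ 2 - 2 * r (k : ℝ)) * ωp (k : ℝ) ^ 2 +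
              r (k : ℝ) ^ 2 - q (k : ℝ) ^ 2 = 0) ∧
            (∀ ω : ℝ, 0 < ω →
              ω ^ 4 + (p (k : ℝ) ^ 2 - s ^ 2 - 2 * r (k : ℝ)) * ω ^ 2 +
                r (k : ℝ) ^ 2 - q (k : ℝ) ^ 2 = 0 →
              ω = ωp (k : ℝ))) ∧
        (Kstar < (k : ℝ) →
          ∀ ω : ℝ, 0 < ω →
            ω ^ 4 + (p (k : ℝ) ^ 2 - s ^ 2 - 2 * r (k : ℝ)) * ω ^ 2 +
              r (k : ℝ) ^ 2 - q (k : ℝ) ^ 2 ≠ 0) := by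
  have hab : 0 < a + b := by linarith
  have hu0 : 0 < u := by rw [hu]; exact hab
  obtain ⟨U, hU⟩ : ∃ U, U = u ^ 2 := ⟨_, rfl⟩
  obtain ⟨w, hw⟩ : ∃ w, w = 2 * u * v := ⟨_, rfl⟩
  have hU0 : 0 < U := by rw [hU]; positivity
  have hw2 : w < 2 := by
    have : w = 2 * b / (a + b) := by
      rw [hw, hu, hv]; field_simp
    rw [this, div_lt_iff₀ hab]; linarith
  simp only [← hU, ← hw] at *
  have hw1 : 1 < w := by linarith [hN0.2]
  have hπ := Real.pi_pos
  obtain ⟨t, ht⟩ : ∃ t, t = d * Real.pi ^ 2 := ⟨_, rfl⟩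
  have ht0 : 0 < t := by rw [ht]; positivity
  -- Turing condition
  have hturing : ∀ k : ℕ, 1 ≤ k →
      (w - 1) * (t * (k:ℝ)^2) - U ≤ ε * (t * (k:ℝ)^2 * (t * (k:ℝ)^2 + U)) := by
    have hεs' : ∀ k : ℕ, εs k d =
        ((w - 1) * (t * (k:ℝ)^2) - U) / (t * (k:ℝ)^2 * (t * (k:ℝ)^2 + U)) := by
      intro k
      rw [hεs, ht]
      congr 1 <;> ring
    intro k hk
    refine aux_turing U (w - 1) t ε hU0 (by linarith) ht0 (fun k => dkk k ≤ d) ?_ ?_ ?_ k hk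
    · intro k hk
      have hkR : (1:ℝ) ≤ k := by exact_mod_cast hk
      show dkk k ≤ d ↔ _
      rw [hdkk, aux_dkk U (w - 1) d _ _ _ hU0 (by linarith) hd (by positivity) (by positivity)
        (by positivity), ht]
      have e1 : d * (k:ℝ) ^ 2 * Real.pi ^ 2 = d * Real.pi ^ 2 * (k:ℝ) ^ 2 := by ring
      have e2 : d * ((k:ℝ) + 1) ^ 2 * Real.pi ^ 2 = d * Real.pi ^ 2 * ((k:ℝ) + 1) ^ 2 := by ring
      rw [e1, e2]
    · intro h
      rw [← hεs', ← hεP1 d h]; exact hε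
    · intro k hk h h'
      rw [← hεs', ← hεPk k hk d h (not_le.1 h')]; exact hε
  have hR0 : 0 < (ε * U - w - 1) + Real.sqrt ((ε * U - w - 1) ^ 2 + 4 * ε * U) := by
    have h1 : |ε * U - w - 1| < Real.sqrt ((ε * U - w - 1) ^ 2 + 4 * ε * U) := by
      rw [← Real.sqrt_sq_eq_abs]
      apply Real.sqrt_lt_sqrt (sq_nonneg _)
      have : 0 < 4 * ε * U := by positivity
      linarith
    linarith [neg_abs_le (ε * U - w - 1)]
  have hK0pos : 0 < K0 := by
    rw [hK0]
    have := Real.sqrt_pos.2 hR0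
    positivity
  have hx0 : t * K0 ^ 2 =
      ((ε * U - w - 1) + Real.sqrt ((ε * U - w - 1) ^ 2 + 4 * ε * U)) / (2 * ε) := by
    rw [hK0, mul_pow, Real.sq_sqrt hR0.le, div_pow, mul_pow, Real.sq_sqrt (by positivity), ht]
    field_simp
  have hKppos : 0 < Kp := hK0pos.trans hcase.2
  have hRp : 0 < -ε + Real.sqrt ((U - w) ^ 2 * (ε ^ 2 + 1) - 1) := by
    by_contra hcon
    rw [Real.sqrt_eq_zero_of_nonpos (not_lt.1 hcon), mul_zero] at hKp
    linarith
  have hxp : t * Kp ^ 2 =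
      (-ε + Real.sqrt ((U - w) ^ 2 * (ε ^ 2 + 1) - 1)) / (ε ^ 2 + 1) := by
    rw [hKp, mul_pow, Real.sq_sqrt hRp.le, div_pow, mul_pow, Real.sq_sqrt (by positivity), ht]
    field_simp
  have e0 : ε * (t * K0 ^ 2) ^ 2 - (ε * U - w - 1) * (t * K0 ^ 2) - U = 0 := by
    rw [hx0]
    have h : Real.sqrt ((ε * U - w - 1) ^ 2 + 4 * ε * U) ^ 2 = (ε * U - w - 1) ^ 2 + 4 * ε * U :=
      Real.sq_sqrt (by positivity)
    generalize Real.sqrt _ = R at h ⊢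
    field_simp
    linear_combination h
  have ep : (ε ^ 2 + 1) * (t * Kp ^ 2) ^ 2 + 2 * ε * (t * Kp ^ 2) + 1 - (U - w) ^ 2 = 0 := by
    rw [hxp]
    have h : Real.sqrt ((U - w) ^ 2 * (ε ^ 2 + 1) - 1) ^ 2 = (U - w) ^ 2 * (ε ^ 2 + 1) - 1 :=
      Real.sq_sqrt (by linarith [hcase.1])
    generalize Real.sqrt _ = R at h ⊢
    field_simp
    linear_combination h
  have hmonoX : ∀ x y : ℝ, 0 ≤ x → 0 ≤ y → (t * x ^ 2 < t * y ^ 2 ↔ x < y) := by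
    intro x y hx hy
    rw [mul_lt_mul_iff_right₀ ht0, pow_lt_pow_iff_left₀ hx hy two_ne_zero]
  obtain ⟨A, hAdef⟩ : ∃ A : ℝ → ℝ, A = fun x => (U - w) ^ 2 - x ^ 2 - (ε * x + 1) ^ 2 := ⟨_, rfl⟩
  obtain ⟨C, hCdef⟩ : ∃ C : ℝ → ℝ,
    C = fun x => (x * (ε * x + 1)) ^ 2 - (U * (ε * x + 1) - w * x) ^ 2 := ⟨_, rfl⟩
  obtain ⟨xs, h0s, hsp, hlt', h0, hxs, hgt', hge'⟩ := aux_core2 U w ε (t * K0 ^ 2) (t * Kp ^ 2)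
    hw1 hw2 hU0 (by linarith [hN0.1]) hεpos (by positivity)
    ((hmonoX K0 Kp hK0pos.le hKppos.le).2 hcase.2) e0 ep
    A C (fun x => by rw [hAdef]) (fun x => by rw [hCdef])
  have hAk : ∀ k : ℝ, s ^ 2 - p k ^ 2 + 2 * r k = A (t * k ^ 2) := by
    intro k; rw [hs, hp, hr, hAdef, ht]; ring
  have hCk : ∀ k : ℝ, r k ^ 2 - q k ^ 2 = C (t * k ^ 2) := by
    intro k; rw [hr, hq, hCdef, ht]; ring
  simp only [hAk, hCk] at hωp hωm
  have hpoly : ∀ k ω : ℝ, ω ^ 4 + (p k ^ 2 - s ^ 2 - 2 * r k) * ω ^ 2 + r k ^ 2 - q k ^ 2 =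
      ω ^ 4 - A (t * k ^ 2) * ω ^ 2 + C (t * k ^ 2) := by
    intro k ω; rw [← hAk, ← hCk]; ring
  simp only [hpoly]
  have hxs0 : 0 < xs := lt_trans (by positivity) h0s
  have hKs : t * Real.sqrt (xs / t) ^ 2 = xs := by
    rw [Real.sq_sqrt (by positivity)]; field_simp
  have hKs0 := Real.sqrt_nonneg (xs / t)
  generalize Real.sqrt (xs / t) = Ks at hKs hKs0
  refine ⟨Ks, ?_, ?_, ?_⟩
  · rw [← hmonoX K0 Ks hK0pos.le hKs0, hKs]; exact h0s
  · rw [← hmonoX Ks Kp hKs0 hKppos.le, hKs]; exact hsp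
  intro k
  have hk0 : (0:ℝ) ≤ k := Nat.cast_nonneg k
  refine ⟨?_, ?_, ?_, ?_⟩
  · rintro ⟨h1, h2⟩
    rw [← hmonoX _ _ hK0pos.le hk0] at h1
    rw [← hmonoX _ _ hk0 hKs0, hKs] at h2
    obtain ⟨hA, hC, hD⟩ := hlt' _ h1 h2
    obtain ⟨r1, r2, r3, r4, r5, r6, r7⟩ := aux_roots _ _ _ _ _ rfl (hωp k) (hωm k) hA hC.le hD.le
    have hsq := Real.sqrt_pos.2 hD
    refine ⟨?_, ?_, r1, r6, r5, r7⟩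
    · intro he
      rw [he] at r4
      linarith
    · rcases r2.lt_or_eq with h | h
      · exact h
      · rw [← h] at r6
        norm_num at r6
        linarith
  · intro h1
    rw [← h1] at h0
    obtain ⟨hA, hC⟩ := h0
    obtain ⟨r1, r2, r3, r4, r5, r6, r7⟩ := aux_roots _ _ _ _ _ rfl (hωp k) (hωm k) hA hC.ge
      (by rw [hC]; nlinarith [sq_nonneg (A (t * (k:ℝ) ^ 2))])
    refine ⟨r1, r5, fun ω hω h => ?_⟩
    rcases r7 ω hω h with h' | h'
    · exfalso
      rw [hC, mul_zero, sub_zero, Real.sqrt_sq hA.le, sub_self, zero_div, ← h'] at r4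
      have : 0 < ω ^ 2 := by positivity
      linarith
    · exact h'
  · intro h1
    rw [← hKs, ← h1] at hxs
    obtain ⟨hA, hC, hD⟩ := hxs
    obtain ⟨r1, r2, r3, r4, r5, r6, r7⟩ := aux_roots _ _ _ _ _ rfl (hωp k) (hωm k) hA hC.le hD.ge
    have he : ωp k = ωm k := by rw [hωp, hωm, hD]; simp
    refine ⟨he, r1, r5, fun ω hω h => ?_⟩
    rcases r7 ω hω h with h' | h'
    · rw [he]; exact h'
    · exact h'
  · intro h1 ω hω h
    rw [← hmonoX _ _ hKs0 hk0, hKs] at h1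
    rcases lt_or_ge (t * (k:ℝ) ^ 2) (t * Kp ^ 2) with h2 | h2
    · have hD := hgt' _ h1 h2
      nlinarith [sq_nonneg (2 * ω ^ 2 - A (t * (k:ℝ) ^ 2))]
    · obtain ⟨hA, hrq⟩ := hge' _ h2
      have hk1 : 1 ≤ k := by
        rcases Nat.eq_zero_or_pos k with hk | hk
        · exfalso
          rw [hk] at h1
          norm_num at h1
          linarith
        · exact hk
      have hT := hturing k hk1
      have hC : 0 ≤ C (t * (k:ℝ) ^ 2) := by
        rw [hCdef]
        simp only
        generalize t * (k:ℝ) ^ 2 = x at *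
        have : 0 ≤ x * (ε * x + 1) + (U * (ε * x + 1) - w * x) := by linarith
        have := mul_nonneg hrq.le this
        linarith
      have h4 : 0 < ω ^ 4 := by positivity
      have h5 : 0 ≤ -A (t * (k:ℝ) ^ 2) * ω ^ 2 := mul_nonneg (by linarith) (by positivity)
      linarith
end

section
/- Fix d>0, ε>0 and an integer k ≥ 0. Suppose ω > 0 satisfies ω⁴ + (p_k² − s² − 2r_k)ω² + r_k² − q_k² = 0, with 2ω² ≥ s² − p_k² + 2r_k and (s² − p_k² + 2r_k)² − 4(r_k² − q_k²) > 0 (i.e., ω = ω_k⁺ is the larger positive root), and τ₀ > 0 satisfies D_k(iω, τ₀, ε) = 0. If λ : (τ₀ − δ, τ₀ + δ) → ℂ is a differentiable function with λ(τ₀) = iω and D_k(λ(τ), τ, ε) = 0 for all τ in this interval, then Re λ'(τ₀) > 0 (transversality of the Hopf bifurcation). -/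
/-- Hopf transversality: if `ω = ω_k⁺` is the larger positive root of the quartic,
`τ₀ > 0` satisfies `D_k(iω, τ₀, ε) = 0`, and `lam` is a differentiable branch of
roots of `D_k(·, τ, ε) = 0` near `τ₀` with `lam τ₀ = iω`, then
`Re lam'(τ₀) > 0`. -/
theorem hopf_transversality
    (a b d ε : ℝ) (ha : 0 < a) (hb : 0 < b) (hd : 0 < d) (hεpos : 0 < ε)
    (u v : ℝ) (hu : u = a + b) (hv : v = b / (a + b) ^ 2)
    (k : ℕ)
    (p r q s : ℝ)
    (hp : p = (ε + 1) * d * (k : ℝ) ^ 2 * Real.pi ^ 2 + 1)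
    (hr : r = ε * d ^ 2 * (k : ℝ) ^ 4 * Real.pi ^ 4 + d * (k : ℝ) ^ 2 * Real.pi ^ 2)
    (hs : s = u ^ 2 - 2 * u * v)
    (hq : q = (ε * u ^ 2 - 2 * u * v) * d * (k : ℝ) ^ 2 * Real.pi ^ 2 + u ^ 2)
    (D : ℂ → ℝ → ℂ)
    (hD : ∀ (lam : ℂ) (τ : ℝ),
      D lam τ = lam ^ 2 + (p : ℂ) * lam + (r : ℂ) +
        ((s : ℂ) * lam + (q : ℂ)) * Complex.exp (-lam * (τ : ℂ)))
    (ω : ℝ) (hω : 0 < ω)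
    (hquartic : ω ^ 4 + (p ^ 2 - s ^ 2 - 2 * r) * ω ^ 2 + r ^ 2 - q ^ 2 = 0)
    (hlarger : 2 * ω ^ 2 ≥ s ^ 2 - p ^ 2 + 2 * r)
    (hdisc : (s ^ 2 - p ^ 2 + 2 * r) ^ 2 - 4 * (r ^ 2 - q ^ 2) > 0)
    (τ₀ : ℝ) (hτ₀ : 0 < τ₀)
    (hroot : D (Complex.I * (ω : ℂ)) τ₀ = 0)
    (δ : ℝ) (hδ : 0 < δ)
    (lam : ℝ → ℂ)
    (hdiff : ∀ τ ∈ Set.Ioo (τ₀ - δ) (τ₀ + δ), DifferentiableAt ℝ lam τ)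
    (hlam₀ : lam τ₀ = Complex.I * (ω : ℂ))
    (hbranch : ∀ τ ∈ Set.Ioo (τ₀ - δ) (τ₀ + δ), D (lam τ) τ = 0) :
    0 < (deriv lam τ₀).re := by
  have hmem : τ₀ ∈ Set.Ioo (τ₀ - δ) (τ₀ + δ) := ⟨by linarith, by linarith⟩
  have hL : HasDerivAt lam (deriv lam τ₀) τ₀ := (hdiff τ₀ hmem).hasDerivAt
  set μ := deriv lam τ₀ with hμ
  have hT : HasDerivAt (fun τ : ℝ => (τ : ℂ)) 1 τ₀ := Complex.ofRealCLM.hasDerivAt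
  have hE := (hL.neg.mul hT).cexp
  have hF := (((hL.mul hL).add (hL.const_mul (p : ℂ))).add_const (r : ℂ)).add
    (((hL.const_mul (s : ℂ)).add_const (q : ℂ)).mul hE)
  have hZ := hF.congr_of_eventuallyEq (f₁ := fun _ => (0 : ℂ)) (by
    filter_upwards [Ioo_mem_nhds hmem.1 hmem.2] with τ hτ
    have h := hbranch τ hτ
    rw [hD] at h
    simp only [Pi.add_apply, Pi.mul_apply, Pi.neg_apply]
    rw [← h]; ring)
  have h0 := hZ.unique (hasDerivAt_const τ₀ (0 : ℂ))
  simp only [Pi.add_apply, Pi.mul_apply, Pi.neg_apply, hlam₀] at h0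
  rw [hD] at hroot
  have hppos : 0 < p := by rw [hp]; positivity
  have hI : Complex.I ^ 2 = -1 := Complex.I_sq
  generalize Complex.exp (-(Complex.I * (ω : ℂ)) * (τ₀ : ℂ)) = E at h0 hroot
  clear_value μ
  set N : ℝ := (r - ω ^ 2) ^ 2 + (p * ω) ^ 2 with hN
  have hNpos : 0 < N := by positivity
  have hNQ : N = q ^ 2 + (s * ω) ^ 2 := by rw [hN]; linarith
  have hNc : (N : ℂ) = ((r : ℂ) - ω ^ 2) ^ 2 + (p * ω) ^ 2 := by rw [hN]; push_cast; ring
  have hNQc : (N : ℂ) = (q : ℂ) ^ 2 + (s * ω) ^ 2 := by rw [hNQ]; push_cast; ring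
  have hNne : (N : ℂ) ≠ 0 := by exact_mod_cast hNpos.ne'
  have hK : 0 < 2 * ω ^ 2 - (s ^ 2 - p ^ 2 + 2 * r) := by
    rcases (sub_nonneg.mpr hlarger).lt_or_eq with h | h
    · exact h
    · exfalso; nlinarith
  clear_value N
  obtain ⟨P, hP⟩ : ∃ P : ℂ, P = r - ω ^ 2 + Complex.I * (p * ω) := ⟨_, rfl⟩
  obtain ⟨Pb, hPb⟩ : ∃ P : ℂ, P = r - ω ^ 2 - Complex.I * (p * ω) := ⟨_, rfl⟩
  obtain ⟨Q, hQ⟩ : ∃ P : ℂ, P = q + Complex.I * (s * ω) := ⟨_, rfl⟩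
  obtain ⟨Qb, hQb⟩ : ∃ P : ℂ, P = q - Complex.I * (s * ω) := ⟨_, rfl⟩
  have hPP : P * Pb = N := by rw [hP, hPb, hNc]; linear_combination (-(p * ω : ℂ) ^ 2) * hI
  have hQQ : Q * Qb = N := by rw [hQ, hQb, hNQc]; linear_combination (-(s * ω : ℂ) ^ 2) * hI
  have hQE : Q * E = -P := by
    rw [hP, hQ]; linear_combination hroot - (ω : ℂ) ^ 2 * hI
  have h1 : (2 * (Complex.I * ω) + p + s * E - τ₀ * (Q * E)) * μ = Complex.I * ω * (Q * E) := by
    rw [hQ]; linear_combination h0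
  rw [hQE] at h1
  have h2 : ((2 * (Complex.I * ω) + p) * Q - s * P + τ₀ * P * Q) * μ
      = -(Complex.I * ω * P * Q) := by
    linear_combination Q * h1 - s * μ * hQE
  have h3 : ((2 * (Complex.I * ω) + p) * Pb - s * Qb + τ₀ * N) * μ = -(Complex.I * ω * N) := by
    apply mul_left_cancel₀ hNne
    have e1 : (N : ℂ) * (((2 * (Complex.I * ω) + p) * Pb - s * Qb + τ₀ * N) * μ)
      = Pb * Qb * (((2 * (Complex.I * ω) + p) * Q - s * P + τ₀ * P * Q) * μ) := by
      have a1 : (N : ℂ) * (((2 * (Complex.I * ω) + p) * Pb - s * Qb + τ₀ * N) * μ)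
        = ((2 * (Complex.I * ω) + p) * Pb * N - s * Qb * N + τ₀ * N * N) * μ := by ring
      rw [a1]
      nth_rewrite 1 [← hQQ]
      nth_rewrite 1 [← hPP]
      nth_rewrite 1 [← hQQ]
      rw [← hPP]
      ring
    rw [e1, h2]
    have a2 : (N : ℂ) * -(Complex.I * ω * N) = -(Complex.I * ω * (N * N)) := by ring
    rw [a2]
    nth_rewrite 1 [← hQQ]
    rw [← hPP]; ring
  rw [hPb, hQb] at h3
  obtain ⟨X, hX⟩ : ∃ X : ℝ, X = p * (r - ω ^ 2) + 2 * p * ω ^ 2 - s * q + τ₀ * N := ⟨_, rfl⟩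
  obtain ⟨K, hKd⟩ : ∃ K : ℝ, K = 2 * ω ^ 2 - (s ^ 2 - p ^ 2 + 2 * r) := ⟨_, rfl⟩
  rw [← hKd] at hK
  have h4 : ((X : ℂ) - Complex.I * (ω * K : ℝ)) * μ = -(Complex.I * (ω * N : ℝ)) := by
    rw [hX, hKd]; push_cast
    linear_combination h3 + 2 * p * ω ^ 2 * μ * hI
  have hre := congrArg Complex.re h4
  have him := congrArg Complex.im h4
  simp only [Complex.mul_re, Complex.mul_im, Complex.sub_re, Complex.sub_im, Complex.ofReal_re,
    Complex.ofReal_im, Complex.I_re, Complex.I_im, Complex.neg_re, Complex.neg_im] at hre him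
  have h5 : μ.re * (X ^ 2 + (ω * K) ^ 2) = ω ^ 2 * N * K := by
    linear_combination X * hre - ω * K * him
  have h6 : 0 < ω ^ 2 * N * K := by positivity
  rw [← h5] at h6
  exact pos_of_mul_pos_left h6 (by positivity)
end
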